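/- If H is a semisimple Hopf algebra over a field of characteristic zero, then the order of the evaluation form e in the group of invertible elements of the convolution algebra D(H)* is equal to the exponent of H. In particular, the order of e divides (dim H)^3. -/

import Mathlib

open TensorProduct LinearMap Coalgebra

noncomputable section

variable (K H : Type*) [Field K] [Ring H] [HopfAlgebra K H] [FiniteDimensional K H]

/-- The comultiplication on the dual space `H* = Hom_K(H, K)` of a finite-dimensional
Hopf algebra: the dual of the multiplication of `H`.  It is characterized by
`φ₍₁₎(h) φ₍₂₎(h') = φ(h h')`. -/
def dualComul : Module.Dual K H →ₗ[K] Module.Dual K H ⊗[K] Module.Dual K H :=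
  (TensorProduct.dualDistribEquiv K H H).symm.toLinearMap ∘ₗ (LinearMap.mul' K H).dualMap

/-- The dual space `H*` as a coalgebra (in the structural sense needed to speak of
Sweedler representations `φ₍₁₎ ⊗ φ₍₂₎` of elements of `H*`): the comultiplication is
dual to the multiplication of `H` and the counit is evaluation at `1`. -/
instance dualCoalgebraStruct : CoalgebraStruct K (Module.Dual K H) where
  comul := dualComul K H
  counit := LinearMap.applyₗ (1 : H)

/-- The convolution product on `H*`: `(φ * ψ)(h) = φ(h₍₁₎) ψ(h₍₂₎)`. -/
def convMul (φ ψ : Module.Dual K H) : Module.Dual K H :=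
  LinearMap.mul' K K ∘ₗ TensorProduct.map φ ψ ∘ₗ Coalgebra.comul

/-- The evaluation form `e : D(H) = H* ⊗ H → K`, `φ ⊗ h ↦ φ(h)`, on the underlying
vector space `H* ⊗ H` of the Drinfel'd double. -/
def evalForm : (Module.Dual K H ⊗[K] H) →ₗ[K] K :=
  TensorProduct.lift LinearMap.id

/-- The comultiplication of the Drinfel'd double `D(H) = H* ⊗ H`:
`Δ(φ ⊗ h) = (φ₍₂₎ ⊗ h₍₁₎) ⊗ (φ₍₁₎ ⊗ h₍₂₎)` (as a coalgebra, `D(H)` is `H*^cop ⊗ H`). -/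
def comulD : (Module.Dual K H ⊗[K] H) →ₗ[K]
    (Module.Dual K H ⊗[K] H) ⊗[K] (Module.Dual K H ⊗[K] H) :=
  (TensorProduct.tensorTensorTensorComm K (Module.Dual K H) (Module.Dual K H) H H).toLinearMap
    ∘ₗ TensorProduct.map
        ((TensorProduct.comm K (Module.Dual K H) (Module.Dual K H)).toLinearMap ∘ₗ dualComul K H)
        Coalgebra.comul

/-- The counit of the Drinfel'd double, `ε(φ ⊗ h) = φ(1) ε(h)`; it is the unit of the
convolution algebra `D(H)*`. -/
def counitD : (Module.Dual K H ⊗[K] H) →ₗ[K] K :=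
  TensorProduct.lift <| LinearMap.mk₂ K (fun φ h => φ 1 * Coalgebra.counit h)
    (by intros; simp [add_mul]) (by intros; simp [smul_eq_mul]; ring)
    (by intros; simp [mul_add]) (by intros; simp [smul_eq_mul]; ring)

/-- The convolution product on the dual `D(H)*` of the Drinfel'd double:
`(f * g)(x) = f(x₍₁₎) g(x₍₂₎)`, with respect to the double's comultiplication. -/
def convD (f g : (Module.Dual K H ⊗[K] H) →ₗ[K] K) : (Module.Dual K H ⊗[K] H) →ₗ[K] K :=
  LinearMap.mul' K K ∘ₗ TensorProduct.map f g ∘ₗ comulD K H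

end

/-- Convolution powers of the evaluation form in `D(H)*`: `e⁰` is the unit (the counit
of `D(H)`) and `e^(m+1) = e^m * e`. -/
noncomputable def evalFormPow (K H : Type*) [Field K] [Ring H] [HopfAlgebra K H]
    [FiniteDimensional K H] : ℕ → ((Module.Dual K H ⊗[K] H) →ₗ[K] K)
  | 0 => counitD K H
  | n + 1 => convD K H (evalFormPow K H n) (evalForm K H)

/-- The `m`-th "reversed Sweedler power" `h ↦ h₍ₘ₎ h₍ₘ₋₁₎ ⋯ h₍₁₎`, where
`h₍₁₎ ⊗ ⋯ ⊗ h₍ₘ₎` is the iterated comultiplication: for `m = 0` it is `ε(h)1`, and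
inductively `h ↦ ∑ h₍₂₎ * (reversed (m)-power of h₍₁₎)`. -/
noncomputable def revSweedlerPow (K H : Type*) [Field K] [Ring H] [HopfAlgebra K H] :
    ℕ → (H →ₗ[K] H)
  | 0 => Algebra.linearMap K H ∘ₗ Coalgebra.counit
  | n + 1 => LinearMap.mul' K H ∘ₗ (TensorProduct.comm K H H).toLinearMap
      ∘ₗ (revSweedlerPow K H n).rTensor H ∘ₗ Coalgebra.comul

/-- The `m`-th Sweedler power `h ↦ h₍₁₎ h₍₂₎ ⋯ h₍ₘ₎`, where `h₍₁₎ ⊗ ⋯ ⊗ h₍ₘ₎` is the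
iterated comultiplication: for `m = 0` it is `ε(h)1`, and inductively
`h ↦ ∑ h₍₁₎ * ((m)-th power of h₍₂₎)`. -/
noncomputable def sweedlerPow (K H : Type*) [Field K] [Ring H] [HopfAlgebra K H] :
    ℕ → (H →ₗ[K] H)
  | 0 => Algebra.linearMap K H ∘ₗ Coalgebra.counit
  | n + 1 => LinearMap.mul' K H ∘ₗ (sweedlerPow K H n).lTensor H ∘ₗ Coalgebra.comul


section

open TensorProduct LinearMap Coalgebra
namespace HP
set_option linter.unusedSectionVars false

/-- Linear functions, unbundled, for automation. -/
@[fun_prop]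
def Lin (K : Type*) {V W : Type*} [Field K] [AddCommGroup V] [Module K V] [AddCommGroup W]
    [Module K W] (f : V → W) : Prop := ∃ g : V →ₗ[K] W, ∀ x, f x = g x

section lin
variable {K V W X : Type*} [Field K] [AddCommGroup V] [Module K V] [AddCommGroup W]
    [Module K W] [AddCommGroup X] [Module K X]

theorem Lin.map_add {f : V → W} (hf : Lin K f) (x y : V) : f (x + y) = f x + f y := by
  obtain ⟨g, hg⟩ := hf; simp [hg]
theorem Lin.map_smul {f : V → W} (hf : Lin K f) (c : K) (x : V) : f (c • x) = c • f x := by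
  obtain ⟨g, hg⟩ := hf; simp [hg]
theorem Lin.map_zero {f : V → W} (hf : Lin K f) : f 0 = 0 := by
  obtain ⟨g, hg⟩ := hf; simp [hg]
theorem Lin.map_sum {f : V → W} (hf : Lin K f) {ι : Type*} (s : Finset ι) (u : ι → V) :
    f (∑ i ∈ s, u i) = ∑ i ∈ s, f (u i) := by
  obtain ⟨g, hg⟩ := hf; simp [hg]
theorem Lin.mk' {f : V → W} (h1 : ∀ x y, f (x + y) = f x + f y)
    (h2 : ∀ (c : K) x, f (c • x) = c • f x) : Lin K f :=
  ⟨{ toFun := f, map_add' := h1, map_smul' := h2 }, fun _ => rfl⟩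

@[fun_prop] theorem lin_id : Lin K (fun x : V => x) := ⟨LinearMap.id, fun _ => rfl⟩
@[fun_prop] theorem lin_zero : Lin K (fun _ : V => (0 : W)) := ⟨0, fun _ => rfl⟩
@[fun_prop] theorem lin_comp {f : W → X} {g : V → W} (hf : Lin K f) (hg : Lin K g) :
    Lin K (fun x => f (g x)) := by
  obtain ⟨a, ha⟩ := hf; obtain ⟨b, hb⟩ := hg
  exact ⟨a ∘ₗ b, fun x => by simp [ha, hb]⟩
@[fun_prop] theorem lin_map (g : W →ₗ[K] X) {f : V → W} (hf : Lin K f) :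
    Lin K (fun x => g (f x)) := by
  obtain ⟨a, ha⟩ := hf
  exact ⟨g ∘ₗ a, fun x => by simp [ha]⟩
@[fun_prop] theorem lin_map_equiv (g : W ≃ₗ[K] X) {f : V → W} (hf : Lin K f) :
    Lin K (fun x => g (f x)) := by
  obtain ⟨a, ha⟩ := hf
  exact ⟨g.toLinearMap ∘ₗ a, fun x => by simp [ha]⟩
@[fun_prop] theorem lin_app {f : V → (W →ₗ[K] X)} (hf : Lin K f) (w : W) :
    Lin K (fun x => f x w) := by
  obtain ⟨a, ha⟩ := hf
  exact ⟨LinearMap.flip a w, fun x => by simp [ha]⟩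
@[fun_prop] theorem lin_algHom {A B : Type*} [Ring A] [Algebra K A] [Ring B] [Algebra K B]
    (g : A →ₐ[K] B) {f : V → A} (hf : Lin K f) :
    Lin K (fun x => g (f x)) := by
  obtain ⟨a, ha⟩ := hf
  exact ⟨g.toLinearMap ∘ₗ a, fun x => by simp [ha]⟩
@[fun_prop] theorem lin_add {f g : V → W} (hf : Lin K f) (hg : Lin K g) :
    Lin K (fun x => f x + g x) := by
  obtain ⟨a, ha⟩ := hf; obtain ⟨b, hb⟩ := hg
  exact ⟨a + b, fun x => by simp [ha, hb]⟩
@[fun_prop] theorem lin_sub {f g : V → W} (hf : Lin K f) (hg : Lin K g) :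
    Lin K (fun x => f x - g x) := by
  obtain ⟨a, ha⟩ := hf; obtain ⟨b, hb⟩ := hg
  exact ⟨a - b, fun x => by simp [ha, hb]⟩
@[fun_prop] theorem lin_const_smul (c : K) {g : V → W} (hg : Lin K g) :
    Lin K (fun x => c • g x) := by
  obtain ⟨b, hb⟩ := hg
  exact ⟨c • b, fun x => by simp [hb]⟩
@[fun_prop] theorem lin_smul_const {c : V → K} (hc : Lin K c) (w : W) :
    Lin K (fun x => c x • w) := by
  obtain ⟨b, hb⟩ := hc
  exact ⟨b.smulRight w, fun x => by simp [hb]⟩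
@[fun_prop] theorem lin_sum {ι : Type*} (s : Finset ι) {f : V → ι → W}
    (hf : ∀ i, Lin K (fun x => f x i)) : Lin K (fun x => ∑ i ∈ s, f x i) := by
  choose g hg using hf
  exact ⟨∑ i ∈ s, g i, fun x => by simp [hg]⟩
@[fun_prop] theorem lin_mul_const {A : Type*} [Ring A] [Algebra K A] {f : V → A}
    (hf : Lin K f) (c : A) : Lin K (fun x => f x * c) := by
  obtain ⟨b, hb⟩ := hf
  exact ⟨LinearMap.mulRight K c ∘ₗ b, fun x => by simp [hb]⟩
@[fun_prop] theorem lin_const_mul {A : Type*} [Ring A] [Algebra K A] {f : V → A}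
    (hf : Lin K f) (c : A) : Lin K (fun x => c * f x) := by
  obtain ⟨b, hb⟩ := hf
  exact ⟨LinearMap.mulLeft K c ∘ₗ b, fun x => by simp [hb]⟩
@[fun_prop] theorem lin_tmul_const {f : V → W} (hf : Lin K f) (c : X) :
    Lin K (fun x => f x ⊗ₜ[K] c) := by
  obtain ⟨b, hb⟩ := hf
  exact ⟨(TensorProduct.mk K W X).flip c ∘ₗ b, fun x => by simp [hb]⟩
@[fun_prop] theorem lin_const_tmul {f : V → W} (hf : Lin K f) (c : X) :
    Lin K (fun x => c ⊗ₜ[K] f x) := by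
  obtain ⟨b, hb⟩ := hf
  exact ⟨TensorProduct.mk K X W c ∘ₗ b, fun x => by simp [hb]⟩

/-- `toLin` bundles. -/
noncomputable def toLin (f : V → W) (hf : Lin K f) : V →ₗ[K] W :=
  { toFun := f, map_add' := hf.map_add, map_smul' := fun c x => by simpa using hf.map_smul c x }
@[simp] theorem toLin_apply (f : V → W) (hf : Lin K f) (x : V) : toLin f hf x = f x := rfl
end lin

section sw
variable {K H E : Type*} [Field K] [Ring H] [HopfAlgebra K H] [FiniteDimensional K H]
  [AddCommGroup E] [Module K E]

local notation "ε" => Coalgebra.counit (R := K) (A := H)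
local notation "S" => HopfAlgebra.antipode K (A := H)

variable (K H) in
/-- the fixed basis -/
noncomputable def bs : Module.Basis (Fin (Module.finrank K H)) K H := Module.finBasis K H

/-- structure constants of the comultiplication -/
noncomputable def cf (h : H) (i j : Fin (Module.finrank K H)) : K :=
  ((bs K H).tensorProduct (bs K H)).repr (comul (R := K) h) (i, j)

variable (K) in
/-- Sweedler sums -/
noncomputable def sw (h : H) (F : H → H → E) : E :=
  ∑ i, ∑ j, cf (K := K) h i j • F (bs K H i) (bs K H j)

theorem sw_eq (h : H) (Φ : H ⊗[K] H →ₗ[K] E) :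
    sw K h (fun a b => Φ (a ⊗ₜ b)) = Φ (comul h) := by
  have := ((bs K H).tensorProduct (bs K H)).sum_repr (comul (R := K) h)
  conv_rhs => rw [← this]
  rw [map_sum, Fintype.sum_prod_type]
  simp [sw, cf]

theorem sw_comul (h : H) : sw K h (fun a b => a ⊗ₜ b) = comul (R := K) h := by
  simpa using sw_eq (K := K) h (LinearMap.id)

theorem sw_map {E' : Type*} [AddCommGroup E'] [Module K E'] (g : E → E') (hg : Lin K g)
    (h : H) (F : H → H → E) : g (sw K h F) = sw K h (fun a b => g (F a b)) := by
  simp [sw, hg.map_sum, hg.map_smul]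

theorem map_sw {E' : Type*} [AddCommGroup E'] [Module K E'] (g : E →ₗ[K] E')
    (h : H) (F : H → H → E) : g (sw K h F) = sw K h (fun a b => g (F a b)) :=
  sw_map g (by fun_prop) h F

theorem algHom_sw {A B : Type*} [Ring A] [Algebra K A] [Ring B] [Algebra K B] (g : A →ₐ[K] B)
    (h : H) (F : H → H → A) : g (sw K h F) = sw K h (fun a b => g (F a b)) :=
  sw_map g (by fun_prop) h F

theorem mul_sw {A : Type*} [Ring A] [Algebra K A] (x : A)
    (h : H) (F : H → H → A) : x * (sw K h F) = sw K h (fun a b => x * (F a b)) :=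
  sw_map (fun y => x * y) (by fun_prop) h F
theorem sw_mul {A : Type*} [Ring A] [Algebra K A] (x : A)
    (h : H) (F : H → H → A) : (sw K h F) * x = sw K h (fun a b => (F a b) * x) :=
  sw_map (fun y => y * x) (by fun_prop) h F
theorem smul_sw (c : K) (h : H) (F : H → H → E) :
    c • (sw K h F) = sw K h (fun a b => c • (F a b)) :=
  sw_map (fun y => c • y) (by fun_prop) h F
theorem sw_smul (h : H) (F : H → H → K) (x : E) :
    (sw K h F) • x = sw K h (fun a b => (F a b) • x) :=
  sw_map (fun y => y • x) (by fun_prop) h F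
theorem tmul_sw {W : Type*} [AddCommGroup W] [Module K W] (x : W)
    (h : H) (F : H → H → E) : x ⊗ₜ[K] (sw K h F) = sw K h (fun a b => x ⊗ₜ[K] (F a b)) :=
  sw_map (fun y => x ⊗ₜ[K] y) (by fun_prop) h F
theorem sw_tmul {W : Type*} [AddCommGroup W] [Module K W] (x : W)
    (h : H) (F : H → H → E) : (sw K h F) ⊗ₜ[K] x = sw K h (fun a b => (F a b) ⊗ₜ[K] x) :=
  sw_map (fun y => y ⊗ₜ[K] x) (by fun_prop) h F
theorem sw_app {V W : Type*} [AddCommGroup W] [Module K W] [AddCommGroup V] [Module K V] (x : W)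
    (h : H) (F : H → H → (W →ₗ[K] V)) : (sw K h F) x = sw K h (fun a b => (F a b) x) :=
  sw_map (fun y => y x) (by fun_prop) h F
theorem sw_sum {ι : Type*} (s : Finset ι) (h : H) (F : ι → H → H → E) :
    ∑ i ∈ s, sw K h (F i) = sw K h (fun a b => ∑ i ∈ s, F i a b) := by
  simp only [sw]
  rw [Finset.sum_comm]
  refine Finset.sum_congr rfl fun i _ => ?_
  rw [Finset.sum_comm]
  simp [Finset.smul_sum]
theorem sw_add (h : H) (F G : H → H → E) :
    sw K h F + sw K h G = sw K h (fun a b => F a b + G a b) := by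
  simp [sw, Finset.sum_add_distrib]

theorem sw_comm {H' : Type*} [Ring H'] [HopfAlgebra K H'] [FiniteDimensional K H']
    (h : H) (k : H') (F : H → H → H' → H' → E) :
    sw K h (fun a b => sw K k (fun c d => F a b c d)) =
      sw K k (fun c d => sw K h (fun a b => F a b c d)) := by
  conv_lhs => rw [sw]
  simp only [smul_sw, sw_sum]
  rfl

theorem lin_cf (i j) : Lin K (fun h : H => cf (K := K) h i j) :=
  ⟨((bs K H).tensorProduct (bs K H)).coord (i, j) ∘ₗ comul, fun x => by simp [cf]⟩

@[fun_prop] theorem lin_sw_left {V : Type*} [AddCommGroup V] [Module K V] {f : V → H}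
    (hf : Lin K f) (F : H → H → E) :
    Lin K (fun x => sw K (f x) F) := by
  unfold sw
  have := lin_cf (K := K) (H := H)
  fun_prop

@[fun_prop] theorem lin_sw_right {V : Type*} [AddCommGroup V] [Module K V] (h : H)
    {F : V → H → H → E} (hF : ∀ a b, Lin K (fun x => F x a b)) :
    Lin K (fun x => sw K h (F x)) := by
  unfold sw
  fun_prop

theorem lin_expand {f : H → E} (hf : Lin K f) (x : H) :
    f x = ∑ i, (bs K H).repr x i • f (bs K H i) := by
  conv_lhs => rw [← (bs K H).sum_repr x]
  rw [hf.map_sum]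
  exact Finset.sum_congr rfl fun i _ => hf.map_smul _ _

/-- bilinear evaluation -/
theorem sw_lift (F : H → H → E) (h1 : ∀ b, Lin K (fun a => F a b))
    (h2 : ∀ a, Lin K (fun b => F a b)) :
    ∃ Φ : H ⊗[K] H →ₗ[K] E, ∀ a b, F a b = Φ (a ⊗ₜ b) :=
  ⟨TensorProduct.lift (LinearMap.mk₂ K F (fun a a' b => (h1 b).map_add a a')
    (fun c a b => (h1 b).map_smul c a) (fun a b b' => (h2 a).map_add b b')
    (fun c a b => (h2 a).map_smul c b)), fun a b => by simp⟩

theorem coassoc (h : H) (F : H → H → H → E) :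
    sw K h (fun a b => sw K a (fun a1 a2 => F a1 a2 b)) =
      sw K h (fun a b => sw K b (fun b1 b2 => F a b1 b2)) := by
  let B := (bs K H).tensorProduct ((bs K H).tensorProduct (bs K H))
  let Φ : H ⊗[K] (H ⊗[K] H) →ₗ[K] E := B.constr K
    (fun i => F (bs K H i.1) (bs K H i.2.1) (bs K H i.2.2))
  have hΦ : ∀ i j k, F (bs K H i) (bs K H j) (bs K H k)
      = Φ (bs K H i ⊗ₜ (bs K H j ⊗ₜ bs K H k)) := by
    intro i j k
    have := B.constr_basis K (fun i => F (bs K H i.1) (bs K H i.2.1) (bs K H i.2.2)) (i, j, k)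
    simp only [B, Module.Basis.tensorProduct_apply] at this
    exact this.symm
  have key : sw K h (fun a b => sw K a (fun a1 a2 => Φ (a1 ⊗ₜ (a2 ⊗ₜ b)))) =
      sw K h (fun a b => sw K b (fun b1 b2 => Φ (a ⊗ₜ (b1 ⊗ₜ b2)))) := by
    simp only [← map_sw, ← tmul_sw, sw_comul]
    congr 1
    rw [show (sw K h fun a b => a ⊗ₜ[K] comul (R := K) b) = _ from
      sw_eq h ((comul (R := K) (A := H)).lTensor H), ← Coalgebra.coassoc_apply, ← sw_comul h]
    simp only [map_sw, rTensor_tmul, ← sw_comul, sw_tmul, TensorProduct.assoc_tmul,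
      LinearEquiv.coe_coe, sw_map _ (lin_map_equiv _ lin_id)]
  simpa only [sw, hΦ] using key

theorem sw_counit_left (h : H) (F : H → E) (hF : Lin K F := by fun_prop) :
    sw K h (fun a b => ε a • F b) = F h := by
  obtain ⟨g, hg⟩ := hF
  have := sw_eq (K := K) h (g ∘ₗ (TensorProduct.lid K H).toLinearMap ∘ₗ
    (Coalgebra.counit (R := K) (A := H)).rTensor H)
  simp only [comp_apply, Coalgebra.rTensor_counit_comul] at this
  simpa [hg] using this
theorem sw_counit_right (h : H) (F : H → E) (hF : Lin K F := by fun_prop) :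
    sw K h (fun a b => ε b • F a) = F h := by
  obtain ⟨g, hg⟩ := hF
  have := sw_eq (K := K) h (g ∘ₗ (TensorProduct.rid K H).toLinearMap ∘ₗ
    (Coalgebra.counit (R := K) (A := H)).lTensor H)
  simp only [comp_apply, Coalgebra.lTensor_counit_comul] at this
  simpa [hg] using this
theorem sw_S_left (h : H) (F : H → E) (hF : Lin K F := by fun_prop) :
    sw K h (fun a b => F (S a * b)) = ε h • F 1 := by
  obtain ⟨g, hg⟩ := hF
  have := sw_eq (K := K) h (g ∘ₗ LinearMap.mul' K H ∘ₗ
    (HopfAlgebra.antipode K (A := H)).rTensor H)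
  simp only [comp_apply, HopfAlgebra.mul_antipode_rTensor_comul_apply] at this
  simpa [hg, Algebra.algebraMap_eq_smul_one] using this
theorem sw_S_right (h : H) (F : H → E) (hF : Lin K F := by fun_prop) :
    sw K h (fun a b => F (a * S b)) = ε h • F 1 := by
  obtain ⟨g, hg⟩ := hF
  have := sw_eq (K := K) h (g ∘ₗ LinearMap.mul' K H ∘ₗ
    (HopfAlgebra.antipode K (A := H)).lTensor H)
  simp only [comp_apply, HopfAlgebra.mul_antipode_lTensor_comul_apply] at this
  simpa [hg, Algebra.algebraMap_eq_smul_one] using this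
theorem sw_one (F : H → H → E) (h1 : ∀ b, Lin K (fun a => F a b))
    (h2 : ∀ a, Lin K (fun b => F a b)) : sw K 1 F = F 1 1 := by
  obtain ⟨Φ, hΦ⟩ := sw_lift F h1 h2
  have : F = fun a b => Φ (a ⊗ₜ b) := by ext a b; exact hΦ a b
  rw [this, sw_eq, Bialgebra.comul_one]; rfl
theorem sw_prod (x y : H) (F : H → H → E) (h1 : ∀ b, Lin K (fun a => F a b))
    (h2 : ∀ a, Lin K (fun b => F a b)) : sw K (x * y) F =
      sw K x (fun a b => sw K y (fun c d => F (a * c) (b * d))) := by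
  obtain ⟨Φ, hΦ⟩ := sw_lift F h1 h2
  have : F = fun a b => Φ (a ⊗ₜ b) := by ext a b; exact hΦ a b
  rw [this, sw_eq, Bialgebra.comul_mul]
  rw [← sw_comul x, ← sw_comul y]
  simp only [sw_mul, mul_sw, map_sw, Algebra.TensorProduct.tmul_mul_tmul]
  exact sw_comm ..
theorem sw_congr (h : H) {F G : H → H → E} (hFG : ∀ a b, F a b = G a b) : sw K h F = sw K h G := by
  congr; ext; exact hFG _ _
theorem sw_anti (h : H) (F : H → H → E) (h1 : ∀ b, Lin K (fun a => F a b))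
    (h2 : ∀ a, Lin K (fun b => F a b)) : sw K (S h) F = sw K h (fun a b => F (S b) (S a)) := by
  obtain ⟨Φ, hΦ⟩ := sw_lift F h1 h2
  have : F = fun a b => Φ (a ⊗ₜ b) := by ext a b; exact hΦ a b
  subst this
  rw [sw_eq, ← map_sw]
  congr 1
  have e1 : ∀ x : H, sw K x (fun a b => comul (R := K) (S a) * comul (R := K) b) = ε x • 1 := by
    intro x
    simp only [← Bialgebra.comul_mul]
    rw [sw_S_left x (fun y => comul (R := K) y) (by fun_prop), Bialgebra.comul_one]
  have e2 : ∀ x : H, sw K x (fun a b => comul (R := K) a * sw K b (fun c d => S d ⊗ₜ[K] S c))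
      = ε x • 1 := by
    intro x
    simp only [← sw_comul, sw_mul, mul_sw, Algebra.TensorProduct.tmul_mul_tmul]
    have := fun a : H => coassoc (K := K) a (fun b1 c d => (x * S d) ⊗ₜ[K] (b1 * S c))
    calc _ = sw K x (fun a b => sw K a fun a1 a2 => sw K b fun c d =>
            (a1 * S d) ⊗ₜ[K] (a2 * S c)) := sw_congr x fun a b => by rw [sw_comm]
      _ = sw K x (fun a b => sw K b fun b1 b2 => sw K b2 fun c d =>
            (a * S d) ⊗ₜ[K] (b1 * S c)) := coassoc x _
      _ = sw K x (fun a b => sw K b fun u d => sw K u fun b1 c =>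
            (a * S d) ⊗ₜ[K] (b1 * S c)) := sw_congr x fun a b => (coassoc b _).symm
      _ = sw K x (fun a b => (a * S b) ⊗ₜ[K] 1) := sw_congr x fun a b => by
            rw [← sw_counit_left b (fun b => (a * S b) ⊗ₜ[K] (1 : H)) (by fun_prop)]
            refine sw_congr _ fun u d => ?_
            rw [sw_S_right u (fun y => (a * S d) ⊗ₜ[K] y) (by fun_prop)]
      _ = _ := by
            rw [sw_S_right x (fun y => y ⊗ₜ[K] (1 : H)) (by fun_prop)]; rfl
  calc comul (R := K) (S h) = sw K h (fun a b => ε b • comul (R := K) (S a)) :=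
        (sw_counit_right h (fun a => comul (R := K) (S a)) (by fun_prop)).symm
    _ = sw K h (fun a b => sw K b fun b1 b2 => comul (R := K) (S a) * (comul (R := K) b1
          * sw K b2 (fun c d => S d ⊗ₜ[K] S c))) := by
        refine sw_congr _ fun a b => ?_
        rw [← mul_sw, e2]; simp
    _ = sw K h (fun a b => sw K a fun a1 a2 => comul (R := K) (S a1) * (comul (R := K) a2
          * sw K b (fun c d => S d ⊗ₜ[K] S c))) := by rw [coassoc]
    _ = sw K h (fun a b => ε a • sw K b (fun c d => S d ⊗ₜ[K] S c)) := by
        refine sw_congr _ fun a b => ?_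
        simp only [← mul_assoc]
        rw [← sw_mul, e1]; simp
    _ = _ := sw_counit_left h _ (by fun_prop)

variable (K) in
/-- contraction over a basis and its dual basis -/
noncomputable def db (F : H → Module.Dual K H → E) : E := ∑ i, F (bs K H i) ((bs K H).coord i)

theorem db_congr {F G : H → Module.Dual K H → E} (h : ∀ y q, F y q = G y q) : db K F = db K G := by
  congr; ext; exact h _ _
theorem db_eval (x : H) (F : H → E) (hF : Lin K F := by fun_prop) :
    db K (fun y q => q x • F y) = F x := by
  rw [lin_expand hF x]; rfl
theorem db_eval' (p : Module.Dual K H) (F : Module.Dual K H → E) (hF : Lin K F := by fun_prop) :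
    db K (fun y q => p y • F q) = F p := by
  have : p = ∑ i, p (bs K H i) • (bs K H).coord i := by
    refine (bs K H).ext fun j => ?_
    simp [Finsupp.single_apply]
  conv_rhs => rw [this, hF.map_sum]
  exact Finset.sum_congr rfl fun i _ => (hF.map_smul _ _).symm
theorem db_map {E' : Type*} [AddCommGroup E'] [Module K E'] (g : E → E')
    (F : H → Module.Dual K H → E) (hg : Lin K g := by fun_prop) :
    g (db K F) = db K (fun y q => g (F y q)) := by
  simp [db, hg.map_sum]
theorem db_sw {H' : Type*} [Ring H'] [HopfAlgebra K H'] [FiniteDimensional K H']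
    (h : H') (F : H → Module.Dual K H → H' → H' → E) :
    db K (fun y q => sw K h (fun a b => F y q a b)) =
      sw K h (fun a b => db K (fun y q => F y q a b)) := by
  simp only [db, sw_sum]
theorem db_db {H' : Type*} [Ring H'] [HopfAlgebra K H'] [FiniteDimensional K H']
    (F : H → Module.Dual K H → H' → Module.Dual K H' → E) :
    db K (fun y q => db K (fun z r => F y q z r)) =
      db K (fun z r => db K (fun y q => F y q z r)) := by
  simp only [db]; rw [Finset.sum_comm]
theorem db_adj (f : H →ₗ[K] H) (F : H → Module.Dual K H → E)
    (h1 : ∀ b, Lin K (fun a => F a b) := by fun_prop)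
    (h2 : ∀ a, Lin K (fun b => F a b) := by fun_prop) :
    db K (fun y q => F (f y) q) = db K (fun y q => F y (q ∘ₗ f)) := by
  have e1 : ∀ y q, F (f y) q = db K (fun z r => r (f y) • F z q) := fun y q =>
    (db_eval (f y) (fun z => F z q) (h1 q)).symm
  have e2 : ∀ y (q : Module.Dual K H), F y (q ∘ₗ f) = db K (fun z r => q (f z) • F y r) :=
    fun y q => (db_eval' (q ∘ₗ f) (fun r => F y r) (h2 y)).symm
  simp only [e1, e2]
  rw [db_db]
theorem trace_eq (f : H →ₗ[K] H) : LinearMap.trace K H f = db K (fun y q => q (f y)) := by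
  rw [LinearMap.trace_eq_matrix_trace K (bs K H)]
  simp [Matrix.trace, LinearMap.toMatrix_apply, db]
@[fun_prop] theorem lin_db {V : Type*} [AddCommGroup V] [Module K V]
    {F : V → H → Module.Dual K H → E} (hF : ∀ a b, Lin K (fun x => F x a b)) :
    Lin K (fun x => db K (F x)) := by
  unfold db
  fun_prop
end sw
end HP
end

section

open TensorProduct LinearMap Coalgebra
namespace HP
set_option linter.unusedSectionVars false
section P1
variable {K H E : Type*} [Field K] [Ring H] [HopfAlgebra K H] [FiniteDimensional K H]
  [AddCommGroup E] [Module K E]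

local notation "ε" => Coalgebra.counit (R := K) (A := H)
local notation "S" => HopfAlgebra.antipode K (A := H)

variable (K) in
/-- normalized two-sided integral -/
structure IsInt (Λ : H) : Prop where
  l : ∀ h : H, h * Λ = Coalgebra.counit (R := K) h • Λ
  r : ∀ h : H, Λ * h = Coalgebra.counit (R := K) h • Λ
  e : Coalgebra.counit (R := K) Λ = 1

variable (K H) in
/-- the twisted trace functional -/
noncomputable def lam : H →ₗ[K] K :=
  LinearMap.trace K H ∘ₗ LinearMap.lcomp K H (S ∘ₗ S) ∘ₗ LinearMap.mul K H

theorem lam_apply (x : H) : lam K H x = LinearMap.trace K H (LinearMap.mulLeft K x ∘ₗ S ∘ₗ S) := rfl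

theorem lam_db (x : H) : lam K H x = db K (fun y q => q (x * S (S y))) := by
  rw [lam_apply, trace_eq]; rfl

theorem S_mul (x y : H) : S (x * y) = S y * S x := HopfAlgebra.antipode_mul_antidistrib x y
theorem S_one : S (1 : H) = 1 := HopfAlgebra.antipode_one
theorem eps_S (x : H) : ε (S x) = ε x := HopfAlgebra.counit_antipode x

theorem sw_S2_left (h : H) (F : H → E) (hF : Lin K F := by fun_prop) :
    sw K h (fun a b => F (S (S b) * S a)) = ε h • F 1 := by
  rw [← S_one (K := K), ← sw_S_right h (fun y => F (S y)) ]
  simp only [S_mul]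

theorem lam_int (x : H) : sw K x (fun a b => lam K H b • a) = lam K H x • 1 := by
  calc sw K x (fun a b => lam K H b • a)
      = db K (fun y q => sw K x (fun a b => q (b * S (S y)) • a)) := by
        rw [db_sw]; refine sw_congr _ fun a b => ?_
        rw [lam_db, db_map (fun c => c • a)]
    _ = db K (fun y q => sw K y (fun y1 y2 => sw K (x * S (S y2)) (fun z1 z2 =>
          q z2 • (z1 * S y1)))) := by
        refine db_congr fun y q => ?_
        symm
        calc _ = sw K y (fun y1 y2 => sw K x (fun a b => sw K y2 (fun c d =>
                q (b * S (S d)) • (a * (S (S c)) * S y1)))) := by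
              refine sw_congr _ fun y1 y2 => ?_
              rw [sw_prod _ _ _ (by fun_prop) (by fun_prop)]
              refine sw_congr _ fun a b => ?_
              rw [sw_anti _ _ (by fun_prop) (by fun_prop), sw_anti _ _ (by fun_prop) (by fun_prop)]
          _ = sw K x (fun a b => sw K y (fun y1 y2 => sw K y1 (fun c d => 
                q (b * S (S y2)) • (a * (S (S d) * S c))))) := by
              rw [sw_comm]
              refine sw_congr _ fun a b => ?_
              rw [coassoc]
              simp only [mul_assoc]
          _ = _ := by
              refine sw_congr _ fun a b => ?_
              rw [← sw_counit_left (K := K) y (fun y => q (b * S (S y)) • a)]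
              refine sw_congr _ fun c d => ?_
              rw [sw_S2_left c (fun y => q (b * S (S d)) • (a * y))]
              simp
    _ = db K (fun z r => sw K z (fun z1 z2 => sw K z2 (fun y1 y2 => 
          r (x * S (S y2)) • (z1 * S y1)))) := by
        have e1 : ∀ (y : H) (q : Module.Dual K H), sw K y (fun y1 y2 => sw K (x * S (S y2))
            (fun z1 z2 => q z2 • (z1 * S y1))) = db K (fun z r => sw K z (fun z1 z2 => 
            q z2 • sw K y (fun y1 y2 => r (x * S (S y2)) • (z1 * S y1)))) := by
          intro y q
          calc _ = sw K y (fun y1 y2 => db K (fun z r => r (x * S (S y2)) •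
                  sw K z (fun z1 z2 => q z2 • (z1 * S y1)))) := by
                refine sw_congr _ fun y1 y2 => ?_
                rw [db_eval (x * S (S y2)) (fun z => sw K z (fun z1 z2 => q z2 • (z1 * S y1)))]
            _ = _ := by
                rw [← db_sw]
                refine db_congr fun z r => ?_
                simp only [smul_sw]
                rw [sw_comm]
                refine sw_congr _ fun a b => sw_congr _ fun c d => ?_
                rw [smul_comm]
        simp only [e1]
        rw [db_db]
        refine db_congr fun z r => ?_
        rw [db_sw]
        refine sw_congr _ fun z1 z2 => ?_
        rw [db_eval z2 (fun y => sw K y (fun y1 y2 => r (x * S (S y2)) • (z1 * S y1)))]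
    _ = db K (fun z r => r (x * S (S z)) • 1) := by
        refine db_congr fun z r => ?_
        rw [← coassoc, ← sw_counit_left (K := K) z (fun z => r (x * S (S z)) • (1 : H))]
        refine sw_congr _ fun a b => ?_
        rw [sw_S_right a (fun y => r (x * S (S b)) • y)]
    _ = _ := by rw [lam_db, db_map (fun c => c • (1 : H))]

theorem lam_nak (x y : H) : lam K H (x * y) = lam K H (y * S (S x)) := by
  rw [lam_apply, lam_apply]
  have e1 : LinearMap.mulLeft K (x * y) ∘ₗ S ∘ₗ S =
    LinearMap.mulLeft K x ∘ₗ (LinearMap.mulLeft K y ∘ₗ S ∘ₗ S) := by ext; simp [mul_assoc]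
  have e2 : LinearMap.mulLeft K (y * S (S x)) ∘ₗ S ∘ₗ S =
    (LinearMap.mulLeft K y ∘ₗ S ∘ₗ S) ∘ₗ LinearMap.mulLeft K x := by
      ext; simp [mul_assoc, S_mul]
  rw [e1, e2, LinearMap.trace_comp_comm']

variable {Λ : H} (hΛ : IsInt K Λ)
include hΛ

theorem S_inj_aux : True := trivial

theorem lam_Λ : lam K H Λ = 1 := by
  rw [lam_db]
  simp only [hΛ.r, eps_S]
  have : ∀ (y : H) (q : Module.Dual K H), q (ε y • Λ) = ε y • q Λ := by intros; simp
  simp only [this]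
  rw [db_eval' (ε) (fun q => q Λ)]
  exact hΛ.e

theorem Λ_mul_left (x : H) (F : H → H → E) (h1 : ∀ b, Lin K (fun a => F a b) := by fun_prop)
    (h2 : ∀ a, Lin K (fun b => F a b) := by fun_prop) :
    sw K Λ (fun a b => F a (x * b)) = sw K Λ (fun a b => F (S x * a) b) := by
  symm
  calc sw K Λ (fun a b => F (S x * a) b)
      = sw K x (fun x1 x2 => ε x2 • sw K Λ (fun a b => F (S x1 * a) b)) := by
        rw [sw_counit_right x (fun x => sw K Λ (fun a b => F (S x * a) b))]
    _ = sw K x (fun x1 x2 => sw K (x2 * Λ) (fun a b => F (S x1 * a) b)) := by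
        refine sw_congr _ fun a b => ?_
        rw [hΛ.l, (lin_sw_left (K := K) lin_id _).map_smul]
    _ = sw K x (fun x1 x2 => sw K x2 (fun c d => sw K Λ (fun a b => F (S x1 * c * a) (d * b)))) := by
        refine sw_congr _ fun a b => ?_
        rw [sw_prod _ _ _ (by fun_prop) (by fun_prop)]
        simp only [mul_assoc]
    _ = sw K x (fun x1 x2 => sw K x1 (fun c d => sw K Λ (fun a b => F (S c * d * a) (x2 * b)))) := by
        rw [coassoc]
    _ = _ := by
        rw [← sw_counit_left (K := K) x (fun x => sw K Λ (fun a b => F a (x * b)))]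
        refine sw_congr _ fun c d => ?_
        rw [sw_S_left c (fun y => sw K Λ (fun a b => F (y * a) (d * b)))]
        simp

theorem Λ_mul_right (x : H) (F : H → H → E) (h1 : ∀ b, Lin K (fun a => F a b) := by fun_prop)
    (h2 : ∀ a, Lin K (fun b => F a b) := by fun_prop) :
    sw K Λ (fun a b => F (a * x) b) = sw K Λ (fun a b => F a (b * S x)) := by
  symm
  calc sw K Λ (fun a b => F a (b * S x))
      = sw K x (fun x1 x2 => ε x1 • sw K Λ (fun a b => F a (b * S x2))) := by
        rw [sw_counit_left x (fun x => sw K Λ (fun a b => F a (b * S x)))]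
    _ = sw K x (fun x1 x2 => sw K (Λ * x1) (fun a b => F a (b * S x2))) := by
        refine sw_congr _ fun a b => ?_
        rw [hΛ.r, (lin_sw_left (K := K) lin_id _).map_smul]
    _ = sw K x (fun x1 x2 => sw K x1 (fun c d => sw K Λ (fun a b => F (a * c) (b * (d * S x2))))) := by
        refine sw_congr _ fun a b => ?_
        rw [sw_prod _ _ _ (by fun_prop) (by fun_prop), sw_comm]
        simp only [mul_assoc]
    _ = sw K x (fun x1 x2 => sw K x2 (fun c d => sw K Λ (fun a b => F (a * x1) (b * (c * S d))))) := by
        rw [coassoc]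
    _ = _ := by
        rw [← sw_counit_right (K := K) x (fun x => sw K Λ (fun a b => F (a * x) b))]
        refine sw_congr _ fun c d => ?_
        rw [sw_S_right d (fun y => sw K Λ (fun a b => F (a * c) (b * y)))]
        simp

theorem S_eq (x : H) : S x = sw K Λ (fun a b => lam K H (x * b) • a) := by
  rw [Λ_mul_left hΛ x (fun a b => lam K H b • a)]
  have := lam_int (K := K) Λ
  rw [lam_Λ hΛ, one_smul] at this
  have e : ∀ a b, lam K H b • (S x * a) = S x * (lam K H b • a) := by intros; simp
  simp only [e]
  rw [← mul_sw, this, mul_one]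

theorem eq_S (x : H) : x = sw K Λ (fun a b => lam K H (b * S x) • a) := by
  rw [← Λ_mul_right hΛ x (fun a b => lam K H b • a)]
  have := lam_int (K := K) Λ
  rw [lam_Λ hΛ, one_smul] at this
  have e : ∀ a b, lam K H b • (a * x) = (lam K H b • a) * x := by intros; simp
  simp only [e]
  rw [← sw_mul, this, one_mul]

theorem S_inj : Function.Injective S := by
  intro x y h
  rw [eq_S hΛ x, eq_S hΛ y, h]

theorem S_surj : Function.Surjective S :=
  LinearMap.injective_iff_surjective.1 (S_inj hΛ)

theorem SΛ : S Λ = Λ := by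
  have h1 : Λ * S Λ = Λ := by
    rw [hΛ.r, eps_S, hΛ.e, one_smul]
  have h2 : Λ * S Λ = S Λ := by
    obtain ⟨y, hy⟩ := S_surj hΛ Λ
    have e : Λ * S Λ = S y * S Λ := by rw [hy]
    rw [e, ← S_mul, hΛ.r, map_smul, ← eps_S, hy, hΛ.e, one_smul]
  rw [← h2, h1]

/-- nondegeneracy of the legs of `Δ Λ` -/
theorem Λ_nondeg (p q : H →ₗ[K] K) (h : sw K Λ (fun a b => p b • a) = sw K Λ (fun a b => q b • a)) :
    p = q := by
  let f : (H →ₗ[K] K) →ₗ[K] H := toLin (fun p => sw K Λ (fun a b => p b • a)) (by fun_prop)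
  have hs : Function.Surjective f := by
    intro x
    exact ⟨lam K H ∘ₗ LinearMap.mulRight K (S x), (eq_S hΛ x).symm⟩
  have hi : Function.Injective f :=
    (LinearMap.injective_iff_surjective_of_finrank_eq_finrank (Subspace.dual_finrank_eq)).2 hs
  exact hi h

theorem lam_nondeg (x : H) (h : ∀ y, lam K H (x * y) = 0) : x = 0 := by
  apply S_inj hΛ
  rw [S_eq hΛ x, map_zero]
  simp [h, sw]

theorem lam_nondeg' (x : H) (h : ∀ y, lam K H (y * x) = 0) : x = 0 := by
  refine lam_nondeg hΛ x fun y => ?_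
  obtain ⟨y, rfl⟩ := S_surj hΛ y
  obtain ⟨y, rfl⟩ := S_surj hΛ y
  rw [← lam_nak, h]

theorem lam_uniq (ν : H →ₗ[K] K) (hν : ∀ x, sw K x (fun a b => ν b • a) = ν x • 1) :
    ν = ν Λ • lam K H := by
  have : ∀ x, ν ∘ₗ LinearMap.mulLeft K x = (ν Λ • lam K H) ∘ₗ LinearMap.mulLeft K x := by
    intro x
    apply Λ_nondeg hΛ
    have e : ∀ a b, ν b • (S x * a) = S x * (ν b • a) := by intros; simp
    calc sw K Λ (fun a b => ν (x * b) • a) = ν Λ • S x := by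
          rw [Λ_mul_left hΛ x (fun a b => ν b • a)]
          simp only [e]
          rw [← mul_sw, hν]; simp
      _ = _ := by
          rw [S_eq hΛ, smul_sw]
          simp [smul_smul]
  simpa [LinearMap.ext_iff] using this 1

end P1
end HP
end

section

open TensorProduct LinearMap Coalgebra
namespace HP
set_option linter.unusedSectionVars false
section P1
variable {K H E : Type*} [Field K] [Ring H] [HopfAlgebra K H] [FiniteDimensional K H]
  [AddCommGroup E] [Module K E]

local notation "ε" => Coalgebra.counit (R := K) (A := H)
local notation "S" => HopfAlgebra.antipode K (A := H)

theorem dual_ext {V : Type*} [AddCommGroup V] [Module K V] {x y : V}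
    (h : ∀ p : V →ₗ[K] K, p x = p y) : x = y := by
  rw [← sub_eq_zero, ← Module.forall_dual_apply_eq_zero_iff K]
  intro p; rw [map_sub, h, sub_self]

variable (K) in
/-- the modular element -/
noncomputable def gam (Λ : H) : H := sw K Λ (fun a b => lam K H a • b)

variable {Λ : H} (hΛ : IsInt K Λ)
include hΛ

theorem lam_gam (x : H) : sw K x (fun a b => lam K H a • b) = lam K H x • gam K Λ := by
  refine dual_ext (K := K) fun p => ?_
  let ν : H →ₗ[K] K := toLin (fun x => p (sw K x (fun a b => lam K H a • b))) (by fun_prop)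
  have h := lam_uniq hΛ ν (fun x => by
    have e : ∀ y, ν y = sw K y (fun a b => lam K H a * p b) := fun y => by
      simp only [ν, toLin_apply, map_sw, map_smul, smul_eq_mul]
    simp only [e, sw_smul]
    rw [← coassoc x (fun a b1 b2 => (lam K H b1 * p b2) • a)]
    refine sw_congr _ fun a b => ?_
    have e2 : ∀ c d : H, (lam K H d * p b) • c = p b • (lam K H d • c) := by
      intro c d; rw [smul_smul, mul_comm]
    simp only [e2]
    rw [← smul_sw, lam_int, smul_smul, mul_comm])
  have h2 := LinearMap.congr_fun h x
  simp only [ν, toLin_apply, LinearMap.smul_apply] at h2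
  rw [h2, map_smul, smul_eq_mul, smul_eq_mul, mul_comm]; rfl

theorem gam_gl : IsGroupLikeElem K (gam K Λ) where
  counit_eq_one := by
    have e : ∀ a b, ε (lam K H a • b) = ε b • lam K H a := by intros; simp [mul_comm]
    simp only [gam, map_sw, e]
    rw [sw_counit_right Λ (fun a => lam K H a), lam_Λ hΛ]
  comul_eq_tmul_self := by
    calc comul (R := K) (gam K Λ) = sw K Λ (fun a b => sw K b (fun c d => lam K H a • (c ⊗ₜ[K] d))) := by
          simp only [gam, map_sw, map_smul, ← smul_sw, sw_comul]
      _ = sw K Λ (fun a b => (sw K a (fun c d => lam K H c • d)) ⊗ₜ[K] b) := by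
          rw [← coassoc]
          simp only [sw_tmul, smul_tmul']
      _ = _ := by
          simp only [lam_gam hΛ]
          have e : ∀ a b : H, (lam K H a • gam K Λ) ⊗ₜ[K] b = gam K Λ ⊗ₜ[K] (lam K H a • b) :=
            fun a b => by rw [smul_tmul]
          simp only [e]
          rw [← tmul_sw]; rfl

theorem S_gam : S (gam K Λ) * gam K Λ = 1 := (gam_gl hΛ).antipode_mul_cancel
theorem gam_S : gam K Λ * S (gam K Λ) = 1 := (gam_gl hΛ).mul_antipode_cancel

theorem sw_gam (x : H) (F : H → H → E) (h1 : ∀ b, Lin K (fun a => F a b))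
    (h2 : ∀ a, Lin K (fun b => F a b)) :
    sw K (x * gam K Λ) F = sw K x (fun a b => F (a * gam K Λ) (b * gam K Λ)) := by
  rw [sw_prod _ _ _ h1 h2]
  refine sw_congr _ fun a b => ?_
  obtain ⟨Φ, hΦ⟩ := sw_lift F h1 h2
  have : F = fun a b => Φ (a ⊗ₜ b) := by ext a b; exact hΦ a b
  subst this
  have := sw_eq (K := K) (gam K Λ)
    (Φ ∘ₗ TensorProduct.map (LinearMap.mulLeft K a) (LinearMap.mulLeft K b))
  rw [(gam_gl hΛ).comul_eq_tmul_self] at this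
  simpa using this

theorem lam_S_gam (x : H) : lam K H (S x * gam K Λ) = lam K H x := by
  have h1 : ∀ x, sw K x (fun a b => lam K H (a * gam K Λ) • b) = lam K H (x * gam K Λ) • 1 := by
    intro x
    have := lam_gam hΛ (x * gam K Λ)
    rw [sw_gam hΛ _ _ (by fun_prop) (by fun_prop)] at this
    have e := congrArg (fun y => y * S (gam K Λ)) this
    simp only [sw_mul] at e
    simpa [mul_assoc, gam_S hΛ] using e
  let ν : H →ₗ[K] K := toLin (fun x => lam K H (S x * gam K Λ)) (by fun_prop)
  have h := lam_uniq hΛ ν (fun x => by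
    apply S_inj hΛ
    have := h1 (S x)
    rw [sw_anti _ _ (by fun_prop) (by fun_prop)] at this
    simp only [ν, map_sw, toLin_apply, map_smul, S_one]
    exact this)
  have h2 := LinearMap.congr_fun h x
  simp only [ν, toLin_apply, LinearMap.smul_apply] at h2
  rw [h2, SΛ hΛ, hΛ.r, (gam_gl hΛ).counit_eq_one, one_smul, lam_Λ hΛ, one_smul]

theorem radford (X : H) : X * gam K Λ = gam K Λ * S (S (S (S X))) := by
  obtain ⟨x, rfl⟩ := S_surj hΛ X
  rw [← sub_eq_zero]
  refine lam_nondeg' hΛ _ fun y => ?_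
  obtain ⟨y, rfl⟩ := S_surj hΛ y
  rw [mul_sub, map_sub, sub_eq_zero]
  calc lam K H (S y * (S x * gam K Λ)) = lam K H (x * y) := by
        rw [← mul_assoc, ← S_mul, lam_S_gam hΛ]
    _ = lam K H (y * S (S x)) := lam_nak _ _
    _ = lam K H (S (S (S x)) * S y * gam K Λ) := by rw [← S_mul, lam_S_gam hΛ]
    _ = _ := by rw [mul_assoc, lam_nak, mul_assoc]

theorem gam_finite : ∃ N : ℕ, 0 < N ∧ gam K Λ ^ N = 1 := by
  have := (linearIndep_groupLikeVal (R := K) (A := H))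
  have : Finite (GroupLike K H) := this.finite
  obtain ⟨N, hN, h⟩ := isOfFinOrder_iff_pow_eq_one.1 (isOfFinOrder_of_finite (⟨gam K Λ, gam_gl hΛ⟩ : GroupLike K H))
  refine ⟨N, hN, ?_⟩
  have := congrArg GroupLike.val h
  simpa using this

theorem Tr_zero_gam (h : lam K H 1 ≠ 0) : gam K Λ = 1 := by
  have := lam_gam hΛ 1
  rw [sw_one _ (by fun_prop) (by fun_prop)] at this
  exact (smul_right_injective H h this).symm

end P1

section xx
variable {K H E : Type*} [Field K] [Ring H] [HopfAlgebra K H] [FiniteDimensional K H]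
  [AddCommGroup E] [Module K E]

local notation "ε" => Coalgebra.counit (R := K) (A := H)
local notation "S" => HopfAlgebra.antipode K (A := H)

variable (K H) in
/-- the element representing the trace of the coregular representation -/
noncomputable def xx : H := db K (fun y q => sw K y (fun a b => q b • a))

theorem db_sw_cyc (G : H → H → E) (h1 : ∀ b, Lin K (fun a => G a b))
    (h2 : ∀ a, Lin K (fun b => G a b)) :
    db K (fun y q => sw K y (fun a b => sw K b (fun b c => q c • G a b))) =
    db K (fun y q => sw K y (fun a b => sw K b (fun b c => q c • G b a))) := by
  have e : ∀ (G : H → H → E) (_ : ∀ b, Lin K (fun a => G a b))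
    (_ : ∀ a, Lin K (fun b => G a b)), ∀ (y : H) (q : Module.Dual K H),
      sw K y (fun a b => sw K b (fun b c => q c • G a b)) = 
      db K (fun z r => sw K y (fun a b => r b • sw K z (fun b c => q c • G a b))) := by
    intro G _ _ y q
    rw [db_sw]
    refine sw_congr _ fun a b => ?_
    rw [db_eval b (fun z => sw K z (fun b c => q c • G a b))]
  simp only [e _ h1 h2, e (fun a b => G b a) h2 h1]
  rw [db_db]
  refine db_congr fun z r => db_congr fun y q => ?_
  simp only [smul_sw]
  rw [sw_comm]
  refine sw_congr _ fun a b => sw_congr _ fun c d => smul_comm _ _ _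

theorem xx_mul : xx K H * xx K H = (Module.finrank K H : K) • xx K H := by
  have e0 : db K (fun (z : H) r => r z • (1 : K)) = (Module.finrank K H : K) := by
    have := trace_eq (K := K) (H := H) LinearMap.id
    simp only [LinearMap.trace_id, LinearMap.id_apply] at this
    simp [← this]
  calc xx K H * xx K H = db K (fun z r => db K (fun y q => sw K z (fun c d =>
          sw K y (fun a b => (q b * r d) • (a * c))))) := by
        conv_lhs => enter [2]; rw [xx]
        rw [db_map (fun t => xx K H * t)]
        refine db_congr fun z r => ?_
        rw [mul_sw, db_sw]
        refine sw_congr _ fun c d => ?_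
        rw [xx, db_map (fun t => t * (r d • c))]
        refine db_congr fun y q => ?_
        rw [sw_mul]
        simp [smul_smul, mul_comm]
    _ = db K (fun z r => sw K z (fun c d => sw K d (fun d e => r e • db K (fun y q => 
          sw K (y * c) (fun a b => q (b * S d) • a))))) := by
        refine db_congr fun z r => ?_
        symm
        calc _ = sw K z (fun c d => sw K d (fun d e => sw K c (fun c1 c2 => db K (fun y q => 
                sw K y (fun a b => (r e * q (b * (c2 * S d))) • (a * c1)))))) := by
              refine sw_congr _ fun c d => sw_congr _ fun d e => ?_
              rw [← db_sw, db_map (fun t => r e • t)]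
              refine db_congr fun y q => ?_
              rw [sw_prod _ _ _ (by fun_prop) (by fun_prop), smul_sw, sw_comm]
              refine sw_congr _ fun a b => ?_
              rw [smul_sw]
              simp only [mul_assoc, smul_smul]
          _ = sw K z (fun c t => sw K t (fun u e => sw K u (fun c2 d => db K (fun y q =>
                sw K y (fun a b => (r e * q (b * (c2 * S d))) • (a * c)))))) := by
              have h3 : ∀ t : H, ∀ c : H, (sw K t (fun u e => sw K u (fun c2 d => db K (fun y q =>
                sw K y (fun a b => (r e * q (b * (c2 * S d))) • (a * c)))))) = _ := fun t c =>
                coassoc (K := K) t (fun c2 d e => db K (fun y q =>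
                sw K y (fun a b => (r e * q (b * (c2 * S d))) • (a * c))))
              simp only [h3]
              exact (sw_congr _ fun c d => sw_comm ..).trans (coassoc ..)
          _ = sw K z (fun c t => db K (fun y q =>
                sw K y (fun a b => (r t * q (b)) • (a * c)))) := by
              refine sw_congr _ fun c t => ?_
              rw [← sw_counit_left (K := K) t (fun t => db K (fun y q =>
                sw K y (fun a b => (r t * q (b)) • (a * c))))]
              refine sw_congr _ fun u e => ?_
              rw [sw_S_right u (fun v => db K (fun y q =>
                sw K y (fun a b => (r e * q (b * v)) • (a * c))))]
              simp only [mul_one]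
          _ = _ := by
              rw [← db_sw]
              refine db_congr fun y q => ?_
              simp only [mul_comm]
    _ = db K (fun z r => sw K z (fun c d => sw K d (fun d e => r e • db K (fun y q => 
          sw K y (fun a b => q (b * S d * c) • a))))) := by
        refine db_congr fun z r => sw_congr _ fun c d => sw_congr _ fun d e => ?_
        congr 1
        exact db_adj (LinearMap.mulRight K c) (fun y q => sw K y (fun a b => q (b * S d) • a))
    _ = db K (fun z r => sw K z (fun c d => sw K d (fun d e => r e • db K (fun y q => 
          sw K y (fun a b => q (b * (S c * d)) • a))))) := by
        simp only [mul_assoc]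
        exact db_sw_cyc (fun c d => db K (fun y q => 
          sw K y (fun a b => q (b * (S d * c)) • a))) (by fun_prop) (by fun_prop)
    _ = db K (fun z r => r z • xx K H) := by
        refine db_congr fun z r => ?_
        rw [← coassoc]
        rw [← sw_counit_left (K := K) z (fun z => r z • xx K H)]
        refine sw_congr _ fun u e => ?_
        rw [sw_S_left u (fun v => r e • db K (fun y q => sw K y (fun a b => q (b * v) • a)))]
        simp [xx]
    _ = _ := by
        rw [← e0, db_map (fun t => t • xx K H)]
        simp

theorem map_xx (p : H →ₗ[K] K) : p (xx K H) = db K (fun y q => q (sw K y (fun a b => p a • b))) := by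
  rw [xx, db_map (fun t => p t)]
  refine db_congr fun y q => ?_
  simp only [map_sw, map_smul, smul_eq_mul, mul_comm]

theorem SS_xx {Λ : H} (hΛ : IsInt K Λ) : S (S (xx K H)) = xx K H := by
  let f : H →ₗ[K] H := S ∘ₗ S
  have hf : Function.Bijective f :=
    ⟨(S_inj hΛ).comp (S_inj hΛ), (S_surj hΛ).comp (S_surj hΛ)⟩
  let g := LinearEquiv.ofBijective f hf
  have h1 : ∀ b, g.symm (S (S b)) = b := fun b => g.symm_apply_apply b
  calc S (S (xx K H)) = db K (fun y q => sw K (f y) (fun a b => q (g.symm b) • a)) := by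
        rw [xx, db_map (fun t => S (S t))]
        refine db_congr fun y q => ?_
        simp only [f, LinearMap.comp_apply]
        rw [sw_anti _ _ (by fun_prop) (by fun_prop), sw_anti _ _ (by fun_prop) (by fun_prop)]
        simp only [map_sw, map_smul, h1]
    _ = _ := by
        rw [db_adj f (fun y q => sw K y (fun a b => q (g.symm b) • a))]
        refine db_congr fun y q => sw_congr _ fun a b => ?_
        have e : (q ∘ₗ f) (g.symm b) = q b := congrArg q (g.apply_symm_apply b)
        rw [e]
end xx
end HP
end

section

open TensorProduct LinearMap Coalgebra
namespace HP
set_option linter.unusedSectionVars false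
section mat
variable {K : Type*} [Field K]

theorem trace_idem {V : Type*} [AddCommGroup V] [Module K V] [FiniteDimensional K V]
    (f : V →ₗ[K] V) (hf : f ∘ₗ f = f) :
    LinearMap.trace K V f = (Module.finrank K (LinearMap.range f) : K) :=
  LinearMap.IsProj.trace (LinearMap.IsIdempotentElem.isProj_range f hf)

theorem trace_idem_mat {n : ℕ} (M : Matrix (Fin n) (Fin n) K) (hM : M * M = M) :
    ∃ r : ℕ, M.trace = r := by
  have := trace_idem (Matrix.toLin' M) (by rw [← Matrix.toLin'_mul, hM])
  rw [Matrix.trace_toLin'_eq] at this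
  exact ⟨_, this⟩

theorem trace_spec {N : ℕ} (hN : 0 < N) [CharZero K] {ω : K} (hω : IsPrimitiveRoot ω N) {n : ℕ}
    (M : Matrix (Fin n) (Fin n) K) (hM : M ^ N = 1) :
    ∃ r : ℕ → ℕ, ∀ s < N, (M ^ s).trace = ∑ j ∈ Finset.range N, (r j : K) * ω ^ (j * s) := by
  have hN0 : (N : K) ≠ 0 := by exact_mod_cast hN.ne'
  have hω0 : ω ≠ 0 := hω.ne_zero hN.ne'
  let u : ℕ → Matrix (Fin n) (Fin n) K := fun j => (ω⁻¹ ^ j) • M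
  have hu : ∀ j, u j ^ N = 1 := by
    intro j
    simp only [u, smul_pow, hM, ← pow_mul]
    rw [mul_comm, pow_mul, inv_pow, hω.pow_eq_one]; simp
  let E : ℕ → Matrix (Fin n) (Fin n) K := fun j => (N : K)⁻¹ • ∑ k ∈ Finset.range N, u j ^ k
  have h1 : ∀ j, u j * E j = E j := by
    intro j
    have := mul_geom_sum (u j) N
    rw [hu, sub_self, sub_mul, one_mul, sub_eq_zero] at this
    simp only [E, mul_smul_comm, this]
  have h2 : ∀ j k, u j ^ k * E j = E j := by
    intro j k
    induction k with
    | zero => simp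
    | succ k ih => rw [pow_succ, mul_assoc, h1, ih]
  have h3 : ∀ j, E j * E j = E j := by
    intro j
    conv_lhs => enter [1]; simp only [E]
    rw [smul_mul_assoc, Finset.sum_mul]
    simp only [h2]
    simp [← Nat.cast_smul_eq_nsmul K, smul_smul, hN0]
  choose r hr using fun j => trace_idem_mat (E j) (h3 j)
  refine ⟨r, fun s hs => ?_⟩
  have h4 : M ^ s = ∑ j ∈ Finset.range N, ω ^ (j * s) • E j := by
    simp only [E, u, smul_pow, Finset.smul_sum, smul_smul]
    rw [Finset.sum_comm]
    simp only [← Finset.sum_smul]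
    rw [Finset.sum_eq_single_of_mem s (Finset.mem_range.2 hs)]
    · have : ∀ j, ω ^ (j * s) * ((N : K)⁻¹ * (ω⁻¹ ^ j) ^ s) = (N : K)⁻¹ := by
        intro j
        rw [← pow_mul, inv_pow]; field_simp
      simp only [this, Finset.sum_const, Finset.card_range, nsmul_eq_mul]
      rw [mul_inv_cancel₀ hN0, one_smul]
    · intro k hk hks
      have hk := Finset.mem_range.1 hk
      have e : ∀ j, ω ^ (j * s) * ((N : K)⁻¹ * (ω⁻¹ ^ j) ^ k) = (N : K)⁻¹ * (ω ^ s * (ω ^ k)⁻¹) ^ j := by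
        intro j
        rw [mul_pow, inv_pow, inv_pow, inv_pow, ← pow_mul, ← pow_mul, ← pow_mul, mul_comm j s,
          mul_comm j k]; ring
      simp only [e]
      rw [← Finset.mul_sum]
      have hne : ω ^ s * (ω ^ k)⁻¹ ≠ 1 := by
        intro h
        apply hks
        rw [mul_inv_eq_one₀ (pow_ne_zero _ hω0)] at h
        exact (hω.pow_inj hs hk h).symm
      have hgeom := mul_geom_sum (ω ^ s * (ω ^ k)⁻¹) N
      have hp : (ω ^ s * (ω ^ k)⁻¹) ^ N = 1 := by
        rw [mul_pow, inv_pow, ← pow_mul, ← pow_mul, mul_comm s, mul_comm k, pow_mul, pow_mul,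
          hω.pow_eq_one]; simp
      rw [hp, sub_self] at hgeom
      have := (mul_eq_zero.1 hgeom).resolve_left (sub_ne_zero.2 hne)
      rw [this]; simp
  rw [h4, Matrix.trace_sum]
  refine Finset.sum_congr rfl fun j _ => ?_
  rw [Matrix.trace_smul, hr, smul_eq_mul, mul_comm]

theorem aeval_prim {N : ℕ} (hN : 0 < N) [CharZero K] {ω : K} (hω : IsPrimitiveRoot ω N)
    {ζ : ℂ} (hζ : IsPrimitiveRoot ζ N) (Q : Polynomial ℚ) :
    Polynomial.aeval ω Q = 0 ↔ Polynomial.aeval ζ Q = 0 := by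
  rw [← minpoly.dvd_iff, ← minpoly.dvd_iff,
    ← Polynomial.cyclotomic_eq_minpoly_rat hω hN, ← Polynomial.cyclotomic_eq_minpoly_rat hζ hN]

theorem pos_sum [CharZero K] [IsAlgClosed K] {ι : Type*} [Fintype ι] [Nonempty ι] (n : ι → ℕ)
    (a : ∀ i, Matrix (Fin (n i)) (Fin (n i)) K) {N : ℕ} (hN : 1 < N) (ha : ∀ i, a i ^ N = 1)
    (ht : ∀ i, (a i).trace ≠ 0) : ∑ i, (a i).trace * (a i ^ (N - 1)).trace ≠ 0 := by
  have hN0 : 0 < N := by omega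
  have : NeZero (N : K) := ⟨by exact_mod_cast hN0.ne'⟩
  obtain ⟨ω, hω⟩ := HasEnoughRootsOfUnity.exists_primitiveRoot K N
  have hζ := Complex.isPrimitiveRoot_exp N hN0.ne'
  set ζ := Complex.exp (2 * Real.pi * Complex.I / N) with hζd
  choose r hr using fun i => trace_spec hN0 hω (a i) (ha i)
  let t : ι → ℕ → Polynomial ℚ := fun i s =>
    ∑ j ∈ Finset.range N, Polynomial.C (r i j : ℚ) * Polynomial.X ^ (j * s)
  have e1 : ∀ i s, s < N → (a i ^ s).trace = Polynomial.aeval ω (t i s) := by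
    intro i s hs
    rw [hr i s hs]; simp [t]
  have e2 : ∀ i s, Polynomial.aeval ζ (t i s) = ∑ j ∈ Finset.range N, (r i j : ℂ) * ζ ^ (j * s) := by
    intro i s; simp [t]
  have hconj : ∀ i, Polynomial.aeval ζ (t i (N - 1)) = (starRingEnd ℂ) (Polynomial.aeval ζ (t i 1)) := by
    intro i
    rw [e2, e2, map_sum]
    refine Finset.sum_congr rfl fun j _ => ?_
    have hn : ‖ζ‖ = 1 := hζ.norm'_eq_one hN0.ne'
    have : (starRingEnd ℂ) ζ = ζ ^ (N - 1) := by
      have h1 : ζ * ζ ^ (N - 1) = 1 := by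
        rw [← pow_succ', Nat.sub_add_cancel hN0, hζ.pow_eq_one]
      have h2 : ζ * (starRingEnd ℂ) ζ = 1 := by
        rw [Complex.mul_conj, Complex.normSq_eq_norm_sq, hn]; simp
      exact mul_left_cancel₀ (hζ.ne_zero hN0.ne') (h2.trans h1.symm)
    rw [map_mul, map_pow, this, map_natCast, mul_one, ← pow_mul, mul_comm j]
  intro h0
  have h1 : Polynomial.aeval ω (∑ i, t i 1 * t i (N - 1)) = 0 := by
    rw [map_sum, ← h0]
    refine Finset.sum_congr rfl fun i _ => ?_
    rw [map_mul, ← e1 i 1 hN, ← e1 i (N - 1) (by omega), pow_one]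
  rw [aeval_prim hN0 hω hζ, map_sum] at h1
  simp only [map_mul, hconj, Complex.mul_conj] at h1
  have h2 : ∑ i, Complex.normSq (Polynomial.aeval ζ (t i 1)) = 0 := by exact_mod_cast h1
  obtain ⟨i⟩ := ‹Nonempty ι›
  have h3 := (Finset.sum_eq_zero_iff_of_nonneg (fun i _ => Complex.normSq_nonneg _)).1 h2 i
    (Finset.mem_univ i)
  rw [Complex.normSq_eq_zero, ← aeval_prim hN0 hω hζ, ← e1 i 1 hN, pow_one] at h3
  exact ht i h3

variable {A : Type*} [Ring A] [Algebra K A] [FiniteDimensional K A] {m : ℕ} {n : Fin m → ℕ}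
  (e : A ≃ₐ[K] Π i, Matrix (Fin (n i)) (Fin (n i)) K)

theorem trace_LR (a c : A) : LinearMap.trace K A (LinearMap.mulLeft K a ∘ₗ LinearMap.mulRight K c) =
    ∑ i, (e a i).trace * (e c i).trace := by
  let D := Π i, Matrix (Fin (n i)) (Fin (n i)) K
  let g : D →ₗ[K] D := LinearMap.mulLeft K (e a) ∘ₗ LinearMap.mulRight K (e c)
  have h1 : e.toLinearEquiv.conj (LinearMap.mulLeft K a ∘ₗ LinearMap.mulRight K c) = g := by
    refine LinearMap.ext fun x => ?_
    simp [g, LinearEquiv.conj_apply]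
  rw [← LinearMap.trace_conj' _ e.toLinearEquiv, h1]
  let B := Pi.basis (fun i => Matrix.stdBasis K (Fin (n i)) (Fin (n i)))
  rw [LinearMap.trace_eq_matrix_trace K B]
  simp only [Matrix.trace, Matrix.diag, LinearMap.toMatrix_apply, B]
  rw [Fintype.sum_sigma]
  refine Finset.sum_congr rfl fun i _ => ?_
  rw [Fintype.sum_prod_type, Finset.sum_mul_sum]
  refine Finset.sum_congr rfl fun k _ => Finset.sum_congr rfl fun l _ => ?_
  simp [g, Pi.basis_apply, Matrix.stdBasis_eq_single, Pi.basis_repr]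
  have hrep : ∀ M : Matrix (Fin (n i)) (Fin (n i)) K,
      (Matrix.stdBasis K (Fin (n i)) (Fin (n i))).repr M (k, l) = M k l := by
    intro M
    conv_rhs => rw [← (Matrix.stdBasis K (Fin (n i)) (Fin (n i))).sum_repr M]
    simp [Matrix.sum_apply, Matrix.stdBasis_eq_single, Fintype.sum_prod_type, Matrix.single_apply,
      Finset.sum_ite_eq, ite_and]
  rw [hrep, Pi.mul_apply, Pi.mul_apply, Pi.single_eq_same]
  simp [Matrix.mul_apply, Matrix.single_apply, ite_and]

theorem trace_L (a : A) : LinearMap.trace K A (LinearMap.mulLeft K a) =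
    ∑ i, (n i : K) * (e a i).trace := by
  have := trace_LR e a 1
  simp [mul_comm] at this
  rw [← this]

theorem exists_rep (p : A →ₗ[K] K) : ∃ b : A, ∀ x, p x = ∑ i, (e b i * e x i).trace := by
  classical
  refine ⟨e.symm (fun i => Matrix.of fun k l => p (e.symm (Pi.single i (Matrix.single l k 1)))), fun x => ?_⟩
  obtain ⟨y, rfl⟩ := e.symm.surjective x
  simp only [AlgEquiv.apply_symm_apply]
  have hy : y = ∑ i, ∑ k, ∑ l, (y i k l) • (Pi.single i (Matrix.single k l (1 : K)) : Π i, Matrix (Fin (n i)) (Fin (n i)) K) := by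
    ext i k l
    simp only [Finset.sum_apply, Pi.smul_apply, Matrix.sum_apply, Matrix.smul_apply, smul_eq_mul]
    rw [Finset.sum_eq_single i, Finset.sum_eq_single k, Finset.sum_eq_single l]
    · simp
    · intro l' _ h; simp [Matrix.single_apply, h]
    · simp
    · intro k' _ h; simp [Matrix.single_apply, h]
    · simp
    · intro i' _ h; simp [Pi.single_apply, Ne.symm h]
    · simp
  conv_lhs => rw [hy]
  simp only [map_sum, map_smul, smul_eq_mul, Matrix.trace, Matrix.diag, Matrix.mul_apply, Matrix.of_apply]
  refine Finset.sum_congr rfl fun i _ => ?_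
  rw [Finset.sum_comm]
  refine Finset.sum_congr rfl fun i _ => Finset.sum_congr rfl fun i _ => ?_
  rw [mul_comm]
end mat
end HP
end

section

open TensorProduct LinearMap Coalgebra
namespace HP
set_option linter.unusedSectionVars false
section mat2
variable {K : Type*} [Field K]
variable {A : Type*} [Ring A] [Algebra K A] [FiniteDimensional K A] {m : ℕ} {n : Fin m → ℕ}
  (e : A ≃ₐ[K] Π i, Matrix (Fin (n i)) (Fin (n i)) K)

/-- the sum of the block traces -/
noncomputable def tau : A →ₗ[K] K :=
  toLin (fun x => ∑ i, (e x i).trace) (Lin.mk' (by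
    intro x y; simp [Finset.sum_add_distrib]) (by intro c x; simp [Finset.mul_sum]))

theorem tau_apply (x : A) : tau e x = ∑ i, (e x i).trace := rfl
theorem tau_comm (x y : A) : tau e (x * y) = tau e (y * x) := by
  simp only [tau_apply, map_mul, Pi.mul_apply]
  exact Finset.sum_congr rfl fun i _ => Matrix.trace_mul_comm _ _
theorem tau_nondeg (x : A) (h : ∀ y, tau e (x * y) = 0) : x = 0 := by
  apply e.injective
  rw [map_zero]
  ext i k l
  have := h (e.symm (Pi.single i (Matrix.single l k 1)))
  rw [tau_apply, Finset.sum_eq_single i] at this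
  · simpa [Matrix.trace_mul_single] using this
  · intro j _ hj; simp [hj]
  · simp
theorem tau_rep (p : A →ₗ[K] K) : ∃ b : A, ∀ x, p x = tau e (b * x) := by
  obtain ⟨b, hb⟩ := exists_rep e p
  exact ⟨b, fun x => by simp [hb, tau_apply]⟩
theorem central_scalar (z : A) (hz : ∀ x, x * z = z * x) (i) : ∃ c : K, e z i = c • 1 := by
  have h : ∀ M : Matrix (Fin (n i)) (Fin (n i)) K, M * e z i = e z i * M := by
    intro M
    have := congr_fun (congr_arg e (hz (e.symm (Pi.single i M)))) i
    simpa using this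
  have h2 : e z i ∈ Set.range (Matrix.scalar (Fin (n i)) : K → Matrix (Fin (n i)) (Fin (n i)) K) := by
    rw [Matrix.mem_range_scalar_iff_commute_single']
    intro a b
    exact h _
  obtain ⟨c, hc⟩ := h2
  exact ⟨c, by rw [← hc, Matrix.scalar_apply, Matrix.smul_one_eq_diagonal]⟩
end mat2

section SS
variable {K H E : Type*} [Field K] [CharZero K] [IsAlgClosed K] [Ring H] [HopfAlgebra K H]
  [FiniteDimensional K H] {m : ℕ} {n : Fin m → ℕ} [∀ i, NeZero (n i)]
  (e : H ≃ₐ[K] Π i, Matrix (Fin (n i)) (Fin (n i)) K)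
local notation "ε" => Coalgebra.counit (R := K) (A := H)
local notation "S" => HopfAlgebra.antipode K (A := H)
variable {Λ : H} (hΛ : IsInt K Λ)
include e hΛ

theorem lam_one_ne : lam K H 1 ≠ 0 := by
  obtain ⟨b, hb⟩ := tau_rep e (lam K H)
  have hinj : Function.Injective (LinearMap.mulLeft K b) := by
    rw [injective_iff_map_eq_zero]
    intro x hx
    apply lam_nondeg hΛ
    intro y
    rw [hb, ← mul_assoc, show b * x = 0 from hx]; simp
  obtain ⟨b', hb'⟩ := (LinearMap.injective_iff_surjective.1 hinj) 1
  have bb' : b * b' = 1 := hb'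
  have b'b : b' * b = 1 := by
    apply hinj
    simp [← mul_assoc, bb']
  have hS : ∀ x, b * x = S (S x) * b := by
    intro x
    rw [← sub_eq_zero]
    apply tau_nondeg e
    intro y
    rw [sub_mul, map_sub, mul_assoc, ← hb, lam_nak, hb, ← mul_assoc, tau_comm, mul_assoc, sub_self]
  have hS' : ∀ x, S (S x) = b * x * b' := by
    intro x; rw [hS, mul_assoc, bb', mul_one]
  have hlam : ∀ x, lam K H x = ∑ i, (e (x * b) i).trace * (e b' i).trace := by
    intro x
    rw [← trace_LR, lam_apply]
    congr 1
    ext y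
    simp [hS', mul_assoc]
  have ht : ∀ i, (e b' i).trace ≠ 0 := by
    intro i h
    have : e.symm (Pi.single i 1) = 0 := by
      apply lam_nondeg hΛ
      intro y
      rw [hlam]
      refine Finset.sum_eq_zero fun j _ => ?_
      by_cases hj : j = i
      · subst hj; rw [h, mul_zero]
      · simp [hj]
    rw [map_eq_zero_iff _ e.symm.injective, Pi.single_eq_zero_iff] at this
    have h0 := congr_fun (congr_fun this 0) 0
    simp at h0
  obtain ⟨N, hN, hγ⟩ := gam_finite hΛ
  set γ := gam K Λ with hγd
  have hcen : ∀ x, x * (γ * (b * b)) = (γ * (b * b)) * x := by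
    intro x
    have := radford hΛ x
    rw [← hγd] at this
    rw [hS' (S (S x)), hS'] at this
    calc x * (γ * (b * b)) = (x * γ) * b * b := by simp only [mul_assoc]
      _ = γ * b * b * x * (b' * (b' * b) * b) := by rw [this]; simp only [mul_assoc]
      _ = _ := by rw [b'b, mul_one, b'b, mul_one]; simp only [mul_assoc]
  have hpow : (γ * (b * b)) ^ N = b ^ (2 * N) := by
    have hc : Commute γ (b * b) := by
      have h1 := hcen (S γ)
      have : b * b = γ * (b * b) * S γ := by
        rw [← h1, ← mul_assoc, S_gam hΛ, one_mul]
      have h2 : b * b * γ = γ * (b * b) * (S γ * γ) := by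
        rw [← mul_assoc, ← this]
      rw [S_gam hΛ, mul_one] at h2
      exact h2.symm
    rw [hc.mul_pow, hγ, one_mul, pow_mul, pow_two]
  choose z hz using fun i => central_scalar e _ hcen i
  choose c hc using fun i => IsAlgClosed.exists_pow_nat_eq (z i) (n := 2) (by norm_num)
  have hzN : ∀ i, e b i ^ (2 * N) = (z i) ^ N • 1 := by
    intro i
    have := congr_fun (congr_arg e hpow) i
    rw [map_pow, Pi.pow_apply, hz, smul_pow, one_pow, map_pow, Pi.pow_apply] at this
    exact this.symm
  have hbb : ∀ i, e b i * e b' i = 1 := fun i => by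
    rw [← Pi.mul_apply, ← map_mul, bb']; simp
  have hbb' : ∀ i, e b' i * e b i = 1 := fun i => by
    rw [← Pi.mul_apply, ← map_mul, b'b]; simp
  have hz0 : ∀ i, z i ≠ 0 := by
    intro i h
    have h1 := hzN i
    rw [h, zero_pow hN.ne', zero_smul] at h1
    have h2 : e b i ^ (2 * N) * e b' i ^ (2 * N) = 1 := by
      rw [← Commute.mul_pow (by rw [Commute, SemiconjBy, hbb, hbb']), hbb, one_pow]
    rw [h1, zero_mul] at h2
    exact zero_ne_one h2
  have hc0 : ∀ i, c i ≠ 0 := fun i h => hz0 i (by rw [← hc, h]; simp)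
  have ha : ∀ i, (c i • e b' i) ^ (2 * N) = 1 := by
    intro i
    have h2 : e b i ^ (2 * N) * e b' i ^ (2 * N) = 1 := by
      rw [← Commute.mul_pow (by rw [Commute, SemiconjBy, hbb, hbb']), hbb, one_pow]
    rw [hzN, smul_mul_assoc, one_mul] at h2
    rw [smul_pow, pow_mul, hc, h2]
  have hne : Nonempty (Fin m) := by
    by_contra hm
    rw [not_nonempty_iff] at hm
    have : (1 : H) = 0 := e.injective (Subsingleton.elim _ _)
    have h2 : ε (1 : H) = 0 := by rw [this, map_zero]
    rw [Bialgebra.counit_one] at h2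
    exact one_ne_zero h2
  have key := pos_sum n (fun i => c i • e b' i) (N := 2 * N) (by omega) ha
    (fun i => by rw [Matrix.trace_smul, smul_eq_mul]; exact mul_ne_zero (hc0 i) (ht i))
  rw [hlam]
  refine fun h => key ((Finset.sum_congr rfl fun i _ => ?_).trans h)
  have hlast : (c i • e b' i) ^ (2 * N - 1) = (c i)⁻¹ • e b i := by
    have h1 : (c i • e b' i) ^ (2 * N - 1) * (c i • e b' i) = 1 := by
      rw [← pow_succ, Nat.sub_add_cancel (by omega), ha]
    have h2 : (c i • e b' i) * ((c i)⁻¹ • e b i) = 1 := by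
      rw [smul_mul_smul_comm, hbb', mul_inv_cancel₀ (hc0 i), one_smul]
    calc _ = (c i • e b' i) ^ (2 * N - 1) * ((c i • e b' i) * ((c i)⁻¹ • e b i)) := by rw [h2, mul_one]
      _ = _ := by rw [← mul_assoc, h1, one_mul]
  rw [hlast, Matrix.trace_smul, Matrix.trace_smul, one_mul, smul_eq_mul, smul_eq_mul]
  have := hc0 i
  field_simp

theorem SS_id (x : H) : S (S x) = x := by
  have hT := lam_one_ne e hΛ
  have hγ := Tr_zero_gam hΛ hT
  have hS4 : ∀ x, S (S (S (S x))) = x := by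
    intro x
    have := radford hΛ x
    rw [hγ, mul_one, one_mul] at this
    exact this.symm
  have h1 : (1 : H) ≠ 0 := by
    intro this
    have h2 : ε (1 : H) = 0 := by rw [this, map_zero]
    rw [Bialgebra.counit_one] at h2
    exact one_ne_zero h2
  have : Nontrivial H := ⟨1, 0, h1⟩
  set d := Module.finrank K H with hd
  have hd0 : 0 < d := Module.finrank_pos
  have hdK : (d : K) ≠ 0 := by exact_mod_cast hd0.ne'
  have hlx : lam K H (xx K H) = lam K H 1 := by
    rw [map_xx]
    have : ∀ y (q : Module.Dual K H), q (sw K y (fun a b => lam K H a • b)) = q 1 • lam K H y := by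
      intro y q; rw [lam_gam hΛ, hγ]; simp [mul_comm]
    rw [db_congr this, db_eval (1 : H) (fun y => lam K H y)]
  set X := (d : K)⁻¹ • xx K H with hX
  have hXX : X * X = X := by
    rw [hX, smul_mul_smul_comm, xx_mul, smul_smul, ← hd]
    congr 1; field_simp
  have hSX : S (S X) = X := by rw [hX, map_smul, map_smul, SS_xx hΛ]
  let Q : H →ₗ[K] H := (2 : K)⁻¹ • (LinearMap.id - S ∘ₗ S)
  have hQa : ∀ x, Q x = (2 : K)⁻¹ • (x - S (S x)) := fun x => rfl
  have hQ : Q ∘ₗ Q = Q := by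
    ext x
    simp only [comp_apply, hQa, map_smul, map_sub, hS4]
    module
  have hLL : (LinearMap.mulLeft K X) ∘ₗ (LinearMap.mulLeft K X) = LinearMap.mulLeft K X := by
    ext x; simp [← mul_assoc, hXX]
  have hLQ : (LinearMap.mulLeft K X ∘ₗ Q) ∘ₗ (LinearMap.mulLeft K X ∘ₗ Q) = LinearMap.mulLeft K X ∘ₗ Q := by
    have hc : ∀ x, Q (X * x) = X * Q x := by
      intro x; simp only [hQa]
      rw [S_mul, S_mul, hSX, mul_smul_comm, mul_sub]
    ext x
    simp only [comp_apply, mulLeft_apply]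
    rw [hc, ← mul_assoc, hXX, show Q (Q x) = Q x from LinearMap.congr_fun hQ x]
  have t1 := trace_idem _ hQ
  have t2 := trace_idem _ hLL
  have t3 := trace_idem _ hLQ
  set r := Module.finrank K (LinearMap.range Q) with hr
  set r1 := Module.finrank K (LinearMap.range (LinearMap.mulLeft K X)) with hr1
  set r2 := Module.finrank K (LinearMap.range (LinearMap.mulLeft K X ∘ₗ Q)) with hr2
  have hSS : S ∘ₗ S = LinearMap.id - (2 : K) • Q := by
    ext x; simp [hQa]
  have hTr : lam K H 1 = d - 2 * r := by
    rw [lam_apply, hSS, show LinearMap.mulLeft K (1 : H) = LinearMap.id by ext; simp, id_comp,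
      map_sub, map_smul, t1, LinearMap.trace_id]; simp [hd]
  have hTX : lam K H X = r1 - 2 * r2 := by
    rw [lam_apply, hSS, comp_sub, comp_id, comp_smul, map_sub, map_smul, t2, t3]; simp
  rw [hX, map_smul, hlx, hTr, smul_eq_mul] at hTX
  have hmain : (d : ℤ) - 2 * r = d * (r1 - 2 * r2) := by
    have : (d : K) - 2 * r = d * (r1 - 2 * r2) := by
      rw [← hTX]; field_simp
    exact_mod_cast this
  have hne : (d : ℤ) - 2 * r ≠ 0 := by
    intro h; apply hT; rw [hTr]; exact_mod_cast h
  have hrk := LinearMap.finrank_range_add_finrank_ker Q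
  have hker : 0 < Module.finrank K (LinearMap.ker Q) := by
    rw [Module.finrank_pos_iff]
    refine ⟨⟨1, ?_⟩, 0, ?_⟩
    · rw [LinearMap.mem_ker, hQa, S_one, S_one]; simp
    · intro h; exact h1 (congr_arg Subtype.val h)
  have hrd : r + 1 ≤ d := by omega
  have hr0 : r = 0 := by
    set k : ℤ := r1 - 2 * r2
    have hk1 : k ≤ 1 := by
      by_contra h; push Not at h; nlinarith
    have hk2 : -1 < k := by
      by_contra h; push Not at h
      nlinarith
    have hk3 : k ≠ 0 := by
      intro h; rw [h, mul_zero] at hmain; exact hne hmain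
    have : k = 1 := by omega
    rw [this] at hmain; omega
  have hQ0 : LinearMap.range Q = ⊥ := by
    rw [← Submodule.finrank_eq_zero (R := K)]; exact hr0
  rw [LinearMap.range_eq_bot] at hQ0
  have := LinearMap.congr_fun hSS x
  rw [hQ0] at this
  simpa using this
end SS
end HP
end

section

open TensorProduct LinearMap Coalgebra
namespace HP
set_option linter.unusedSectionVars false

section dual
variable (K H : Type*) [Field K] [Ring H] [HopfAlgebra K H] [FiniteDimensional K H]

/-- the dual Hopf algebra, as a type of its own -/
def HD : Type _ := H →ₗ[K] K

noncomputable instance : AddCommGroup (HD K H) := inferInstanceAs (AddCommGroup (H →ₗ[K] K))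
noncomputable instance : Module K (HD K H) := inferInstanceAs (Module K (H →ₗ[K] K))
instance : FiniteDimensional K (HD K H) := inferInstanceAs (FiniteDimensional K (Module.Dual K H))

variable {K H}
/-- the evaluation -/
noncomputable def evB : HD K H ≃ₗ[K] (H →ₗ[K] K) := LinearEquiv.refl K (H →ₗ[K] K)

local notation "ε" => Coalgebra.counit (R := K) (A := H)
local notation "S" => HopfAlgebra.antipode K (A := H)

theorem hd_ext {p q : HD K H} (h : ∀ x, evB p x = evB q x) : p = q :=
  evB.injective (LinearMap.ext h)

noncomputable instance : Mul (HD K H) where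
  mul p q := evB.symm (toLin (fun h => sw K h (fun a b => evB p a * evB q b)) (by fun_prop))
noncomputable instance : One (HD K H) where
  one := evB.symm ε

theorem ev_mul (p q : HD K H) (h : H) : evB (p * q) h = sw K h (fun a b => evB p a * evB q b) := rfl
theorem ev_one (h : H) : evB (1 : HD K H) h = ε h := rfl

noncomputable instance : Ring (HD K H) :=
  { (inferInstance : AddCommGroup (HD K H)) with
    mul := (· * ·)
    one := 1
    mul_assoc := by
      intro p q r
      refine hd_ext fun h => ?_
      simp only [ev_mul]
      calc _ = sw K h (fun a b => sw K a fun a1 a2 => evB p a1 * evB q a2 * evB r b) :=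
            sw_congr _ fun a b => by rw [sw_mul]
        _ = _ := by
            rw [coassoc h (fun x y z => evB p x * evB q y * evB r z)]
            exact sw_congr _ fun a b => by simp only [mul_sw, mul_assoc]
    one_mul := by
      intro p
      refine hd_ext fun h => ?_
      rw [ev_mul]
      exact sw_counit_left (K := K) h (fun x => evB p x)
    mul_one := by
      intro p
      refine hd_ext fun h => ?_
      rw [ev_mul]
      rw [← sw_counit_right (K := K) h (fun x => evB p x)]
      exact sw_congr _ fun a b => by rw [ev_one]; exact mul_comm _ _
    left_distrib := by
      intro p q r
      refine hd_ext fun h => ?_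
      simp only [ev_mul, map_add, LinearMap.add_apply, sw_add, mul_add]
    right_distrib := by
      intro p q r
      refine hd_ext fun h => ?_
      simp only [ev_mul, map_add, LinearMap.add_apply, sw_add, add_mul]
    zero_mul := by
      intro p
      refine hd_ext fun h => ?_
      simp only [ev_mul, map_zero, LinearMap.zero_apply, zero_mul, sw, smul_zero, Finset.sum_const_zero]
    mul_zero := by
      intro p
      refine hd_ext fun h => ?_
      simp only [ev_mul, map_zero, LinearMap.zero_apply, mul_zero, sw, smul_zero, Finset.sum_const_zero] }

noncomputable instance : Algebra K (HD K H) := Algebra.ofModule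
  (by
    intro c p q
    refine hd_ext fun h => ?_
    simp only [ev_mul, map_smul, LinearMap.smul_apply, smul_sw, smul_mul_assoc])
  (by
    intro c p q
    refine hd_ext fun h => ?_
    simp only [ev_mul, map_smul, LinearMap.smul_apply, smul_sw, mul_smul_comm])

/-- evaluation on two tensor factors -/
noncomputable def ev2 {V W : Type*} [AddCommGroup V] [Module K V] [AddCommGroup W] [Module K W]
    (f : V →ₗ[K] K) (g : W →ₗ[K] K) : V ⊗[K] W →ₗ[K] K :=
  LinearMap.mul' K K ∘ₗ TensorProduct.map f g
theorem ev2_tmul {V W : Type*} [AddCommGroup V] [Module K V] [AddCommGroup W] [Module K W]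
    (f : V →ₗ[K] K) (g : W →ₗ[K] K) (v : V) (w : W) : ev2 f g (v ⊗ₜ w) = f v * g w := rfl

/-- evaluation at a point -/
noncomputable def evp (h : H) : HD K H →ₗ[K] K := (LinearMap.applyₗ h) ∘ₗ evB.toLinearMap
theorem evp_apply (h : H) (p : HD K H) : evp h p = evB p h := rfl

/-- a family of functionals separates points -/
def Sep {V ι : Type*} [AddCommGroup V] [Module K V] (f : ι → (V →ₗ[K] K)) : Prop :=
  ∃ b : Module.Basis (Fin (Module.finrank K V)) K V, ∀ i, ∃ j, f j = b.coord i

theorem sep2 {V W ι κ : Type*} [AddCommGroup V] [Module K V] [AddCommGroup W] [Module K W]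
    [FiniteDimensional K V] [FiniteDimensional K W]
    (f : ι → (V →ₗ[K] K)) (g : κ → (W →ₗ[K] K)) {α β : Type*} [Fintype α] [Fintype β]
    (b : Module.Basis α K V) (c : Module.Basis β K W) (hb : ∀ i, ∃ j, f j = b.coord i)
    (hc : ∀ i, ∃ j, g j = c.coord i) (t t' : V ⊗[K] W)
    (h : ∀ i j, ev2 (f i) (g j) t = ev2 (f i) (g j) t') : t = t' := by
  refine (b.tensorProduct c).repr.injective (Finsupp.ext fun ⟨i, j⟩ => ?_)
  obtain ⟨i', hi⟩ := hb i
  obtain ⟨j', hj⟩ := hc j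
  have e : ∀ t, (b.tensorProduct c).repr t (i, j) = ev2 (f i') (g j') t := by
    intro t
    induction t with
    | zero => simp
    | add x y hx hy => simp [hx, hy]
    | tmul x y => simp [ev2_tmul, hi, hj]; exact mul_comm _ _
  rw [e, e, h]

/-- the dual basis -/
noncomputable def dbs : Module.Basis (Fin (Module.finrank K H)) K (HD K H) :=
  (bs K H).dualBasis.map evB.symm
theorem dbs_coord (i) : evp (bs K H i) = (dbs (K := K) (H := H)).coord i := by
  refine (dbs (K := K) (H := H)).ext fun j => ?_
  rw [Module.Basis.coord_apply, Module.Basis.repr_self, evp_apply]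
  simp [dbs, Finsupp.single_apply, eq_comm]

theorem sepP2 (t t' : HD K H ⊗[K] HD K H)
    (h : ∀ x y : H, ev2 (evp x) (evp y) t = ev2 (evp x) (evp y) t') : t = t' :=
  sep2 _ _ dbs dbs (fun i => ⟨_, dbs_coord i⟩) (fun i => ⟨_, dbs_coord i⟩) t t' h
theorem sepP3 (t t' : HD K H ⊗[K] (HD K H ⊗[K] HD K H))
    (h : ∀ x y z : H, ev2 (evp x) (ev2 (evp y) (evp z)) t = ev2 (evp x) (ev2 (evp y) (evp z)) t') :
    t = t' :=
  sep2 (fun x : H => evp x) (fun w : H × H => ev2 (evp w.1) (evp w.2)) dbs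
    (dbs.tensorProduct dbs) (fun i => ⟨_, dbs_coord i⟩)
    (fun i => ⟨(bs K H i.1, bs K H i.2), by
      refine (dbs.tensorProduct dbs).ext fun j => ?_
      obtain ⟨j1, j2⟩ := j
      rw [Module.Basis.coord_apply, Module.Basis.repr_self, Module.Basis.tensorProduct_apply,
        ev2_tmul, dbs_coord, dbs_coord]
      simp only [Module.Basis.coord_apply, Module.Basis.repr_self, Finsupp.single_apply, Prod.ext_iff]
      split_ifs <;> simp_all⟩) t t' (fun x y => h x y.1 y.2)

theorem exists_comul (p : HD K H) : ∃ t : HD K H ⊗[K] HD K H,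
    ∀ x y : H, ev2 (evp x) (evp y) t = evB p (x * y) := by
  refine ⟨∑ i, ∑ j, evB p (bs K H i * bs K H j) • dbs i ⊗ₜ dbs j, fun x y => ?_⟩
  have hd : ∀ i (x : H), evp x (dbs (K := K) i) = (bs K H).repr x i := by
    intro i x
    simp [evp_apply, dbs]
  simp only [map_sum, map_smul, ev2_tmul, hd]
  rw [lin_expand (K := K) (f := fun x => evB p (x * y)) (by fun_prop) x]
  refine Finset.sum_congr rfl fun i _ => ?_
  rw [lin_expand (K := K) (f := fun y => evB p (bs K H i * y)) (by fun_prop) y, Finset.smul_sum]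
  refine Finset.sum_congr rfl fun j _ => ?_
  simp only [smul_eq_mul]; ring

noncomputable def cmul : HD K H →ₗ[K] HD K H ⊗[K] HD K H :=
  { toFun := fun p => (exists_comul p).choose
    map_add' := fun p q => sepP2 _ _ fun x y => by
      refine ((exists_comul (p + q)).choose_spec x y).trans ?_
      rw [map_add evB, map_add (ev2 _ _), (exists_comul p).choose_spec, (exists_comul q).choose_spec]
      rfl
    map_smul' := fun c p => sepP2 _ _ fun x y => by
      refine ((exists_comul (c • p)).choose_spec x y).trans ?_
      rw [map_smul evB, map_smul (ev2 _ _), (exists_comul p).choose_spec]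
      rfl }
theorem ev_cmul (p : HD K H) (x y : H) : ev2 (evp x) (evp y) (cmul p) = evB p (x * y) :=
  (exists_comul p).choose_spec x y

noncomputable instance : Coalgebra K (HD K H) where
  comul := cmul
  counit := evp 1
  coassoc := by
    refine LinearMap.ext fun p => sepP3 _ _ fun x y z => ?_
    have e1 : ∀ t : HD K H ⊗[K] HD K H, ev2 (evp x) (ev2 (evp y) (evp z))
        (TensorProduct.assoc K _ _ _ (cmul.rTensor _ t)) = ev2 (evp (x * y)) (evp z) t := by
      intro t
      induction t with
      | zero => simp
      | add x y hx hy => simp only [map_add, hx, hy]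
      | tmul p q =>
        rw [rTensor_tmul, ev2_tmul, evp_apply, ← ev_cmul]
        generalize cmul p = s
        induction s with
        | zero => simp
        | add x y hx hy => simp only [map_add, add_tmul, hx, hy, add_mul]
        | tmul a b => simp [ev2_tmul, mul_assoc]
    have e2 : ∀ t : HD K H ⊗[K] HD K H, ev2 (evp x) (ev2 (evp y) (evp z))
        (cmul.lTensor _ t) = ev2 (evp x) (evp (y * z)) t := by
      intro t
      induction t with
      | zero => simp
      | add x y hx hy => simp only [map_add, hx, hy]
      | tmul p q =>
        rw [lTensor_tmul, ev2_tmul, ev2_tmul, ev_cmul, evp_apply, evp_apply]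
    simp only [comp_apply, LinearEquiv.coe_coe]
    rw [e1, e2, ev_cmul, ev_cmul, mul_assoc]
  rTensor_counit_comp_comul := by
    refine LinearMap.ext fun p => (TensorProduct.lid K _).injective (hd_ext fun x => ?_)
    have e1 : ∀ t : HD K H ⊗[K] HD K H, evB (TensorProduct.lid K _ ((evp 1).rTensor _ t)) x =
        ev2 (evp 1) (evp x) t := by
      intro t
      induction t with
      | zero => simp
      | add x y hx hy => simp only [map_add, hx, hy, LinearMap.add_apply]
      | tmul p q => simp [ev2_tmul, evp_apply]
    simp only [comp_apply]
    rw [e1, ev_cmul]; simp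
  lTensor_counit_comp_comul := by
    refine LinearMap.ext fun p => (TensorProduct.rid K _).injective (hd_ext fun x => ?_)
    have e1 : ∀ t : HD K H ⊗[K] HD K H, evB (TensorProduct.rid K _ ((evp 1).lTensor _ t)) x =
        ev2 (evp x) (evp 1) t := by
      intro t
      induction t with
      | zero => simp
      | add x y hx hy => simp only [map_add, hx, hy, LinearMap.add_apply]
      | tmul p q => simp [ev2_tmul, evp_apply, mul_comm]
    simp only [comp_apply]
    rw [e1, ev_cmul]; simp

theorem ev2_mul (s t : HD K H ⊗[K] HD K H) (x y : H) : ev2 (evp x) (evp y) (s * t) =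
    sw K x (fun a b => sw K y fun c d => ev2 (evp a) (evp c) s * ev2 (evp b) (evp d) t) := by
  induction s with
  | zero => simp [sw]
  | add s s' hs hs' => simp only [add_mul, map_add, hs, hs', sw_add]
  | tmul p q =>
    induction t with
    | zero => simp [sw]
    | add s s' hs hs' => simp only [mul_add, map_add, hs, hs', sw_add]
    | tmul p' q' =>
      rw [Algebra.TensorProduct.tmul_mul_tmul, ev2_tmul, evp_apply, evp_apply, ev_mul, ev_mul,
        sw_mul]
      refine sw_congr _ fun a b => ?_
      rw [mul_sw]
      refine sw_congr _ fun c d => ?_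
      rw [ev2_tmul, ev2_tmul, evp_apply, evp_apply, evp_apply, evp_apply]
      ring

theorem hd_counit (p : HD K H) : Coalgebra.counit (R := K) p = evB p 1 := rfl
theorem hd_comul (p : HD K H) : Coalgebra.comul (R := K) p = cmul p := rfl

theorem hd_b1 : Coalgebra.counit (R := K) (1 : HD K H) = 1 := by
  rw [hd_counit, ev_one, Bialgebra.counit_one]
theorem hd_b2 (p q : HD K H) : Coalgebra.counit (R := K) (p * q) =
    Coalgebra.counit (R := K) p * Coalgebra.counit (R := K) q := by
  rw [hd_counit, hd_counit, hd_counit, ev_mul, sw_one _ (by fun_prop) (by fun_prop)]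
theorem hd_b3 : Coalgebra.comul (R := K) (1 : HD K H) = 1 := by
  refine sepP2 _ _ fun x y => ?_
  rw [hd_comul, ev_cmul, Algebra.TensorProduct.one_def, ev2_tmul, evp_apply, evp_apply, ev_one,
    ev_one, ev_one, Bialgebra.counit_mul]
theorem hd_b4 (p q : HD K H) : Coalgebra.comul (R := K) (p * q) =
    Coalgebra.comul (R := K) p * Coalgebra.comul (R := K) q := by
  refine sepP2 _ _ fun x y => ?_
  rw [hd_comul, hd_comul, hd_comul, ev_cmul, ev_mul, sw_prod _ _ _ (by fun_prop) (by fun_prop), ev2_mul]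
  simp only [ev_cmul]

noncomputable instance : Bialgebra K (HD K H) :=
  Bialgebra.mk' K (HD K H) hd_b1 (fun {a b} => hd_b2 a b) hd_b3 (fun {a b} => hd_b4 a b)

/-- the antipode of the dual -/
noncomputable def antiD : HD K H →ₗ[K] HD K H :=
  evB.symm.toLinearMap ∘ₗ (LinearMap.lcomp K K S) ∘ₗ evB.toLinearMap
theorem ev_antiD (p : HD K H) (x : H) : evB (antiD p) x = evB p (S x) := rfl

noncomputable instance : HopfAlgebra K (HD K H) where
  antipode := antiD
  mul_antipode_rTensor_comul := by
    refine LinearMap.ext fun p => hd_ext fun x => ?_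
    have e1 : ∀ t : HD K H ⊗[K] HD K H, evB (LinearMap.mul' K _ (antiD.rTensor _ t)) x =
        sw K x (fun a b => ev2 (evp (S a)) (evp b) t) := by
      intro t
      induction t with
      | zero => simp [sw]
      | add x y hx hy => simp only [map_add, hx, hy, LinearMap.add_apply, sw_add]
      | tmul p q => rw [rTensor_tmul, mul'_apply, ev_mul]; rfl
    simp only [comp_apply]
    rw [e1]
    change sw K x (fun a b => ev2 (evp (S a)) (evp b) (cmul p)) = _
    simp only [ev_cmul]
    rw [sw_S_left x (fun y => evB p y)]
    simp only [Algebra.linearMap_apply, Algebra.algebraMap_eq_smul_one, map_smul,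
      LinearMap.smul_apply, ev_one]
    exact mul_comm _ _
  mul_antipode_lTensor_comul := by
    refine LinearMap.ext fun p => hd_ext fun x => ?_
    have e1 : ∀ t : HD K H ⊗[K] HD K H, evB (LinearMap.mul' K _ (antiD.lTensor _ t)) x =
        sw K x (fun a b => ev2 (evp a) (evp (S b)) t) := by
      intro t
      induction t with
      | zero => simp [sw]
      | add x y hx hy => simp only [map_add, hx, hy, LinearMap.add_apply, sw_add]
      | tmul p q => rw [lTensor_tmul, mul'_apply, ev_mul]; rfl
    simp only [comp_apply]
    rw [e1]
    change sw K x (fun a b => ev2 (evp a) (evp (S b)) (cmul p)) = _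
    simp only [ev_cmul]
    rw [sw_S_right x (fun y => evB p y)]
    simp only [Algebra.linearMap_apply, Algebra.algebraMap_eq_smul_one, map_smul,
      LinearMap.smul_apply, ev_one]
    exact mul_comm _ _

end dual

section pair
/-- perfect Hopf pairings -/
structure HPair (K H P : Type*) [Field K] [Ring H] [HopfAlgebra K H] [FiniteDimensional K H]
    [Ring P] [HopfAlgebra K P] [FiniteDimensional K P] where
  B : P ≃ₗ[K] (H →ₗ[K] K)
  mulP : ∀ p q h, B (p * q) h = sw K h (fun a b => B p a * B q b)
  mulH : ∀ p h k, B p (h * k) = sw K p (fun p1 p2 => B p1 h * B p2 k)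
  oneP : ∀ h, B 1 h = Coalgebra.counit (R := K) h
  oneH : ∀ p, B p 1 = Coalgebra.counit (R := K) p
  antip : ∀ p h, B (HopfAlgebra.antipode K p) h = B p (HopfAlgebra.antipode K h)

noncomputable def hdPair (K H : Type*) [Field K] [Ring H] [HopfAlgebra K H]
    [FiniteDimensional K H] : HPair K H (HD K H) where
  B := evB
  mulP := ev_mul
  mulH := fun p h k => by
    rw [← ev_cmul]
    exact (sw_eq p (ev2 (evp h) (evp k))).symm
  oneP := ev_one
  oneH := fun p => rfl
  antip := ev_antiD
end pair
end HP
end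

section

open TensorProduct LinearMap Coalgebra
namespace HP
set_option linter.unusedSectionVars false

section SS
variable {K H E : Type*} [Field K] [Ring H] [HopfAlgebra K H] [FiniteDimensional K H]
  [AddCommGroup E] [Module K E]
local notation "ε" => Coalgebra.counit (R := K) (A := H)
local notation "S" => HopfAlgebra.antipode K (A := H)

theorem sw_So_right (hS : ∀ x : H, S (S x) = x) (h : H) (F : H → E) (hF : Lin K F := by fun_prop) :
    sw K h (fun a b => F (b * S a)) = ε h • F 1 := by
  have := sw_S_left (K := K) (S h) F hF
  rw [sw_anti _ _ (by fun_prop) (by fun_prop), eps_S] at this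
  simpa only [hS] using this
theorem sw_So_left (hS : ∀ x : H, S (S x) = x) (h : H) (F : H → E) (hF : Lin K F := by fun_prop) :
    sw K h (fun a b => F (S b * a)) = ε h • F 1 := by
  have := sw_S_right (K := K) (S h) F hF
  rw [sw_anti _ _ (by fun_prop) (by fun_prop), eps_S] at this
  simpa only [hS] using this
end SS

namespace HPair
variable {K H P V : Type*} [Field K] [Ring H] [HopfAlgebra K H] [FiniteDimensional K H]
    [Ring P] [HopfAlgebra K P] [FiniteDimensional K P] [AddCommGroup V] [Module K V]
    (π : HPair K H P)

theorem extP {p q : P} (h : ∀ x, π.B p x = π.B q x) : p = q :=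
  π.B.injective (LinearMap.ext h)

/-- dual basis contraction for a pairing -/
noncomputable def dp (F : H → P → V) : V := db K (fun y q => F y (π.B.symm q))

theorem dp_congr {F G : H → P → V} (h : ∀ y q, F y q = G y q) : π.dp F = π.dp G :=
  db_congr fun _ _ => h _ _
theorem dp_eval (x : H) (F : H → V) (hF : Lin K F := by fun_prop) :
    π.dp (fun y q => π.B q x • F y) = F x := by
  simp only [dp, LinearEquiv.apply_symm_apply]
  exact db_eval x F hF
theorem dp_eval' (p : P) (F : P → V) (hF : Lin K F := by fun_prop) :
    π.dp (fun y q => π.B p y • F q) = F p := by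
  have := db_eval' (π.B p) (fun q => F (π.B.symm q)) (by fun_prop)
  simpa [dp] using this
theorem dp_map {V' : Type*} [AddCommGroup V'] [Module K V'] (g : V → V')
    (F : H → P → V) (hg : Lin K g := by fun_prop) :
    g (π.dp F) = π.dp (fun y q => g (F y q)) := db_map g _ hg
theorem dp_sw {H' : Type*} [Ring H'] [HopfAlgebra K H'] [FiniteDimensional K H']
    (h : H') (F : H → P → H' → H' → V) :
    π.dp (fun y q => sw K h (fun a b => F y q a b)) =
      sw K h (fun a b => π.dp (fun y q => F y q a b)) := db_sw ..
theorem dp_dp {H' P' : Type*} [Ring H'] [HopfAlgebra K H'] [FiniteDimensional K H']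
    [Ring P'] [HopfAlgebra K P'] [FiniteDimensional K P'] (π' : HPair K H' P')
    (F : H → P → H' → P' → V) :
    π.dp (fun y q => π'.dp (fun z r => F y q z r)) =
      π'.dp (fun z r => π.dp (fun y q => F y q z r)) := db_db _
@[fun_prop] theorem lin_dp {W : Type*} [AddCommGroup W] [Module K W]
    {F : W → H → P → V} (hF : ∀ a b, Lin K (fun x => F x a b)) :
    Lin K (fun x => π.dp (F x)) := by
  unfold dp; fun_prop
theorem dp_smul (c : K) (F : H → P → V) : c • π.dp F = π.dp (fun y q => c • F y q) :=
  π.dp_map (fun v => c • v) F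
theorem dp_mul {A : Type*} [Ring A] [Algebra K A] (c : A) (F : H → P → A) :
    π.dp F * c = π.dp (fun y q => F y q * c) :=
  π.dp_map (fun v => v * c) F
theorem mul_dp {A : Type*} [Ring A] [Algebra K A] (c : A) (F : H → P → A) :
    c * π.dp F = π.dp (fun y q => c * F y q) :=
  π.dp_map (fun v => c * v) F
theorem dp_eps (F : P → V) (hF : Lin K F := by fun_prop) :
    π.dp (fun y q => Coalgebra.counit (R := K) y • F q) = F 1 := by
  simp only [← π.oneP]; exact π.dp_eval' 1 F hF
theorem dp_eps' (F : H → V) (hF : Lin K F := by fun_prop) :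
    π.dp (fun y q => Coalgebra.counit (R := K) q • F y) = F 1 := by
  simp only [← π.oneH]; exact π.dp_eval 1 F hF

theorem dp_sw_left (F : H → H → P → V) (h1 : ∀ b c, Lin K (fun a => F a b c) := by fun_prop)
    (h2 : ∀ a c, Lin K (fun b => F a b c) := by fun_prop)
    (h3 : ∀ a b, Lin K (fun c => F a b c) := by fun_prop) :
    π.dp (fun y q => sw K y (fun a b => F a b q)) =
      π.dp (fun y q => π.dp (fun z r => F y z (q * r))) := by
  calc _ = π.dp (fun y q => sw K y (fun a b => π.dp fun y' q' => π.dp fun z' r' =>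
          (π.B q' a * π.B r' b) • F y' z' q)) := by
        refine π.dp_congr fun y q => sw_congr _ fun a b => ?_
        rw [← π.dp_eval a (fun a => F a b q)]
        refine π.dp_congr fun y' q' => ?_
        rw [← π.dp_eval b (fun b => F y' b q), dp_smul]
        exact π.dp_congr fun z' r' => by rw [smul_smul]
    _ = π.dp (fun y q => π.dp fun y' q' => π.dp fun z' r' => π.B (q' * r') y • F y' z' q) := by
        refine π.dp_congr fun y q => ?_
        rw [← dp_sw]
        refine π.dp_congr fun y' q' => ?_
        rw [← dp_sw]
        refine π.dp_congr fun z' r' => ?_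
        rw [← sw_smul, π.mulP]
    _ = _ := by
        rw [dp_dp]
        refine π.dp_congr fun y' q' => ?_
        rw [dp_dp]
        refine π.dp_congr fun z' r' => ?_
        rw [π.dp_eval' (q' * r') (fun q => F y' z' q)]

theorem dp_sw_right (F : H → P → P → V) (h1 : ∀ b c, Lin K (fun a => F a b c) := by fun_prop)
    (h2 : ∀ a c, Lin K (fun b => F a b c) := by fun_prop)
    (h3 : ∀ a b, Lin K (fun c => F a b c) := by fun_prop) :
    π.dp (fun y q => sw K q (fun a b => F y a b)) =
      π.dp (fun y q => π.dp (fun z r => F (y * z) q r)) := by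
  calc _ = π.dp (fun y q => sw K q (fun a b => π.dp fun y' q' => π.dp fun z' r' =>
          (π.B a y' * π.B b z') • F y q' r')) := by
        refine π.dp_congr fun y q => sw_congr _ fun a b => ?_
        rw [← π.dp_eval' a (fun a => F y a b)]
        refine π.dp_congr fun y' q' => ?_
        rw [← π.dp_eval' b (fun b => F y q' b), dp_smul]
        exact π.dp_congr fun z' r' => by rw [smul_smul]
    _ = π.dp (fun y q => π.dp fun y' q' => π.dp fun z' r' => π.B q (y' * z') • F y q' r') := by
        refine π.dp_congr fun y q => ?_
        rw [← dp_sw]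
        refine π.dp_congr fun y' q' => ?_
        rw [← dp_sw]
        refine π.dp_congr fun z' r' => ?_
        rw [← sw_smul, π.mulH]
    _ = _ := by
        rw [dp_dp]
        refine π.dp_congr fun y' q' => ?_
        rw [dp_dp]
        refine π.dp_congr fun z' r' => ?_
        rw [π.dp_eval (y' * z') (fun y => F y q' r')]

theorem dp_S (F : H → P → V) (h1 : ∀ b, Lin K (fun a => F a b) := by fun_prop)
    (h2 : ∀ a, Lin K (fun b => F a b) := by fun_prop) :
    π.dp (fun y q => F (HopfAlgebra.antipode K y) q) = π.dp (fun y q => F y (HopfAlgebra.antipode K q)) := by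
  calc _ = π.dp (fun y q => π.dp fun y' q' => π.B q' (HopfAlgebra.antipode K y) • F y' q) :=
        π.dp_congr fun y q => (π.dp_eval _ (fun a => F a q)).symm
    _ = π.dp (fun y' q' => π.dp fun y q => π.B (HopfAlgebra.antipode K q') y • F y' q) := by
        rw [dp_dp]; simp only [π.antip]
    _ = _ := π.dp_congr fun y q => π.dp_eval' _ (fun a => F y a)

/-- multiplying one side of the dual basis -/
theorem dp_mul_left (x : H) (F : H → P → V) (h1 : ∀ b, Lin K (fun a => F a b) := by fun_prop)
    (h2 : ∀ a, Lin K (fun b => F a b) := by fun_prop) :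
    π.dp (fun y q => F (x * y) q) = π.dp (fun y q => sw K q fun u w => π.B u x • F y w) := by
  rw [π.dp_sw_right (fun y u w => π.B u x • F y w)]
  calc _ = π.dp (fun z r => π.dp fun y q => π.B q x • F (y * z) r) := 
        π.dp_congr fun z r => (π.dp_eval x (fun y => F (y * z) r)).symm
    _ = _ := π.dp_dp ..
theorem dp_mul_right (x : H) (F : H → P → V) (h1 : ∀ b, Lin K (fun a => F a b) := by fun_prop)
    (h2 : ∀ a, Lin K (fun b => F a b) := by fun_prop) :
    π.dp (fun y q => F (y * x) q) = π.dp (fun y q => sw K q fun u w => π.B w x • F y u) := by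
  rw [π.dp_sw_right (fun y u w => π.B w x • F y u)]
  exact π.dp_congr fun y q => (π.dp_eval x (fun z => F (y * z) q)).symm
theorem dp_mul_left' (x : P) (F : H → P → V) (h1 : ∀ b, Lin K (fun a => F a b) := by fun_prop)
    (h2 : ∀ a, Lin K (fun b => F a b) := by fun_prop) :
    π.dp (fun y q => F y (x * q)) = π.dp (fun y q => sw K y fun a b => π.B x a • F b q) := by
  rw [π.dp_sw_left (fun a b q => π.B x a • F b q)]
  calc _ = π.dp (fun z r => π.dp fun y q => π.B x y • F z (q * r)) := 
        π.dp_congr fun z r => (π.dp_eval' x (fun q => F z (q * r))).symm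
    _ = _ := π.dp_dp ..
theorem dp_mul_right' (x : P) (F : H → P → V) (h1 : ∀ b, Lin K (fun a => F a b) := by fun_prop)
    (h2 : ∀ a, Lin K (fun b => F a b) := by fun_prop) :
    π.dp (fun y q => F y (q * x)) = π.dp (fun y q => sw K y fun a b => π.B x b • F a q) := by
  rw [π.dp_sw_left (fun a b q => π.B x b • F a q)]
  exact π.dp_congr fun y q => (π.dp_eval' x (fun r => F y (q * r))).symm

theorem sep (x y : H) (h : ∀ p, π.B p x = π.B p y) : x = y := by
  rw [← sub_eq_zero, ← Module.forall_dual_apply_eq_zero_iff K]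
  intro φ
  have := h (π.B.symm φ)
  simpa [sub_eq_zero] using this

/-- the opposite pairing -/
noncomputable def symm : HPair K P H where
  B := LinearEquiv.ofInjectiveOfFinrankEq (LinearMap.flip π.B.toLinearMap)
    (by
      intro x y h
      exact π.sep x y fun p => LinearMap.congr_fun h p)
    (by
      rw [Subspace.dual_finrank_eq, π.B.finrank_eq, Subspace.dual_finrank_eq])
  mulP := fun p q h => π.mulH h p q
  mulH := fun p q h => π.mulP q h p
  oneP := fun h => π.oneH h
  oneH := fun h => π.oneP h
  antip := fun p h => (π.antip h p).symm

theorem symm_B (h : H) (p : P) : π.symm.B h p = π.B p h := rfl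

include π in
theorem SP (hS : ∀ x : H, HopfAlgebra.antipode K (HopfAlgebra.antipode K x) = x) (p : P) :
    HopfAlgebra.antipode K (HopfAlgebra.antipode K p) = p :=
  π.extP fun x => by rw [π.antip, π.antip, hS]

end HPair

section yd
variable {K H P E V : Type*} [Field K] [Ring H] [HopfAlgebra K H] [FiniteDimensional K H]
    [Ring P] [HopfAlgebra K P] [FiniteDimensional K P] [Ring E] [Algebra K E]
    [AddCommGroup V] [Module K V]

/-- Yetter-Drinfeld pairs -/
structure YD (π : HPair K H P) (f : H →ₐ[K] E) (g : P →ₐ[K] E) : Prop where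
  rel : ∀ h p, sw K h (fun a b => sw K p fun u w => π.B u b • (f a * g w)) =
    sw K h (fun a b => sw K p fun u w => π.B w a • (g u * f b))

variable {π : HPair K H P} {f : H →ₐ[K] E} {g : P →ₐ[K] E} (hY : YD π f g)
  (hS : ∀ x : H, HopfAlgebra.antipode K (HopfAlgebra.antipode K x) = x)
include hY

theorem YD.symm : YD π.symm g f where
  rel := fun p h => by
    rw [sw_comm, sw_comm (h := p) (k := h)]
    exact (hY.rel h p).symm

local notation "S" => HopfAlgebra.antipode K

theorem YD.rho (h : H) (F : H → E → V) (h1 : ∀ b, Lin K (fun a => F a b) := by fun_prop)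
    (h2 : ∀ a, Lin K (fun b => F a b) := by fun_prop) :
    π.dp (fun y q => sw K h fun a b => F (b * y) (f a * g q)) =
      π.dp (fun y q => sw K h fun a b => F (y * a) (g q * f b)) := by
  calc _ = sw K h fun a b => π.dp (fun y q => sw K q fun u w => π.B u b • F y (f a * g w)) := by
        rw [HPair.dp_sw]
        exact sw_congr _ fun a b => π.dp_mul_left b (fun y q => F y (f a * g q))
    _ = π.dp (fun y q => F y (sw K h fun a b => sw K q fun u w => π.B u b • (f a * g w))) := by
        rw [← HPair.dp_sw]
        refine π.dp_congr fun y q => ?_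
        rw [sw_map (fun e => F y e) (by fun_prop)]
        refine sw_congr _ fun a b => ?_
        rw [sw_map (fun e => F y e) (by fun_prop)]
        exact sw_congr _ fun u w => ((h2 y).map_smul _ _).symm
    _ = π.dp (fun y q => F y (sw K h fun a b => sw K q fun u w => π.B w a • (g u * f b))) := by
        simp only [hY.rel]
    _ = sw K h fun a b => π.dp (fun y q => sw K q fun u w => π.B w a • F y (g u * f b)) := by
        rw [← HPair.dp_sw]
        refine π.dp_congr fun y q => ?_
        rw [sw_map (fun e => F y e) (by fun_prop)]
        refine sw_congr _ fun a b => ?_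
        rw [sw_map (fun e => F y e) (by fun_prop)]
        exact sw_congr _ fun u w => ((h2 y).map_smul _ _)
    _ = _ := by
        rw [HPair.dp_sw]
        exact sw_congr _ fun a b => (π.dp_mul_right a (fun y q => F y (g q * f b))).symm

theorem YD.rho' (p : P) (F : P → E → V) (h1 : ∀ b, Lin K (fun a => F a b) := by fun_prop)
    (h2 : ∀ a, Lin K (fun b => F a b) := by fun_prop) :
    π.dp (fun y q => sw K p fun u w => F (q * u) (f y * g w)) =
      π.dp (fun y q => sw K p fun u w => F (w * q) (g u * f y)) := by
  calc _ = sw K p fun u w => π.dp (fun y q => sw K y fun a b => π.B u b • F q (f a * g w)) := by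
        rw [HPair.dp_sw]
        exact sw_congr _ fun u w => π.dp_mul_right' u (fun y q => F q (f y * g w))
    _ = π.dp (fun y q => F q (sw K y fun a b => sw K p fun u w => π.B u b • (f a * g w))) := by
        rw [← HPair.dp_sw]
        refine π.dp_congr fun y q => ?_
        rw [sw_comm, sw_map (fun e => F q e) (by fun_prop)]
        refine sw_congr _ fun a b => ?_
        rw [sw_map (fun e => F q e) (by fun_prop)]
        exact sw_congr _ fun u w => ((h2 q).map_smul _ _).symm
    _ = π.dp (fun y q => F q (sw K y fun a b => sw K p fun u w => π.B w a • (g u * f b))) := by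
        simp only [hY.rel]
    _ = sw K p fun u w => π.dp (fun y q => sw K y fun a b => π.B w a • F q (g u * f b)) := by
        rw [← HPair.dp_sw]
        refine π.dp_congr fun y q => ?_
        rw [sw_comm (h := p), sw_map (fun e => F q e) (by fun_prop)]
        refine sw_congr _ fun a b => ?_
        rw [sw_map (fun e => F q e) (by fun_prop)]
        exact sw_congr _ fun u w => ((h2 q).map_smul _ _)
    _ = _ := by
        rw [HPair.dp_sw]
        exact sw_congr _ fun u w => (π.dp_mul_left' w (fun y q => F q (g u * f y))).symm

include hS in
/-- the straightening formula -/
theorem YD.straight (p : P) (h : H) : g p * f h =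
    sw K h (fun a b => sw K b fun b1 b2 => sw K p fun u w => sw K w fun w1 w2 =>
      (π.B u b2 * π.B w2 (S a)) • (f b1 * g w1)) := by
  symm
  calc _ = sw K h (fun a b => sw K p fun u' w2 => π.B w2 (S a) •
          sw K b fun b1 b2 => sw K u' fun u w1 => π.B u b2 • (f b1 * g w1)) := by
        refine sw_congr _ fun a b => ?_
        simp only [smul_sw, smul_smul]
        rw [sw_comm]
        have := coassoc (K := K) p (fun u w1 w2 => sw K b fun b1 b2 =>
          (π.B w2 (S a) * π.B u b2) • (f b1 * g w1))
        calc _ = _ := by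
              refine sw_congr _ fun u w => ?_
              rw [sw_comm]
              exact sw_congr _ fun w1 w2 => sw_congr _ fun b1 b2 => by rw [mul_comm]
          _ = _ := this.symm
          _ = _ := sw_congr _ fun u w => sw_comm ..
    _ = sw K h (fun a b => sw K p fun u' w2 => π.B w2 (S a) •
          sw K b fun b1 b2 => sw K u' fun u w1 => π.B w1 b1 • (g u * f b2)) := by
        simp only [hY.rel]
    _ = sw K h (fun a b => sw K b fun b1 b2 => sw K p fun u w =>
          π.B w (b1 * S a) • (g u * f b2)) := by
        refine sw_congr _ fun a b => ?_
        simp only [smul_sw, smul_smul]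
        have := coassoc (K := K) p (fun u w1 w2 => sw K b fun b1 b2 =>
          (π.B w2 (S a) * π.B w1 b1) • (g u * f b2))
        calc _ = _ := sw_congr _ fun u w => sw_comm ..
          _ = _ := this
          _ = _ := by
              rw [sw_comm (h := b)]
              refine sw_congr _ fun u w => ?_
              rw [sw_comm]
              refine sw_congr _ fun b1 b2 => ?_
              rw [π.mulH, sw_smul]
              exact sw_congr _ fun b1 b2 => by rw [mul_comm]
    _ = sw K h (fun c b2 => sw K c fun a b1 => sw K p fun u w =>
          π.B w (b1 * S a) • (g u * f b2)) := (coassoc ..).symm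
    _ = sw K h (fun c b2 => Coalgebra.counit (R := K) c • (g p * f b2)) := by
        refine sw_congr _ fun c b2 => ?_
        rw [sw_So_right hS c (fun x => sw K p fun u w => π.B w x • (g u * f b2))]
        congr 1
        simp only [π.oneH]
        exact sw_counit_right p (fun u => g u * f b2)
    _ = _ := sw_counit_left h (fun b => g p * f b)

end yd
end HP
end

section

open TensorProduct LinearMap Coalgebra
namespace HP
set_option linter.unusedSectionVars false

section v
variable {K H P E V : Type*} [Field K] [Ring H] [HopfAlgebra K H] [FiniteDimensional K H]
    [Ring P] [HopfAlgebra K P] [FiniteDimensional K P] [Ring E] [Algebra K E]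
    [AddCommGroup V] [Module K V]
local notation "S" => HopfAlgebra.antipode K

/-- the Drinfeld element -/
noncomputable def vv (π : HPair K H P) (f : H →ₐ[K] E) (g : P →ₐ[K] E) : E :=
  π.dp fun y q => f (S y) * g q

variable {π : HPair K H P} {f : H →ₐ[K] E} {g : P →ₐ[K] E} (hY : YD π f g)
  (hS : ∀ x : H, HopfAlgebra.antipode K (HopfAlgebra.antipode K x) = x)
include hY hS

theorem vv_f_aux (h : H) : sw K h (fun a b => f (S a) * vv π f g * f b) =
    Coalgebra.counit (R := K) h • vv π f g := by
  have := hY.rho h (fun y e => f (S y) * e)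
  symm
  calc _ = π.dp (fun y q => Coalgebra.counit (R := K) h • (f (S y) * f 1 * g q)) := by
        rw [vv, HPair.dp_smul]; simp
    _ = π.dp fun y q => sw K h fun a b => f (S (b * y)) * (f a * g q) := by
        refine π.dp_congr fun y q => ?_
        rw [← sw_So_left hS h (fun x => f (S y) * f x * g q)]
        refine sw_congr _ fun a b => ?_
        simp only [S_mul, map_mul, mul_assoc]
    _ = _ := by
        rw [this, HPair.dp_sw]
        refine sw_congr _ fun a b => ?_
        rw [vv, HPair.mul_dp, HPair.dp_mul]
        refine π.dp_congr fun y q => ?_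
        simp only [S_mul, map_mul, mul_assoc]

theorem vv_f (h : H) : f h * vv π f g = vv π f g * f h := by
  calc f h * vv π f g = sw K h (fun a b => f a * (Coalgebra.counit (R := K) b • vv π f g)) := by
        rw [← sw_counit_right (K := K) h (fun x => f x * vv π f g)]
        exact sw_congr _ fun a b => by simp
    _ = sw K h (fun a b => sw K b fun b1 b2 => f a * f (S b1) * vv π f g * f b2) := by
        refine sw_congr _ fun a b => ?_
        rw [← vv_f_aux hY hS, mul_sw]
        exact sw_congr _ fun b1 b2 => by simp only [mul_assoc]
    _ = sw K h (fun c b2 => sw K c fun a b1 => f (a * S b1) * vv π f g * f b2) := by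
        rw [← coassoc]; simp only [map_mul]
    _ = sw K h (fun c b2 => Coalgebra.counit (R := K) c • (f 1 * vv π f g * f b2)) := by
        refine sw_congr _ fun a b => ?_
        rw [sw_S_right a (fun x => f x * vv π f g * f b)]
    _ = _ := by
        rw [sw_counit_left h (fun b => f 1 * vv π f g * f b)]; simp

theorem vv_g_aux (p : P) : sw K p (fun u w => g u * vv π f g * g (S w)) =
    Coalgebra.counit (R := K) p • vv π f g := by
  have := hY.rho' p (fun q e => e * g (S q))
  have hv : vv π f g = π.dp fun y q => f y * g (S q) := by
    rw [vv, π.dp_S (fun y q => f y * g q)]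
  rw [hv]
  symm
  calc _ = π.dp (fun y q => Coalgebra.counit (R := K) p • (f y * g 1 * g (S q))) := by
        rw [HPair.dp_smul]; simp
    _ = π.dp fun y q => sw K p fun u w => (f y * g w) * g (S (q * u)) := by
        refine π.dp_congr fun y q => ?_
        rw [← sw_So_right (π.SP hS) p (fun x => f y * g x * g (S q))]
        refine sw_congr _ fun a b => ?_
        simp only [S_mul, map_mul, mul_assoc]
    _ = _ := by
        rw [this, HPair.dp_sw]
        refine sw_congr _ fun a b => ?_
        rw [HPair.mul_dp, HPair.dp_mul]
        refine π.dp_congr fun y q => ?_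
        simp only [S_mul, map_mul, mul_assoc]

theorem vv_g (p : P) : g p * vv π f g = vv π f g * g p := by
  symm
  calc vv π f g * g p = sw K p (fun a b => (Coalgebra.counit (R := K) a • vv π f g) * g b) := by
        rw [← sw_counit_left (K := K) p (fun x => vv π f g * g x)]
        exact sw_congr _ fun a b => by simp
    _ = sw K p (fun a b => sw K a fun b1 b2 => g b1 * vv π f g * g (S b2) * g b) := by
        refine sw_congr _ fun a b => ?_
        rw [← vv_g_aux hY hS, sw_mul]
    _ = sw K p (fun a c => sw K c fun b1 b2 => g a * vv π f g * g (S b1 * b2)) := by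
        rw [coassoc]; simp only [map_mul, mul_assoc]
    _ = sw K p (fun a c => Coalgebra.counit (R := K) c • (g a * vv π f g * g 1)) := by
        refine sw_congr _ fun a b => ?_
        rw [sw_S_left b (fun x => g a * vv π f g * g x)]
    _ = _ := by
        rw [sw_counit_right p (fun b => g b * vv π f g * g 1)]; simp

theorem sweedlerPow_zero_apply (h : H) : sweedlerPow K H 0 h = Coalgebra.counit (R := K) h • 1 := by
  simp [sweedlerPow, Algebra.algebraMap_eq_smul_one]
theorem sweedlerPow_succ_apply (k : ℕ) (h : H) :
    sweedlerPow K H (k+1) h = sw K h fun a b => a * sweedlerPow K H k b := by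
  rw [sweedlerPow]
  simp only [LinearMap.comp_apply]
  rw [← sw_comul (K := K) h, map_sw, map_sw]
  simp

theorem vv_pow (k : ℕ) : vv π f g ^ k = π.dp fun y q => f (S (sweedlerPow K H k y)) * g q := by
  induction k with
  | zero =>
    simp only [sweedlerPow_zero_apply hY hS, pow_zero, map_smul, S_one, smul_mul_assoc, map_one]
    rw [π.dp_eps (fun q => 1 * g q)]; simp
  | succ k ih =>
    rw [pow_succ, ih, HPair.dp_mul]
    simp only [sweedlerPow_succ_apply hY hS]
    calc _ = π.dp fun z r => π.dp fun y q => f (S (y * sweedlerPow K H k z)) * g (q * r) := by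
          refine π.dp_congr fun z r => ?_
          rw [mul_assoc, vv_g hY hS, vv, HPair.dp_mul, HPair.mul_dp]
          refine π.dp_congr fun y q => ?_
          simp only [S_mul, map_mul, mul_assoc]
      _ = π.dp fun y q => sw K y fun a b => f (S (a * sweedlerPow K H k b)) * g q := by
          rw [π.dp_sw_left (fun a b q => f (S (a * sweedlerPow K H k b)) * g q), HPair.dp_dp]
      _ = _ := by
          refine π.dp_congr fun y q => ?_
          rw [map_sw, algHom_sw, sw_mul]
end v

/-- abstract Drinfeld double -/
structure DD {K H P : Type*} [Field K] [Ring H] [HopfAlgebra K H] [FiniteDimensional K H]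
    [Ring P] [HopfAlgebra K P] [FiniteDimensional K P] (π : HPair K H P) (A : Type*) [Ring A]
    [Algebra K A] where
  ι : H →ₐ[K] A
  κ : P →ₐ[K] A
  yd : YD π ι κ
  μ : H ⊗[K] P ≃ₗ[K] A
  hμ : ∀ h p, μ (h ⊗ₜ p) = ι h * κ p

namespace DD
variable {K H P E V A : Type*} [Field K] [Ring H] [HopfAlgebra K H] [FiniteDimensional K H]
    [Ring P] [HopfAlgebra K P] [FiniteDimensional K P] [Ring E] [Algebra K E]
    [AddCommGroup V] [Module K V] {π : HPair K H P} [Ring A] [Algebra K A] (D : DD π A)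
  (hS : ∀ x : H, HopfAlgebra.antipode K (HopfAlgebra.antipode K x) = x)
local notation "S" => HopfAlgebra.antipode K

include D in
theorem fin : FiniteDimensional K A := D.μ.finiteDimensional

theorem ext_lin (F G : A → V) (hF : Lin K F) (hG : Lin K G)
    (h : ∀ h p, F (D.ι h * D.κ p) = G (D.ι h * D.κ p)) (x : A) : F x = G x := by
  have : toLin F hF ∘ₗ D.μ.toLinearMap = toLin G hG ∘ₗ D.μ.toLinearMap := by
    ext a b
    simp [D.hμ, h]
  have := LinearMap.congr_fun this (D.μ.symm x)
  simpa using this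

variable {f : H →ₐ[K] E} {g : P →ₐ[K] E} (hY : YD π f g)

/-- linear version of the lift -/
noncomputable def rho (f : H →ₐ[K] E) (g : P →ₐ[K] E) : A →ₗ[K] E :=
  (LinearMap.mul' K E ∘ₗ TensorProduct.map f.toLinearMap g.toLinearMap) ∘ₗ D.μ.symm.toLinearMap

theorem rho_apply (f : H →ₐ[K] E) (g : P →ₐ[K] E) (h : H) (p : P) :
    D.rho f g (D.ι h * D.κ p) = f h * g p := by
  simp [rho, ← D.hμ]

include hS hY in
theorem rho_mul (x y : A) : D.rho f g (x * y) = D.rho f g x * D.rho f g y := by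
  refine D.ext_lin (fun x => D.rho f g (x * y)) (fun x => D.rho f g x * D.rho f g y)
    (by fun_prop) (by fun_prop) (fun h p => ?_) x
  refine D.ext_lin (fun y => D.rho f g (D.ι h * D.κ p * y)) (fun y => D.rho f g (D.ι h * D.κ p) * D.rho f g y)
    (by fun_prop) (by fun_prop) (fun h' p' => ?_) y
  have e1 : D.ι h * D.κ p * (D.ι h' * D.κ p') = D.ι h * (D.κ p * D.ι h') * D.κ p' := by
    simp only [mul_assoc]
  have e2 : f h * g p * (f h' * g p') = f h * (g p * f h') * g p' := by
    simp only [mul_assoc]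
  have e3 : ∀ (c : K) x y, D.rho f g (D.ι h * (c • (D.ι x * D.κ y)) * D.κ p') =
      f h * (c • (f x * g y)) * g p' := by
    intro c x y
    simp only [mul_smul_comm, smul_mul_assoc, map_smul]
    have := D.rho_apply f g (h * x) (y * p')
    simp only [map_mul, ← mul_assoc] at this ⊢
    rw [this]
  simp only [rho_apply]
  rw [e1, e2, D.yd.straight hS, hY.straight hS]
  simp only [mul_sw, sw_mul, map_sw, e3]

/-- universal property -/
noncomputable def lift : A →ₐ[K] E := AlgHom.ofLinearMap (D.rho f g)
  (by have := D.rho_apply f g 1 1; simpa using this) (D.rho_mul hS hY)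

theorem lift_apply (h : H) (p : P) :
    D.lift hS hY (D.ι h * D.κ p) = f h * g p := D.rho_apply f g h p
@[simp] theorem lift_ι (h : H) : D.lift hS hY (D.ι h) = f h := by
  simpa using D.lift_apply hS hY h 1
@[simp] theorem lift_κ (p : P) : D.lift hS hY (D.κ p) = g p := by
  simpa using D.lift_apply hS hY 1 p

include hS in
theorem vv_central (x : A) : x * vv π D.ι D.κ = vv π D.ι D.κ * x := by
  refine D.ext_lin (fun x => x * vv π D.ι D.κ) (fun x => vv π D.ι D.κ * x) (by fun_prop) (by fun_prop)
    (fun h p => ?_) x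
  rw [mul_assoc, vv_g D.yd hS, ← mul_assoc, vv_f D.yd hS, mul_assoc]

include hS in
theorem pow_of_vv (N : ℕ) (h : vv π D.ι D.κ ^ N = 1) (x : H) :
    sweedlerPow K H N x = Coalgebra.counit (R := K) x • 1 := by
  rw [vv_pow D.yd hS] at h
  have h1 : π.dp (fun y q => S (sweedlerPow K H N y) ⊗ₜ[K] q) = 1 ⊗ₜ 1 := by
    apply D.μ.injective
    rw [π.dp_map (fun x => D.μ x)]
    simp only [D.hμ, h, map_one, mul_one]
  have h2 := congr_arg (fun z => TensorProduct.lift (LinearMap.flip (LinearMap.lsmul K H ∘ₗ (LinearMap.applyₗ x) ∘ₗ π.B.toLinearMap)) z) h1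
  rw [π.dp_map (fun z => TensorProduct.lift (LinearMap.flip (LinearMap.lsmul K H ∘ₗ (LinearMap.applyₗ x) ∘ₗ π.B.toLinearMap)) z)] at h2
  simp only [TensorProduct.lift.tmul, LinearMap.flip_apply, LinearMap.comp_apply, LinearMap.lsmul_apply, LinearMap.applyₗ_apply_apply, LinearEquiv.coe_coe] at h2
  rw [π.dp_eval x (fun y => S (sweedlerPow K H N y)), π.oneP] at h2
  rw [← hS (sweedlerPow K H N x), h2]
  simp

include hS in
theorem ext_lin' (F G : A → V) (hF : Lin K F) (hG : Lin K G)
    (h : ∀ h p, F (D.κ p * D.ι h) = G (D.κ p * D.ι h)) (x : A) : F x = G x := by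
  refine D.ext_lin F G hF hG (fun a p => ?_) x
  have := D.yd.symm.straight (π.SP hS) a p
  simp only [this, sw_map F hF, sw_map G hG, hF.map_smul, hG.map_smul, h]
end DD
end HP
end

section

open TensorProduct LinearMap Coalgebra
namespace HP
set_option linter.unusedSectionVars false

section int
variable {K H P E V : Type*} [Field K] [CharZero K] [Ring H] [HopfAlgebra K H] [FiniteDimensional K H]
    [Ring P] [HopfAlgebra K P] [FiniteDimensional K P] 
local notation "S" => HopfAlgebra.antipode K
variable (π : HPair K H P) {Λ : H} (hΛ : IsInt K Λ)
  (hS : ∀ x : H, HopfAlgebra.antipode K (HopfAlgebra.antipode K x) = x)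

include hS in
theorem lam_one_eq : lam K H 1 = (Module.finrank K H : K) := by
  rw [lam_apply]
  have : LinearMap.mulLeft K (1 : H) ∘ₗ HopfAlgebra.antipode K ∘ₗ HopfAlgebra.antipode K = LinearMap.id := by
    ext x; simp [hS]
  rw [this, LinearMap.trace_id]

include hΛ in
theorem dim_ne : (Module.finrank K H : K) ≠ 0 := by
  have : Nontrivial H := ⟨Λ, 0, by rintro rfl; have := hΛ.e; simp at this⟩
  exact_mod_cast Module.finrank_pos.ne'

include hΛ hS in
theorem gam_one : gam K Λ = 1 := Tr_zero_gam hΛ (by rw [lam_one_eq hS]; exact dim_ne hΛ)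

include hΛ hS in
theorem lam_int' (x : H) : sw K x (fun a b => lam K H a • b) = lam K H x • 1 := by
  rw [lam_gam hΛ, gam_one hΛ hS]

include hΛ hS in
theorem lam_S (x : H) : lam K H (S x) = lam K H x := by
  rw [← lam_S_gam hΛ x, gam_one hΛ hS, mul_one]

include hS in
theorem lam_tr (x y : H) : lam K H (x * y) = lam K H (y * x) := by
  rw [lam_nak, hS]

include hΛ in
theorem ΛS (F : H → H → E) [AddCommGroup E] [Module K E] (h1 : ∀ b, Lin K (fun a => F a b) := by fun_prop)
    (h2 : ∀ a, Lin K (fun b => F a b) := by fun_prop) :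
    sw K Λ F = sw K Λ fun a b => F (S b) (S a) := by
  conv_lhs => rw [← SΛ hΛ]
  rw [sw_anti _ _ h1 h2]

include hΛ hS in
theorem rec1 (h : H) : h = sw K Λ (fun a b => lam K H (h * a) • S b) := by
  obtain ⟨x, rfl⟩ := S_surj hΛ h
  conv_lhs => rw [S_eq hΛ x, ΛS hΛ (fun a b => lam K H (x * b) • a)]
  refine sw_congr _ fun a b => ?_
  rw [← lam_S hΛ hS, S_mul, hS, lam_tr hS]

include hΛ hS in
theorem rec2 (h : H) : h = sw K Λ (fun a b => lam K H (b * h) • S a) := by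
  conv_lhs => rw [← hS h, eq_S hΛ (S h), map_sw]
  refine sw_congr _ fun a b => ?_
  rw [hS, map_smul]

/-- the integral of `P` -/
noncomputable def LamP : P := π.B.symm ((Module.finrank K H : K)⁻¹ • lam K H)

theorem B_LamP (x : H) : π.B (LamP π) x = (Module.finrank K H : K)⁻¹ * lam K H x := by
  simp [LamP]

include hΛ hS in
theorem LamP_int : IsInt K (LamP π) where
  l := fun p => by
    apply π.extP
    intro h
    rw [π.mulP]
    simp only [map_smul, LinearMap.smul_apply, B_LamP, ← π.oneH]
    have e : ∀ a b, π.B p a * ((Module.finrank K H : K)⁻¹ * lam K H b) =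
      (Module.finrank K H : K)⁻¹ * π.B p (lam K H b • a) := by
      intros; simp; ring
    simp only [e]
    rw [← mul_sw, ← map_sw, lam_int]
    simp; ring
  r := fun p => by
    apply π.extP
    intro h
    rw [π.mulP]
    simp only [map_smul, LinearMap.smul_apply, B_LamP, ← π.oneH]
    have e : ∀ a b, ((Module.finrank K H : K)⁻¹ * lam K H a) * π.B p b =
      (Module.finrank K H : K)⁻¹ * π.B p (lam K H a • b) := by
      intros; simp; ring
    simp only [e]
    rw [← mul_sw, ← map_sw, lam_int' hΛ hS]
    simp; ring
  e := by
    rw [← π.oneH, B_LamP, lam_one_eq hS, inv_mul_cancel₀ (dim_ne hΛ)]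

include hΛ hS in
theorem lamP (p : P) : lam K P p = (Module.finrank K H : K) * π.B p Λ := by
  have := lam_uniq (LamP_int π hΛ hS) (LinearMap.applyₗ Λ ∘ₗ π.B.toLinearMap) (by
    intro p
    apply π.extP
    intro h
    have e : ∀ a b : P, (π.B b Λ • π.B a) h = π.B a h * π.B b Λ := by
      intros; simp; ring
    simp only [LinearMap.comp_apply, LinearMap.applyₗ_apply_apply, LinearEquiv.coe_coe]
    rw [sw_map (fun x => π.B x h) (by fun_prop)]
    simp only [map_smul, e]
    rw [← π.mulH, hΛ.l]
    simp [π.oneP])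
  have h2 := LinearMap.congr_fun this p
  simp [B_LamP, lam_Λ hΛ] at h2
  rw [h2, mul_inv_cancel_left₀ (dim_ne hΛ)]

include π in
theorem dimP : Module.finrank K P = Module.finrank K H := by
  rw [π.B.finrank_eq, Subspace.dual_finrank_eq]
end int

/-- separability idempotents give semisimplicity -/
theorem maschke {K A : Type*} [Field K] [Ring A] [Algebra K A] (c : A ⊗[K] A)
    (h1 : LinearMap.mul' K A c = 1)
    (h2 : ∀ x, (LinearMap.mulLeft K x).rTensor A c = (LinearMap.mulRight K x).lTensor A c) :
    IsSemisimpleRing A := by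
  have key : ∀ N : Submodule A A, ∃ q : A →ₗ[A] N, q ∘ₗ N.subtype = LinearMap.id := by
    intro N
    obtain ⟨p0, hp0⟩ := (N.restrictScalars K).subtype.exists_leftInverse_of_injective
      (by simp)
    have hp : ∀ x (hx : x ∈ N), (p0 x : A) = x := fun x hx => by
      have := LinearMap.congr_fun hp0 ⟨x, hx⟩
      simpa using congr_arg Subtype.val this
    let p : A →ₗ[K] A := (N.restrictScalars K).subtype ∘ₗ p0
    have hpN : ∀ x, p x ∈ N := fun x => (p0 x).2
    have hpx : ∀ x ∈ N, p x = x := fun x hx => hp x hx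
    let Φ : A → A ⊗[K] A →ₗ[K] A := fun m =>
      LinearMap.mul' K A ∘ₗ (p ∘ₗ LinearMap.mulRight K m).lTensor A
    have hΦ : ∀ m a b, Φ m (a ⊗ₜ b) = a * p (b * m) := by intro m a b; simp [Φ]
    have hΦN : ∀ m t, Φ m t ∈ N := by
      intro m t
      induction t with
      | zero => simp
      | tmul a b => rw [hΦ]; exact N.smul_mem a (hpN _)
      | add s t hs ht => rw [map_add]; exact N.add_mem hs ht
    have ha : ∀ m m' t, Φ (m + m') t = Φ m t + Φ m' t := by
      intro m m' t
      induction t with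
      | zero => simp
      | tmul a b => simp only [hΦ, mul_add, map_add]
      | add s t hs ht => simp only [map_add, hs, ht]; abel
    have hm : ∀ x m, Φ (x * m) c = x * Φ m c := by
      intro x m
      have e1 : ∀ t, Φ (x * m) t = Φ m ((LinearMap.mulRight K x).lTensor A t) := by
        intro t
        induction t with
        | zero => simp
        | tmul a b => simp [hΦ, mul_assoc]
        | add s t hs ht => simp only [map_add, hs, ht]
      have e2 : ∀ t, x * Φ m t = Φ m ((LinearMap.mulLeft K x).rTensor A t) := by
        intro t
        induction t with
        | zero => simp
        | tmul a b => simp [hΦ, mul_assoc]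
        | add s t hs ht => simp only [map_add, mul_add, hs, ht]
      rw [e1, e2, h2]
    have hn : ∀ m ∈ N, Φ m c = m := by
      intro m hmN
      have : ∀ t, Φ m t = LinearMap.mul' K A t * m := by
        intro t
        induction t with
        | zero => simp
        | tmul a b => 
          rw [hΦ, hpx (b * m) (N.smul_mem b hmN)]; simp [mul_assoc]
        | add s t hs ht => simp only [map_add, add_mul, hs, ht]
      rw [this, h1, one_mul]
    refine ⟨{ toFun := fun m => ⟨Φ m c, hΦN m c⟩
              map_add' := fun m m' => Subtype.ext (ha _ _ _)
              map_smul' := fun x m => Subtype.ext (hm _ _) }, ?_⟩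
    ext ⟨m, hmN⟩
    simpa using hn m hmN
  refine (isSemisimpleModule_iff A A).2 ⟨fun N => ?_⟩
  obtain ⟨q, hq⟩ := key N
  exact ⟨_, LinearMap.isCompl_of_proj (fun x => LinearMap.congr_fun hq x)⟩

theorem ss_of_int {K H : Type*} [Field K] [Ring H] [HopfAlgebra K H] [FiniteDimensional K H]
    {Λ : H} (hΛ : IsInt K Λ) : IsSemisimpleRing H := by
  refine maschke (K := K) (sw K Λ fun a b => a ⊗ₜ HopfAlgebra.antipode K b) ?_ fun x => ?_
  · rw [map_sw]
    simp only [LinearMap.mul'_apply]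
    rw [sw_S_right Λ (fun x => x) , hΛ.e, one_smul]
  · obtain ⟨x, rfl⟩ := S_surj hΛ x
    rw [map_sw, map_sw]
    simp only [LinearMap.rTensor_tmul, LinearMap.lTensor_tmul, LinearMap.mulLeft_apply, LinearMap.mulRight_apply]
    have := Λ_mul_left hΛ x (fun a b => a ⊗ₜ[K] HopfAlgebra.antipode K b)
    rw [← this]
    simp only [S_mul]
end HP
end

section

open TensorProduct LinearMap Coalgebra
namespace HP
set_option linter.unusedSectionVars false

section DDex
variable {K H P E V : Type*} [Field K] [Ring H] [HopfAlgebra K H] [FiniteDimensional K H]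
    [Ring P] [HopfAlgebra K P] [FiniteDimensional K P] 
local notation "S" => HopfAlgebra.antipode K
variable (π : HPair K H P) 

theorem lin_end {V W : Type*} [AddCommGroup V] [Module K V] [AddCommGroup W] [Module K W]
    {f : V → Module.End K W} (h : ∀ w, Lin K (fun x => f x w)) : Lin K f :=
  Lin.mk' (fun x y => LinearMap.ext fun w => (h w).map_add x y)
    (fun c x => LinearMap.ext fun w => (h w).map_smul c x)

variable (K) in
/-- left-right multiplication -/
noncomputable def lr (a b : H) : Module.End K H := LinearMap.mulLeft K b ∘ₗ LinearMap.mulRight K (S a)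
theorem lr_apply (a b x : H) : lr K a b x = b * (x * S a) := rfl
@[fun_prop] theorem lin_lr1 {f : V → H} [AddCommGroup V] [Module K V] (hf : Lin K f) (b : H) :
    Lin K (fun x => lr K (f x) b) := lin_end fun w => by simp only [lr_apply]; fun_prop
@[fun_prop] theorem lin_lr2 {f : V → H} [AddCommGroup V] [Module K V] (hf : Lin K f) (b : H) :
    Lin K (fun x => lr K b (f x)) := lin_end fun w => by simp only [lr_apply]; fun_prop
theorem lr_mul (a b c d : H) : lr K (a * c) (b * d) = lr K a b * lr K c d := by
  ext x; simp [lr_apply, S_mul, mul_assoc]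

/-- hit action -/
noncomputable def cc (p : P) : Module.End K H := toLin (fun x => sw K x fun a b => π.B p b • a) (by fun_prop)
theorem cc_apply (p : P) (x : H) : cc π p x = sw K x fun a b => π.B p b • a := rfl
@[fun_prop] theorem lin_cc {f : V → P} [AddCommGroup V] [Module K V] (hf : Lin K f) :
    Lin K (fun x => cc π (f x)) := lin_end fun w => by simp only [cc_apply]; fun_prop
theorem cc_mul (p q : P) : cc π (p * q) = cc π p * cc π q := by
  ext x
  simp only [cc_apply, π.mulP, Module.End.mul_apply, sw_smul, map_sw, map_smul, smul_sw, smul_smul]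
  rw [← coassoc]
  simp only [mul_comm]

/-- operators on the tensor square -/
noncomputable def tm (T : Module.End K H) (m : H) : Module.End K (H ⊗[K] H) := TensorProduct.map T (LinearMap.mulLeft K m)
theorem tm_apply (T : Module.End K H) (m x y : H) : tm T m (x ⊗ₜ y) = T x ⊗ₜ[K] (m * y) := rfl
@[fun_prop] theorem lin_tm1 [AddCommGroup V] [Module K V] {f : V → Module.End K H} (hf : Lin K f) (m : H) :
    Lin K (fun x => tm (f x) m) := by
  obtain ⟨g, hg⟩ := hf
  refine ⟨(TensorProduct.mapBilinear (RingHom.id K) H H H H).flip (LinearMap.mulLeft K m) ∘ₗ g, fun x => ?_⟩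
  simp only [hg]; rfl
@[fun_prop] theorem lin_tm2 [AddCommGroup V] [Module K V] {f : V → H} (T : Module.End K H) (hf : Lin K f) :
    Lin K (fun x => tm T (f x)) := by
  obtain ⟨g, hg⟩ := hf
  refine ⟨(TensorProduct.mapBilinear (RingHom.id K) H H H H) T ∘ₗ LinearMap.mul K H ∘ₗ g, fun x => ?_⟩
  simp only [hg]; rfl
theorem tm_mul (T T' : Module.End K H) (m m' : H) : tm T m * tm T' m' = tm (T * T') (m * m') := by
  ext x y
  simp [tm_apply, mul_assoc]
theorem tm_one : tm (1 : Module.End K H) 1 = 1 := by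
  ext x y
  simp [tm_apply]
theorem sw_tm {H' : Type*} [Ring H'] [HopfAlgebra K H'] [FiniteDimensional K H'] (h : H') 
    (F : H' → H' → Module.End K H) (m : H) : tm (sw K h F) m = sw K h fun a b => tm (F a b) m :=
  sw_map (fun T => tm T m) (by fun_prop) h F
theorem smul_tm (c : K) (T : Module.End K H) (m : H) : c • tm T m = tm (c • T) m :=
  (Lin.map_smul (f := fun T => tm T m) (by fun_prop) c T).symm

/-- the map iota -/
noncomputable def iot : H →ₐ[K] Module.End K (H ⊗[K] H) :=
  AlgHom.ofLinearMap (toLin (K := K) (fun h => sw K h fun a c => sw K c fun m b => tm (lr K a b) m) (by fun_prop))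
  (by
    simp only [toLin_apply]
    rw [sw_one _ (by fun_prop) (by fun_prop), sw_one _ (by fun_prop) (by fun_prop)]
    rw [← tm_one]
    congr 1
    ext x; simp [lr_apply])
  (fun x y => by
    simp only [toLin_apply]
    rw [sw_prod _ _ _ (by fun_prop) (by fun_prop), sw_mul]
    refine sw_congr _ fun a c => ?_
    rw [mul_sw]
    refine sw_congr _ fun a' c' => ?_
    rw [sw_prod _ _ _ (by fun_prop) (by fun_prop), sw_mul]
    refine sw_congr _ fun m b => ?_
    rw [mul_sw]
    refine sw_congr _ fun m' b' => ?_
    simp only [lr_mul, tm_mul])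
theorem iot_apply (h : H) : iot (K := K) h = sw K h fun a c => sw K c fun m b => tm (lr K a b) m := rfl

/-- the map kappa -/
noncomputable def kap : P →ₐ[K] Module.End K (H ⊗[K] H) :=
  AlgHom.ofLinearMap (toLin (fun p => tm (cc π p) 1) (by fun_prop))
  (by
    simp only [toLin_apply]
    rw [← tm_one]
    congr 1
    ext x; simp only [cc_apply, π.oneP]
    exact sw_counit_right x (fun x => x))
  (fun x y => by simp [cc_mul, tm_mul])
theorem kap_apply (p : P) : kap π p = tm (cc π p) 1 := rfl

variable (hS : ∀ x : H, HopfAlgebra.antipode K (HopfAlgebra.antipode K x) = x)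

/-- auxiliary operator -/
noncomputable def R1 (p : P) (c d : H) : Module.End K H := 
  toLin (fun x => sw K d fun a b => sw K x fun x1 x2 => π.B p (b * x2) • (a * (x1 * S c))) (by fun_prop)
theorem R1_apply (p : P) (c d x : H) : R1 π p c d x =
   sw K d fun a b => sw K x fun x1 x2 => π.B p (b * x2) • (a * (x1 * S c)) := rfl

theorem claim1 (p : P) (c h : H) : sw K h (fun a b => sw K p fun u w => π.B u b • (lr K c a * cc π w)) =
    R1 π p c h := by
  ext x
  rw [sw_app, R1_apply]
  refine sw_congr _ fun a b => ?_
  rw [sw_app]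
  simp only [LinearMap.smul_apply, Module.End.mul_apply, cc_apply, map_sw, map_smul, smul_sw, smul_smul, lr_apply]
  rw [sw_comm]
  refine sw_congr _ fun x1 x2 => ?_
  rw [← sw_smul, π.mulH]

include hS in
theorem claim2 (p : P) (q d : H) : sw K q (fun e c => sw K p fun u w => π.B w e • (cc π u * lr K c d)) =
    R1 π p q d := by
  ext x
  rw [sw_app]
  calc _ = sw K q (fun e c => sw K c fun c1 c2 => sw K d fun a b => sw K x fun x1 x2 =>
          π.B p (b * (x2 * (S c1 * e))) • (a * (x1 * S c2))) := by
        refine sw_congr _ fun e c => ?_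
        rw [sw_app]
        simp only [LinearMap.smul_apply, Module.End.mul_apply, cc_apply, lr_apply]
        have : ∀ u : P, sw K (d * (x * S c)) (fun a b => π.B u b • a) =
          sw K c fun c1 c2 => sw K d fun a b => sw K x fun x1 x2 =>
            π.B u (b * (x2 * S c1)) • (a * (x1 * S c2)) := by
          intro u
          rw [sw_prod _ _ _ (by fun_prop) (by fun_prop), sw_comm (h := c)]
          refine sw_congr _ fun a b => ?_
          rw [sw_prod _ _ _ (by fun_prop) (by fun_prop), sw_comm (h := c)]
          refine sw_congr _ fun x1 x2 => ?_
          rw [sw_anti _ _ (by fun_prop) (by fun_prop)]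
        simp only [this, smul_sw, smul_smul]
        rw [sw_comm]; refine sw_congr _ fun c1 c2 => ?_
        rw [sw_comm]; refine sw_congr _ fun a b => ?_
        rw [sw_comm]; refine sw_congr _ fun x1 x2 => ?_
        rw [← sw_smul]
        have e2 : b * (x2 * (S c1 * e)) = (b * (x2 * S c1)) * e := by simp only [mul_assoc]
        rw [e2, π.mulH]
        simp only [mul_comm]
    _ = sw K q (fun t c2 => sw K t fun e c1 => sw K d fun a b => sw K x fun x1 x2 =>
          π.B p (b * (x2 * (S c1 * e))) • (a * (x1 * S c2))) := (coassoc ..).symm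
    _ = sw K q (fun t c2 => Coalgebra.counit (R := K) t • sw K d fun a b => sw K x fun x1 x2 =>
          π.B p (b * (x2 * 1)) • (a * (x1 * S c2))) := by
        refine sw_congr _ fun t c2 => ?_
        rw [sw_So_left hS t (fun z => sw K d fun a b => sw K x fun x1 x2 =>
          π.B p (b * (x2 * z)) • (a * (x1 * S c2)))]
    _ = _ := by
        rw [sw_counit_left q (fun c2 => sw K d fun a b => sw K x fun x1 x2 =>
          π.B p (b * (x2 * 1)) • (a * (x1 * S c2))), R1_apply]
        simp only [mul_one]

include hS in
theorem yd_iot : YD (E := Module.End K (H ⊗[K] H)) π (iot (K := K)) (kap π) where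
  rel := fun h p => by
    trans sw K h fun a r => sw K r fun m d => tm (R1 π p a d) m
    · calc _ = sw K h fun t b => sw K t fun a c => sw K c fun m d =>
              tm (sw K p fun u w => π.B u b • (lr K a d * cc π w)) m := by
            refine sw_congr _ fun t b => ?_
            simp only [iot_apply, kap_apply, sw_mul, smul_sw, sw_tm, tm_mul, mul_one, smul_tm]
            rw [sw_comm]; refine sw_congr _ fun a c => ?_
            rw [sw_comm]
        _ = sw K h fun a r => sw K r fun c b => sw K c fun m d =>
              tm (sw K p fun u w => π.B u b • (lr K a d * cc π w)) m := coassoc ..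
        _ = sw K h fun a r => sw K r fun m d' => sw K d' fun d b =>
              tm (sw K p fun u w => π.B u b • (lr K a d * cc π w)) m := by
            refine sw_congr _ fun a r => ?_
            exact coassoc ..
        _ = _ := by
            refine sw_congr _ fun a r => sw_congr _ fun m d' => ?_
            rw [← claim1, sw_tm]
    · symm
      calc _ = sw K h fun e r => sw K r fun c s => sw K s fun m d =>
              tm (sw K p fun u w => π.B w e • (cc π u * lr K c d)) m := by
            refine sw_congr _ fun t b => ?_
            simp only [iot_apply, kap_apply, mul_sw, smul_sw, sw_tm, tm_mul, one_mul, smul_tm]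
            rw [sw_comm]; refine sw_congr _ fun a c => ?_
            rw [sw_comm]
        _ = sw K h fun q s => sw K q fun e c => sw K s fun m d =>
              tm (sw K p fun u w => π.B w e • (cc π u * lr K c d)) m := (coassoc ..).symm
        _ = _ := by
            refine sw_congr _ fun a r => ?_
            rw [sw_comm]
            refine sw_congr _ fun m d => ?_
            rw [← claim2 π hS, sw_tm]

/-- the multiplication map -/
noncomputable def mm : H ⊗[K] P →ₗ[K] Module.End K (H ⊗[K] H) :=
  LinearMap.mul' K _ ∘ₗ TensorProduct.map (iot (K := K)).toLinearMap (kap π).toLinearMap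
theorem mm_apply (h : H) (p : P) : mm π (h ⊗ₜ p) = iot h * kap π p := rfl

/-- auxiliary -/
noncomputable def psi0 (y : H) (l : H) : H :=
  sw K l fun l1 r => sw K r fun l2 l3 => Coalgebra.counit (R := K) (S l3 * (y * l1)) • l2
theorem psi0_l1 (x : H) : Lin K (fun l => psi0 (K := K) x l) := by
  unfold psi0; fun_prop
theorem psi0_l2 (l : H) : Lin K (fun T => psi0 (K := K) T l) := by
  unfold psi0; fun_prop
/-- the un-twisting map -/
noncomputable def psi (x : H) : Module.End K (H ⊗[K] H) →ₗ[K] H :=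
  TensorProduct.lift (LinearMap.mk₂ K (fun (T : H) l => psi0 (K := K) T l)
    (fun T T' l => (psi0_l2 l).map_add T T') (fun c T l => (psi0_l2 l).map_smul c T)
    (fun T a b => (psi0_l1 T).map_add a b) (fun c T a => (psi0_l1 T).map_smul c a)) ∘ₗ
    LinearMap.applyₗ (x ⊗ₜ 1)
theorem psi_tm (x : H) (T : Module.End K H) (l : H) : psi x (tm T l) = 
  sw K l fun l1 r => sw K r fun l2 l3 => Coalgebra.counit (R := K) (S l3 * (T x * l1)) • l2 := by
  simp [psi, tm_apply, psi0]

theorem psi_mm (x : H) (h : H) (p : P) : psi x (mm π (h ⊗ₜ p)) = π.B p x • h := by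
  have e : Coalgebra.counit (R := K) (cc π p x) = π.B p x := by
    rw [cc_apply, map_sw]
    simp only [map_smul, smul_eq_mul]
    have := sw_counit_left (K := K) x (fun b => π.B p b)
    simpa [mul_comm] using this
  simp only [mm_apply, iot_apply, kap_apply, sw_mul, tm_mul, mul_one, map_sw, psi_tm,
    Module.End.mul_apply, lr_apply]
  simp only [Bialgebra.counit_mul, eps_S, e]
  calc _ = sw K h fun a c => sw K c fun m b => (π.B p x * (Coalgebra.counit (R := K) b * Coalgebra.counit (R := K) a)) • m := by
        refine sw_congr _ fun a c => sw_congr _ fun m b => ?_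
        have := sw_counit_left (K := K) m (fun r => (π.B p x * (Coalgebra.counit (R := K) b * Coalgebra.counit (R := K) a)) • r)
        rw [← this]
        refine sw_congr _ fun l1 r => ?_
        have := sw_counit_right (K := K) r (fun r => (π.B p x * (Coalgebra.counit (R := K) b * Coalgebra.counit (R := K) a)) • r)
        rw [← this, smul_sw]
        refine sw_congr _ fun l1 r => ?_
        simp only [smul_smul]
        congr 1; ring
    _ = _ := by
        have := sw_counit_left (K := K) h (fun r => π.B p x • r)
        rw [← this]
        refine sw_congr _ fun a c => ?_
        have := sw_counit_right (K := K) c (fun r => π.B p x • r)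
        rw [← this, smul_sw]
        refine sw_congr _ fun l1 r => ?_
        simp only [smul_smul]
        congr 1; ring

theorem mm_inj : Function.Injective (mm π) := by
  have key : ∀ s, s = π.dp fun y q => psi y (mm π s) ⊗ₜ[K] q := by
    intro s
    induction s with
    | zero => simp; exact (π.dp_eps (fun _ => 0)).symm.trans (by simp)
    | tmul h p =>
      simp only [psi_mm, TensorProduct.smul_tmul]
      simp only [← TensorProduct.smul_tmul', ← TensorProduct.smul_tmul]
      exact (π.dp_eval' p (fun q => h ⊗ₜ q)).symm
    | add s t hs ht =>
      have : Lin K (fun s => π.dp fun y q => psi y (mm π s) ⊗ₜ[K] q) := by fun_prop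
      rw [this.map_add, ← hs, ← ht]
  intro s t h
  rw [key s, h, ← key t]

/-- the Drinfeld double as a subalgebra -/
noncomputable def DA : Subalgebra K (Module.End K (H ⊗[K] H)) where
  carrier := Set.range (mm π)
  mul_mem' := by
    rintro _ _ ⟨s, rfl⟩ ⟨t, rfl⟩
    change _ ∈ LinearMap.range (mm π)
    induction s with
    | zero => simp
    | add s s' hs hs' => rw [map_add, add_mul]; exact add_mem hs hs'
    | tmul h p =>
      induction t with
      | zero => simp
      | add s s' hs hs' => rw [map_add, mul_add]; exact add_mem hs hs'
      | tmul h' p' =>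
        have e1 : iot (K := K) h * kap π p * (iot (K := K) h' * kap π p') = iot (K := K) h * (kap π p * iot (K := K) h') * kap π p' := by
          simp only [mul_assoc]
        rw [mm_apply, mm_apply, e1, (yd_iot π hS).straight hS]
        have e3 : ∀ (c : K) x y, iot (K := K) h * (c • (iot (K := K) x * kap π y)) * kap π p' =
            mm π (c • ((h * x) ⊗ₜ (y * p'))) := by
          intro c x y
          simp only [mul_smul_comm, smul_mul_assoc, map_smul, mm_apply, map_mul, mul_assoc]
        simp only [mul_sw, sw_mul, e3, ← map_sw]
        exact ⟨_, rfl⟩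
  one_mem' := ⟨1 ⊗ₜ 1, by simp [mm_apply]⟩
  add_mem' := by
    rintro _ _ ⟨s, rfl⟩ ⟨t, rfl⟩
    exact ⟨s + t, map_add _ _ _⟩
  algebraMap_mem' := fun c => ⟨c • (1 ⊗ₜ 1), by simp [mm_apply, Algebra.algebraMap_eq_smul_one]⟩

theorem YD.of_inj {A E : Type*} [Ring A] [Algebra K A] [Ring E] [Algebra K E] {π : HPair K H P} {f : H →ₐ[K] A} {g : P →ₐ[K] A}
    (j : A →ₐ[K] E) (hj : Function.Injective j) (h : YD π (j.comp f) (j.comp g)) : YD π f g where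
  rel := fun a p => by
    apply hj
    simpa only [algHom_sw, map_smul, map_mul, AlgHom.comp_apply] using h.rel a p
theorem YD.comp {A E : Type*} [Ring A] [Algebra K A] [Ring E] [Algebra K E] {π : HPair K H P} {f : H →ₐ[K] A} {g : P →ₐ[K] A}
    (j : A →ₐ[K] E) (h : YD π f g) : YD π (j.comp f) (j.comp g) where
  rel := fun a p => by
    have := congr_arg j (h.rel a p)
    simpa only [algHom_sw, map_smul, map_mul, AlgHom.comp_apply] using this

/-- the double -/
noncomputable def DAdd : DD π (DA π hS) where
  ι := (iot (K := K)).codRestrict _ (fun h => ⟨h ⊗ₜ 1, by simp [mm_apply]⟩)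
  κ := (kap π).codRestrict _ (fun h => ⟨1 ⊗ₜ h, by simp [mm_apply]⟩)
  yd := YD.of_inj (DA π hS).val Subtype.val_injective (yd_iot π hS)
  μ := LinearEquiv.ofInjective (mm π) (mm_inj π)
  hμ := fun h p => Subtype.ext rfl
end DDex
end HP
end

section

open TensorProduct LinearMap Coalgebra
namespace HP
set_option linter.unusedSectionVars false

namespace DD
variable {K H P E V A : Type*} [Field K] [CharZero K] [Ring H] [HopfAlgebra K H] [FiniteDimensional K H]
    [Ring P] [HopfAlgebra K P] [FiniteDimensional K P] [Ring E] [Algebra K E]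
    [AddCommGroup V] [Module K V] {π : HPair K H P} [Ring A] [Algebra K A] [FiniteDimensional K A] (D : DD π A)
  (hS : ∀ x : H, HopfAlgebra.antipode K (HopfAlgebra.antipode K x) = x)
  {Λ : H} (hΛ : IsInt K Λ)
local notation "S" => HopfAlgebra.antipode K

variable (π) in
/-- auxiliary operator -/
noncomputable def phi (u w2 : P) : H →ₗ[K] H := 
  toLin (fun y => sw K y fun a b => sw K b fun b1 b2 => (π.B u b2 * π.B w2 (S a)) • b1) (by fun_prop)

theorem lam_eq (hS : ∀ x : H, HopfAlgebra.antipode K (HopfAlgebra.antipode K x) = x) (x : H) :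
    LinearMap.trace K H (LinearMap.mulLeft K x) = lam K H x := by
  rw [lam_apply]
  congr 1
  ext y; simp [hS]

include hS hΛ in
theorem phi_sum (p : P) (h : H) : sw K p (fun u w => sw K w fun w1 w2 =>
    ((Module.finrank K H : K) * π.B w1 Λ) • (phi π u w2 ∘ₗ LinearMap.mulLeft K h)) =
    ((Module.finrank K H : K) * π.B p Λ) • LinearMap.mulLeft K h := by
  ext y
  simp only [sw_app, LinearMap.smul_apply, LinearMap.comp_apply, LinearMap.mulLeft_apply, phi, toLin_apply]
  generalize h * y = z
  calc _ = sw K z fun a b => sw K b fun b1 b2 => ((Module.finrank K H : K) * π.B p (b2 * (Λ * S a))) • b1 := by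
        simp only [smul_sw, smul_smul]
        calc _ = sw K p fun u w => sw K z fun a b => sw K b fun b1 b2 => sw K w fun w1 w2 => 
              ((Module.finrank K H : K) * π.B w1 Λ * (π.B u b2 * π.B w2 (S a))) • b1 := by
              refine sw_congr _ fun u w => ?_
              rw [sw_comm]; refine sw_congr _ fun _ _ => ?_
              rw [sw_comm]
          _ = _ := by
            rw [sw_comm]; refine sw_congr _ fun a b => ?_
            rw [sw_comm]; refine sw_congr _ fun b1 b2 => ?_
            simp only [← sw_smul]
            congr 1
            simp only [π.mulH, mul_sw]
            refine sw_congr _ fun _ _ => sw_congr _ fun _ _ => ?_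
            ring
    _ = _ := by
        simp only [hΛ.l, hΛ.r, map_smul, mul_smul_comm, eps_S]
        have := sw_counit_left (K := K) z (fun r => ((Module.finrank K H : K) * π.B p Λ) • r)
        rw [← this]
        refine sw_congr _ fun a c => ?_
        have := sw_counit_right (K := K) c (fun r => ((Module.finrank K H : K) * π.B p Λ) • r)
        rw [← this, smul_sw]
        refine sw_congr _ fun l1 r => ?_
        simp only [smul_smul, smul_eq_mul]

include hS hΛ in
theorem trace_κι (p : P) (h : H) : LinearMap.trace K A (LinearMap.mulLeft K (D.κ p * D.ι h)) =
    lam K P p * lam K H h := by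
  let T : Module.End K (H ⊗[K] P) := sw K p fun u w => sw K w fun w1 w2 =>
    TensorProduct.map (phi π u w2 ∘ₗ LinearMap.mulLeft K h) (LinearMap.mulLeft K w1)
  have hT : D.μ.conj T = LinearMap.mulLeft K (D.κ p * D.ι h) := by
    ext x
    refine D.ext_lin (fun x => D.μ.conj T x) (fun x => LinearMap.mulLeft K (D.κ p * D.ι h) x) (by fun_prop) (by fun_prop)
      (fun y q => ?_) x
    rw [LinearEquiv.conj_apply, ← D.hμ]
    simp only [LinearMap.comp_apply, LinearEquiv.coe_coe, LinearEquiv.symm_apply_apply]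
    rw [D.hμ, LinearMap.mulLeft_apply]
    have e1 : D.κ p * D.ι h * (D.ι y * D.κ q) = (D.κ p * D.ι (h * y)) * D.κ q := by
      simp only [mul_assoc, map_mul]
    rw [e1, D.yd.straight hS]
    simp only [T, sw_app, TensorProduct.map_tmul, LinearMap.comp_apply, LinearMap.mulLeft_apply, phi, toLin_apply,
      sw_tmul, ← TensorProduct.smul_tmul', sw_mul]
    refine (map_sw D.μ.toLinearMap p _).trans ?_
    trans sw K p fun u w => sw K w fun w1 w2 => sw K (h * y) fun a b => sw K b fun b1 b2 =>
           (π.B u b2 * π.B w2 (S a)) • (D.ι b1 * D.κ (w1 * q))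
    · refine sw_congr _ fun u w => ?_
      refine (map_sw D.μ.toLinearMap _ _).trans ?_
      refine sw_congr _ fun u w => ?_
      refine (map_sw D.μ.toLinearMap _ _).trans ?_
      refine sw_congr _ fun u w => ?_
      refine (map_sw D.μ.toLinearMap _ _).trans ?_
      refine sw_congr _ fun u w => ?_
      refine (map_smul D.μ.toLinearMap _ _).trans ?_
      congr 1
      exact D.hμ _ _
    calc _ = sw K p fun u w => sw K (h * y) fun a b => sw K b fun b1 b2 => sw K w fun w1 w2 => 
           (π.B u b2 * π.B w2 (S a)) • (D.ι b1 * D.κ (w1 * q)) := by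
          refine sw_congr _ fun u w => ?_
          rw [sw_comm]; refine sw_congr _ fun _ _ => ?_
          rw [sw_comm]
      _ = _ := by
          rw [sw_comm]; refine sw_congr _ fun _ _ => ?_
          rw [sw_comm]
          simp only [map_mul, smul_mul_assoc, mul_assoc]
  rw [← hT, LinearMap.trace_conj']
  simp only [T, map_sw, LinearMap.trace_tensorProduct', lam_eq (π.SP hS)]
  have e : ∀ w1 u w2, LinearMap.trace K H (phi π u w2 ∘ₗ LinearMap.mulLeft K h) * lam K P w1 =
    LinearMap.trace K H (((Module.finrank K H : K) * π.B w1 Λ) • (phi π u w2 ∘ₗ LinearMap.mulLeft K h)) := by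
    intro w1 u w2
    rw [lamP π hΛ hS, map_smul, smul_eq_mul, mul_comm]
  simp only [e, ← map_sw]
  rw [phi_sum hS hΛ, map_smul, lam_eq hS, lamP π hΛ hS, smul_eq_mul]

/-- trace form -/
noncomputable def tt (K : Type*) {A : Type*} [Field K] [Ring A] [Algebra K A] : A →ₗ[K] K := LinearMap.trace K A ∘ₗ LinearMap.mul K A
theorem tt_apply (x : A) : tt K x = LinearMap.trace K A (LinearMap.mulLeft K x) := rfl
theorem tt_comm (x y : A) : tt K (x * y) = tt K (y * x) := by
  rw [tt_apply, tt_apply, LinearMap.mulLeft_mul, LinearMap.mulLeft_mul, LinearMap.trace_comp_comm']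

include hS hΛ in
/-- Casimir identity -/
theorem casimir (x : A) : x = sw K (LamP π) fun u w => sw K Λ fun a b => 
    tt K (x * (D.ι a * D.κ w)) • (D.κ (S u) * D.ι (S b)) := by
  refine D.ext_lin' hS (fun x => x) (fun x => sw K (LamP π) fun u w => sw K Λ fun a b => 
    tt K (x * (D.ι a * D.κ w)) • (D.κ (S u) * D.ι (S b))) (by fun_prop) (by fun_prop) (fun h p => ?_) x
  have e : ∀ a w, tt K (D.κ p * D.ι h * (D.ι a * D.κ w)) = lam K P (w * p) * lam K H (h * a) := by
    intro a w
    rw [← D.trace_κι hS hΛ, ← tt_apply, ← mul_assoc, tt_comm]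
    simp only [map_mul, mul_assoc]
  simp only [e]
  conv_lhs => rw [rec2 (LamP_int π hΛ hS) (π.SP hS) p, rec1 hΛ hS h]
  simp only [algHom_sw, sw_mul, mul_sw, map_smul, smul_mul_assoc, mul_smul_comm, smul_smul, smul_sw]
  rw [sw_comm]
  refine sw_congr _ fun _ _ => sw_congr _ fun _ _ => ?_
  rw [mul_comm]

include D hS hΛ in
theorem tt_nondeg (x : A) (h : ∀ y, tt K (x * y) = 0) : x = 0 := by
  rw [D.casimir hS hΛ x]
  simp only [h, zero_smul, sw]
  simp

include D hS hΛ in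
theorem semisimple : IsSemisimpleRing A := by
  have hA : ∀ x : A, sw K (LamP π) (fun u w => sw K Λ fun a b => 
    tt K (x * (D.κ (S u) * D.ι (S b))) • (D.ι a * D.κ w)) = x := by
    intro x
    rw [← sub_eq_zero]
    apply D.tt_nondeg hS hΛ
    intro y
    rw [sub_mul, map_sub, sub_eq_zero, sw_mul, map_sw, tt_comm x y]
    simp only [sw_mul, map_sw]
    conv_rhs => rw [D.casimir hS hΛ y]
    simp only [sw_mul, map_sw, smul_mul_assoc, map_smul, smul_eq_mul]
    refine sw_congr _ fun u w => sw_congr _ fun a b => ?_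
    rw [mul_comm, tt_comm y, tt_comm x]
  refine maschke (K := K) (sw K (LamP π) fun u w => sw K Λ fun a b => 
    (D.κ (S u) * D.ι (S b)) ⊗ₜ[K] (D.ι a * D.κ w)) ?_ fun x => ?_
  · simp only [map_sw, LinearMap.mul'_apply]
    have e : ∀ u w, sw K Λ (fun a b => D.κ (S u) * D.ι (S b) * (D.ι a * D.κ w)) = D.κ (S u * w) := by
      intro u w
      have := sw_So_left hS Λ (fun z => D.κ (S u) * D.ι z * D.κ w)
      simp only [map_mul] at this ⊢
      simp only [hΛ.e, one_smul, map_one, mul_one, mul_assoc] at this ⊢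
      exact this
    simp only [e]
    rw [sw_S_left (LamP π) (fun z => D.κ z), (LamP_int π hΛ hS).e]
    simp
  · simp only [map_sw, LinearMap.rTensor_tmul, LinearMap.lTensor_tmul, LinearMap.mulLeft_apply, LinearMap.mulRight_apply]
    trans sw K (LamP π) fun u w => sw K Λ fun a b => sw K (LamP π) fun u' w' => sw K Λ fun a' b' => 
      tt K ((x * (D.κ (S u) * D.ι (S b))) * (D.ι a' * D.κ w')) • ((D.κ (S u') * D.ι (S b')) ⊗ₜ[K] (D.ι a * D.κ w))
    · refine sw_congr _ fun u w => sw_congr _ fun a b => ?_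
      conv_lhs => rw [D.casimir hS hΛ (x * (D.κ (S u) * D.ι (S b)))]
      simp only [sw_tmul, TensorProduct.smul_tmul']
    · symm
      trans sw K (LamP π) fun u' w' => sw K Λ fun a' b' => sw K (LamP π) fun u w => sw K Λ fun a b => 
        tt K ((x * (D.κ (S u) * D.ι (S b))) * (D.ι a' * D.κ w')) • ((D.κ (S u') * D.ι (S b')) ⊗ₜ[K] (D.ι a * D.κ w))
      · refine sw_congr _ fun u w => sw_congr _ fun a b => ?_
        conv_lhs => rw [← hA (D.ι a * D.κ w * x)]
        simp only [tmul_sw, TensorProduct.tmul_smul]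
        refine sw_congr _ fun u' w' => sw_congr _ fun a' b' => ?_
        rw [← tt_comm (D.ι a * D.κ w)]
        simp only [mul_assoc]
      · calc _ = sw K (LamP π) fun u' w' => sw K (LamP π) fun u w => sw K Λ fun a' b' => sw K Λ fun a b => 
            tt K ((x * (D.κ (S u) * D.ι (S b))) * (D.ι a' * D.κ w')) • ((D.κ (S u') * D.ι (S b')) ⊗ₜ[K] (D.ι a * D.κ w)) := by
              refine sw_congr _ fun u w => ?_
              rw [sw_comm]
          _ = _ := by
              rw [sw_comm]
              refine sw_congr _ fun u w => ?_
              calc _ = sw K (LamP π) fun u' w' => sw K Λ fun a b => sw K Λ fun a' b' => 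
                    tt K ((x * (D.κ (S u) * D.ι (S b))) * (D.ι a' * D.κ w')) • ((D.κ (S u') * D.ι (S b')) ⊗ₜ[K] (D.ι a * D.κ w)) := by
                      refine sw_congr _ fun u w => ?_
                      rw [sw_comm]
                _ = _ := by rw [sw_comm]
end DD
end HP
end

section

open TensorProduct LinearMap Coalgebra
namespace HP
set_option linter.unusedSectionVars false

section dets
variable {K H P E M V W : Type*} [Field K] [Ring H] [HopfAlgebra K H] [FiniteDimensional K H]
    [Ring P] [HopfAlgebra K P] [FiniteDimensional K P] [Ring E] [Algebra K E]
    [AddCommGroup M] [Module K M] [FiniteDimensional K M] [AddCommGroup V] [Module K V] [AddCommGroup W] [Module K W]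
    (π : HPair K H P)
local notation "S" => HopfAlgebra.antipode K

theorem dp_app (F : H → P → (V →ₗ[K] W)) (x : V) : (π.dp F) x = π.dp fun y q => F y q x :=
  π.dp_map (fun T : V →ₗ[K] W => T x) F
theorem map_dp (g : V →ₗ[K] W) (F : H → P → V) : g (π.dp F) = π.dp fun y q => g (F y q) :=
  π.dp_map (fun T => g T) F
theorem dp_tmul (F : H → P → V) (x : W) : (π.dp F) ⊗ₜ[K] x = π.dp fun y q => F y q ⊗ₜ[K] x :=
  π.dp_map (fun T => T ⊗ₜ[K] x) F

theorem det_op (T : Module.End K M) (T' : Module.End K H) : LinearMap.det (TensorProduct.map T T') = 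
    LinearMap.det T ^ Module.finrank K H * LinearMap.det T' ^ Module.finrank K M := by
  classical
  let b := Module.finBasis K M
  let c := Module.finBasis K H
  rw [← LinearMap.det_toMatrix (b.tensorProduct c), TensorProduct.toMatrix_map, Matrix.det_kronecker,
    LinearMap.det_toMatrix, LinearMap.det_toMatrix]
  simp

variable (K M H) in
/-- operators on the right factor -/
noncomputable def opr : Module.End K H →ₐ[K] Module.End K (M ⊗[K] H) := Module.End.lTensorAlgHom K H M
variable (K M H) in
/-- operators on the left factor -/
noncomputable def opl : Module.End K M →ₐ[K] Module.End K (M ⊗[K] H) := Module.End.rTensorAlgHom K M H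
theorem opr_apply (T : Module.End K H) (m : M) (x : H) : opr K H M T (m ⊗ₜ x) = m ⊗ₜ T x := rfl
theorem opl_apply (T : Module.End K M) (m : M) (x : H) : opl K H M T (m ⊗ₜ x) = T m ⊗ₜ x := rfl
theorem op_comm (T : Module.End K M) (T' : Module.End K H) : 
    opr K H M T' * opl K H M T = opl K H M T * opr K H M T' := by
  ext m x
  simp [opr_apply, opl_apply]

/-- R operator -/
noncomputable def RR (f : H →ₐ[K] E) (g : P →ₐ[K] E) : E := π.dp fun y q => f y * g q

theorem RR_inv (f : H →ₐ[K] E) (g : P →ₐ[K] E) (hc : ∀ y q, f y * g q = g q * f y) :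
    RR π f g * vv π f g = 1 := by
  rw [RR, vv, HPair.dp_mul]
  calc _ = π.dp fun y q => π.dp fun z r => f (y * S z) * g (q * r) := by
        refine π.dp_congr fun y q => ?_
        rw [HPair.mul_dp]
        refine π.dp_congr fun z r => ?_
        rw [map_mul, map_mul, mul_assoc, ← mul_assoc (g q), ← hc]
        simp only [mul_assoc]
    _ = π.dp fun y q => sw K y fun a b => f (a * S b) * g q := by
        rw [π.dp_sw_left (fun a b q => f (a * S b) * g q)]
    _ = _ := by
        have : ∀ y q, sw K y (fun a b => f (a * S b) * g q) = counit (R := K) y • g q := by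
          intro y q
          rw [sw_S_right y (fun a => f a * g q)]
          simp
        simp only [this]
        rw [π.dp_eps (fun q => g q)]
        simp

variable {π}
variable (f : H →ₐ[K] Module.End K M)

/-- twisting operator -/
noncomputable def tw : Module.End K (M ⊗[K] H) := 
  TensorProduct.lift (LinearMap.mk₂ K (fun m x => sw K x fun a b => f a m ⊗ₜ[K] b)
    (fun m m' x => (Lin.map_add (K := K) (f := fun m => sw K x fun a b => f a m ⊗ₜ[K] b) (by fun_prop) m m'))
    (fun c m x => (Lin.map_smul (K := K) (f := fun m => sw K x fun a b => f a m ⊗ₜ[K] b) (by fun_prop) c m))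
    (fun m x x' => (Lin.map_add (K := K) (f := fun x => sw K x fun a b => f a m ⊗ₜ[K] b) (by fun_prop) x x'))
    (fun c m x => (Lin.map_smul (K := K) (f := fun x => sw K x fun a b => f a m ⊗ₜ[K] b) (by fun_prop) c x)))
theorem tw_apply (m : M) (x : H) : tw f (m ⊗ₜ x) = sw K x fun a b => f a m ⊗ₜ[K] b := rfl

/-- inverse twisting operator -/
noncomputable def tw' : Module.End K (M ⊗[K] H) := 
  TensorProduct.lift (LinearMap.mk₂ K (fun m x => sw K x fun a b => f (S a) m ⊗ₜ[K] b)
    (fun m m' x => (Lin.map_add (K := K) (f := fun m => sw K x fun a b => f (S a) m ⊗ₜ[K] b) (by fun_prop) m m'))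
    (fun c m x => (Lin.map_smul (K := K) (f := fun m => sw K x fun a b => f (S a) m ⊗ₜ[K] b) (by fun_prop) c m))
    (fun m x x' => (Lin.map_add (K := K) (f := fun x => sw K x fun a b => f (S a) m ⊗ₜ[K] b) (by fun_prop) x x'))
    (fun c m x => (Lin.map_smul (K := K) (f := fun x => sw K x fun a b => f (S a) m ⊗ₜ[K] b) (by fun_prop) c x)))
theorem tw'_apply (m : M) (x : H) : tw' f (m ⊗ₜ x) = sw K x fun a b => f (S a) m ⊗ₜ[K] b := rfl


variable (hS : ∀ x : H, HopfAlgebra.antipode K (HopfAlgebra.antipode K x) = x)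

include hS in
theorem tw_tw' : tw f * tw' f = 1 := by
  ext m x
  simp only [TensorProduct.AlgebraTensorModule.curry_apply, LinearMap.restrictScalars_self, TensorProduct.curry_apply,
    Module.End.mul_apply, Module.End.one_apply, tw'_apply, map_sw, tw_apply]
  rw [← coassoc]
  simp only [← Module.End.mul_apply, ← map_mul]
  trans sw K x fun a b => counit (R := K) a • (f 1 m ⊗ₜ[K] b)
  · refine sw_congr _ fun a b => ?_
    rw [← sw_So_right hS a (fun r => f r m ⊗ₜ[K] b)]
  · rw [sw_counit_left x (fun b => f 1 m ⊗ₜ[K] b)]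
    simp

include hS in
theorem det_tw_ne : LinearMap.det (tw f) ≠ 0 := by
  intro h
  have := congrArg LinearMap.det (tw_tw' f hS)
  rw [map_mul, h, zero_mul, map_one] at this
  exact zero_ne_one this

variable (K H M) in
/-- left regular action on the right factor -/
noncomputable def opL : H →ₐ[K] Module.End K (M ⊗[K] H) := (opr K H M).comp (Algebra.lmul K H)
theorem opL_apply (h : H) (m : M) (x : H) : opL K H M h (m ⊗ₜ x) = m ⊗ₜ (h * x) := rfl

theorem RR_det_ne {Z : Type*} [AddCommGroup Z] [Module K Z] (f : H →ₐ[K] Module.End K Z) (g : P →ₐ[K] Module.End K Z)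
    (hc : ∀ y q, f y * g q = g q * f y) : LinearMap.det (RR π f g) ≠ 0 := by
  intro h
  have := congrArg LinearMap.det (RR_inv π f g hc)
  rw [map_mul, h, zero_mul, map_one] at this
  exact zero_ne_one this

include hS in
theorem det_RR (g : P →ₐ[K] Module.End K M) (hc : ∀ y q, f y * g q = g q * f y) : 
    LinearMap.det (RR π f g) ^ Module.finrank K H = 1 := by
  let f' := (opl K H M).comp f
  let g' := (opl K H M).comp g
  let L' := opL K H M
  have hL : ∀ y q, L' y * g' q = g' q * L' y := fun y q => op_comm _ _
  have h1 : opl K H M (RR π f g) = RR π f' g' := by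
    rw [RR, RR, π.dp_map (fun x => opl K H M x)]
    simp [f', g']
  have h2 : RR π f' g' * RR π L' g' = π.dp fun y q => sw K y fun a b => f' a * L' b * g' q := by
    rw [RR, RR, HPair.dp_mul, π.dp_sw_left (fun a b q => f' a * L' b * g' q)]
    refine π.dp_congr fun y q => ?_
    rw [HPair.mul_dp]
    refine π.dp_congr fun z r => ?_
    rw [map_mul, mul_assoc, ← mul_assoc (g' q), ← hL]
    simp only [mul_assoc]
  have h3 : ∀ y, tw f * L' y = (sw K y fun a b => f' a * L' b) * tw f := by
    intro y
    ext m x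
    simp only [TensorProduct.AlgebraTensorModule.curry_apply, LinearMap.restrictScalars_self, TensorProduct.curry_apply,
      Module.End.mul_apply, tw_apply, opL_apply, L', f', sw_app, AlgHom.comp_apply]
    rw [sw_prod _ _ _ (by fun_prop) (by fun_prop)]
    refine sw_congr _ fun a b => ?_
    rw [map_sw, map_sw]
    refine sw_congr _ fun c d => ?_
    rw [opL_apply, opl_apply]
    simp
  have h4 : ∀ q, tw f * g' q = g' q * tw f := by
    intro q
    ext m x
    simp only [TensorProduct.AlgebraTensorModule.curry_apply, LinearMap.restrictScalars_self, TensorProduct.curry_apply,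
      Module.End.mul_apply, tw_apply, opl_apply, g', AlgHom.comp_apply]
    rw [map_sw]
    refine sw_congr _ fun a b => ?_
    rw [opl_apply, ← Module.End.mul_apply, hc, Module.End.mul_apply]
  have h5 : tw f * RR π L' g' = RR π f' g' * RR π L' g' * tw f := by
    rw [h2, RR, HPair.mul_dp, HPair.dp_mul]
    refine π.dp_congr fun y q => ?_
    rw [← sw_mul, mul_assoc (sw K y _), ← h4, ← mul_assoc, ← mul_assoc, h3]
  have h6 := congrArg LinearMap.det h5
  have h7 := det_tw_ne f hS
  have h8 := RR_det_ne (π := π) L' g' hL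
  rw [map_mul, map_mul, map_mul, mul_comm] at h6
  have h9 : LinearMap.det (RR π f' g') = 1 := by
    have := mul_right_cancel₀ h7 h6
    exact (mul_eq_right₀ h8).mp this.symm
  have h10 : LinearMap.det (opl K H M (RR π f g)) = LinearMap.det (RR π f g) ^ Module.finrank K H := by
    have := det_op (RR π f g) (1 : Module.End K H)
    rw [map_one, one_pow, mul_one] at this
    exact this
  rw [← h10, h1, h9]

variable (π) in
/-- right hit action on the right factor -/
noncomputable def opC : P →ₐ[K] Module.End K (M ⊗[K] H) := (opr K H M).comp 
  (AlgHom.ofLinearMap (toLin (K := K) (fun p => cc π p) (by fun_prop)) 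
    (by ext x; simp only [toLin_apply, cc_apply, π.oneP, sw_counit_right (K := K) x (fun x => x)]; rfl)
    (fun p q => cc_mul π p q))
theorem opC_apply (p : P) (m : M) (x : H) : opC (M := M) π p (m ⊗ₜ x) = m ⊗ₜ (sw K x fun a b => π.B p b • a) := rfl

variable (π) in
/-- left hit action on the right factor -/
noncomputable def opC' : P →ₐ[K] Module.End K (M ⊗[K] H) := (opr K H M).comp 
  (AlgHom.ofLinearMap (toLin (K := K) (fun p => (toLin (K := K) (fun x : H => sw K x fun a b => π.B p (S a) • b) (by fun_prop) : Module.End K H)) 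
      (lin_end fun w => by simp only [toLin_apply]; fun_prop)) 
    (by ext x; simp only [toLin_apply, π.oneP, eps_S, sw_counit_left (K := K) x (fun x => x)]; rfl)
    (fun p q => by
      ext x
      simp only [toLin_apply, π.mulP, Module.End.mul_apply, sw_smul, map_sw, map_smul, smul_sw, smul_smul]
      rw [← coassoc]
      refine sw_congr _ fun a b => ?_
      rw [sw_anti _ _ (by fun_prop) (by fun_prop)]
      simp only [mul_comm]))
theorem opC'_apply (p : P) (m : M) (x : H) : opC' (M := M) π p (m ⊗ₜ x) = m ⊗ₜ (sw K x fun a b => π.B p (S a) • b) := rfl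

variable (K H M) in
/-- right regular action on the right factor -/
noncomputable def opR : H →ₐ[K] Module.End K (M ⊗[K] H) := (opr K H M).comp 
  (AlgHom.ofLinearMap (toLin (K := K) (fun p => (toLin (K := K) (fun x : H => x * S p) (by fun_prop) : Module.End K H)) 
      (lin_end fun w => by simp only [toLin_apply]; fun_prop)) 
    (by ext x; simp [S_one]) (fun p q => by ext x; simp [S_mul, mul_assoc]))
theorem opR_apply (h : H) (m : M) (x : H) : opR K H M h (m ⊗ₜ x) = m ⊗ₜ (x * S h) := rfl

theorem RR_C' : RR π ((opl K H M).comp f) (opC' π) = tw' f := by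
  ext m x
  simp only [TensorProduct.AlgebraTensorModule.curry_apply, LinearMap.restrictScalars_self, TensorProduct.curry_apply, RR, tw'_apply]
  rw [dp_app]
  simp only [Module.End.mul_apply, opC'_apply, AlgHom.comp_apply, tmul_sw, TensorProduct.tmul_smul, map_sw, map_smul, opl_apply]
  rw [HPair.dp_sw]
  exact sw_congr _ fun a b => π.dp_eval (S a) (fun y => f y m ⊗ₜ[K] b)

theorem RR_C (m : M) (x : H) : RR π ((opl K H M).comp f) (opC π) (m ⊗ₜ x) = sw K x fun a b => f b m ⊗ₜ[K] a := by
  rw [RR, dp_app]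
  simp only [Module.End.mul_apply, opC_apply, AlgHom.comp_apply, tmul_sw, TensorProduct.tmul_smul, map_sw, map_smul, opl_apply]
  rw [HPair.dp_sw]
  exact sw_congr _ fun a b => π.dp_eval b (fun y => f y m ⊗ₜ[K] a)


variable {f} {g : P →ₐ[K] Module.End K M} (hY : YD π f g) {t : K} (ht : vv π f g = t • 1)

include hY hS ht in
theorem triple : RR π (opL K H M) ((opl K H M).comp g) * RR π ((opl K H M).comp f) (opC π) * 
    RR π (opR K H M) ((opl K H M).comp g) = t • tw f := by
  ext m x
  simp only [TensorProduct.AlgebraTensorModule.curry_apply, LinearMap.restrictScalars_self, TensorProduct.curry_apply,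
     Module.End.mul_apply, LinearMap.smul_apply, tw_apply]
  have h1 : ∀ (m : M) (x : H), RR π (opR K H M) ((opl K H M).comp g) (m ⊗ₜ x) = π.dp fun y q => g q m ⊗ₜ (x * S y) := by
    intro m x
    rw [RR, dp_app]
    rfl
  have h2 : ∀ (m : M) (x : H), RR π (opL K H M) ((opl K H M).comp g) (m ⊗ₜ x) = π.dp fun y q => g q m ⊗ₜ (y * x) := by
    intro m x
    rw [RR, dp_app]
    rfl
  rw [h1, map_dp]
  simp only [RR_C]
  rw [map_dp]
  simp only [map_sw, h2]
  calc _ = π.dp fun y q => sw K x fun a b => sw K y fun c d => π.dp fun z r => 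
        g r (f (b * S c) (g q m)) ⊗ₜ[K] (z * (a * S d)) := by
        refine π.dp_congr fun y q => ?_
        rw [sw_prod _ _ _ (by fun_prop) (by fun_prop)]
        refine sw_congr _ fun a b => ?_
        rw [sw_anti _ _ (by fun_prop) (by fun_prop)]
    _ = sw K x fun a b => π.dp fun y q => π.dp fun y' q' => π.dp fun z r => 
        g r (f (b * S y) (g (q * q') m)) ⊗ₜ[K] (z * (a * S y')) := by
        rw [HPair.dp_sw]
        refine sw_congr _ fun a b => ?_
        rw [π.dp_sw_left (fun c d q => π.dp fun z r => 
          g r (f (b * S c) (g q m)) ⊗ₜ[K] (z * (a * S d)))]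
    _ = sw K x fun a b => π.dp fun y' q' => π.dp fun z r => 
         (g r * f b * vv π f g * g q') m ⊗ₜ[K] (z * (a * S y')) := by
        refine sw_congr _ fun a b => ?_
        rw [HPair.dp_dp]
        refine π.dp_congr fun y' q' => ?_
        rw [HPair.dp_dp]
        refine π.dp_congr fun z r => ?_
        rw [vv, HPair.mul_dp, HPair.dp_mul, dp_app, dp_tmul]
        refine π.dp_congr fun y q => ?_
        simp only [map_mul, Module.End.mul_apply]
    _ = t • π.dp fun y' q' => π.dp fun z r => sw K x fun a b => 
         (g r * f b) (g q' m) ⊗ₜ[K] ((z * a) * S y') := by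
        rw [← HPair.dp_sw, HPair.dp_smul]
        refine π.dp_congr fun y' q' => ?_
        rw [← HPair.dp_sw, HPair.dp_smul]
        refine π.dp_congr fun z r => ?_
        rw [ht, smul_sw]
        simp only [mul_assoc, smul_mul_assoc, mul_smul_comm, LinearMap.smul_apply, one_mul, TensorProduct.smul_tmul', Module.End.mul_apply]
    _ = t • π.dp fun y' q' => π.dp fun z r => sw K x fun a b => 
         (f a * g r) (g q' m) ⊗ₜ[K] ((b * z) * S y') := by
        congr 1
        refine π.dp_congr fun y' q' => ?_
        exact (hY.rho x (fun z T => T (g q' m) ⊗ₜ[K] (z * S y'))).symm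
    _ = t • π.dp fun z r => π.dp fun y' q' => sw K x fun a b => f a (g (r * q') m) ⊗ₜ[K] (b * (z * S y')) := by
        rw [HPair.dp_dp]
        simp only [map_mul, Module.End.mul_apply, mul_assoc]
    _ = t • π.dp fun y q => sw K y fun c d => sw K x fun a b => f a (g q m) ⊗ₜ[K] (b * (c * S d)) := by
        rw [π.dp_sw_left (fun c d q => sw K x fun a b => f a (g q m) ⊗ₜ[K] (b * (c * S d)))]
    _ = t • π.dp fun y q => counit (R := K) y • sw K x fun a b => f a (g q m) ⊗ₜ[K] (b * 1) := by
        congr 1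
        refine π.dp_congr fun y q => ?_
        rw [sw_S_right y (fun z => sw K x fun a b => f a (g q m) ⊗ₜ[K] (b * z))]
    _ = _ := by
        rw [π.dp_eps (fun q => sw K x fun a b => f a (g q m) ⊗ₜ[K] (b * 1))]
        simp

include hY hS ht in
theorem t_pow : t ^ ((Module.finrank K H) ^ 2 * Module.finrank K M) = 1 := by
  have h1 := det_RR (π := π) (opL K H M) hS ((opl K H M).comp g) (fun y q => op_comm _ _)
  have h2 := det_RR (π := π) ((opl K H M).comp f) hS (opC π) (fun y q => (op_comm _ _).symm)
  have h3 := det_RR (π := π) (opR K H M) hS ((opl K H M).comp g) (fun y q => op_comm _ _)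
  have h4 := det_RR (π := π) ((opl K H M).comp f) hS (opC' π) (fun y q => (op_comm _ _).symm)
  rw [RR_C'] at h4
  have h5 := congrArg LinearMap.det (tw_tw' f hS)
  rw [map_mul, map_one] at h5
  have h6 := congrArg LinearMap.det (triple hS hY ht)
  rw [map_mul, map_mul, LinearMap.det_smul, Module.finrank_tensorProduct] at h6
  have h7 : LinearMap.det (tw f) ^ Module.finrank K H = 1 := by
    have := congrArg (· ^ Module.finrank K H) h5
    simpa only [mul_pow, h4, mul_one, one_pow] using this
  have := congrArg (· ^ Module.finrank K H) h6
  simp only [mul_pow, h1, h2, h3, h7, mul_one, ← pow_mul] at this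
  rw [this]
  congr 1; ring

end dets
end HP
end

section

open TensorProduct LinearMap Coalgebra
namespace HP
set_option linter.unusedSectionVars false

namespace DD
variable {K H P E V A : Type*} [Field K] [Ring H] [HopfAlgebra K H] [FiniteDimensional K H]
    [Ring P] [HopfAlgebra K P] [FiniteDimensional K P] [Ring E] [Algebra K E]
    [AddCommGroup V] [Module K V] {π : HPair K H P} [Ring A] [Algebra K A] (D : DD π A)
  (hS : ∀ x : H, HopfAlgebra.antipode K (HopfAlgebra.antipode K x) = x)
local notation "S" => HopfAlgebra.antipode K

/-- Drinfeld map -/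
noncomputable def zz (φ : A →ₗ[K] K) : A := 
  π.dp fun y q => π.dp fun w r => φ (D.κ q * D.ι w) • (D.ι y * D.κ r)

theorem zz_sum {ι : Type*} (s : Finset ι) (c : ι → K) (φ : ι → (A →ₗ[K] K)) : 
    D.zz (∑ i ∈ s, c i • φ i) = ∑ i ∈ s, c i • D.zz (φ i) := by
  have : Lin K D.zz := by unfold zz; fun_prop
  simp only [this.map_sum, this.map_smul]

theorem zz_ι_aux (h : H) (F : A → A → V) (h1 : ∀ b, Lin K (fun a => F a b))
    (h2 : ∀ a, Lin K (fun b => F a b)) :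
    (π.dp fun y q => π.dp fun w r => sw K h fun a b => F (D.ι a * (D.κ q * D.ι w)) (D.ι b * (D.ι y * D.κ r))) =
    (π.dp fun y q => π.dp fun w r => sw K h fun a b => F ((D.κ q * D.ι w) * D.ι a) ((D.ι y * D.κ r) * D.ι b)) := by
  calc _ = π.dp fun w r => π.dp fun y q => sw K h fun a b => F (D.ι a * D.κ q * D.ι w) (D.ι (b * y) * D.κ r) := by
        rw [HPair.dp_dp]
        simp only [mul_assoc, map_mul]
    _ = π.dp fun w r => π.dp fun y q => sw K h fun a b => F (D.κ q * D.ι b * D.ι w) (D.ι (y * a) * D.κ r) := by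
        refine π.dp_congr fun w r => ?_
        exact D.yd.rho h (fun y e => F (e * D.ι w) (D.ι y * D.κ r))
    _ = π.dp fun y q => π.dp fun w r => sw K h fun a b => F (D.κ q * D.ι (b * w)) (D.ι y * (D.ι a * D.κ r)) := by
        rw [HPair.dp_dp]
        simp only [mul_assoc, map_mul]
    _ = _ := by
        refine π.dp_congr fun y q => ?_
        rw [D.yd.rho h (fun w e => F (D.κ q * D.ι w) (D.ι y * e))]
        simp only [mul_assoc, map_mul]

theorem zz_κ_aux (p : P) (F : A → A → V) (h1 : ∀ b, Lin K (fun a => F a b))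
    (h2 : ∀ a, Lin K (fun b => F a b)) :
    (π.dp fun y q => π.dp fun w r => sw K p fun u v => F (D.κ v * (D.κ q * D.ι w)) (D.κ u * (D.ι y * D.κ r))) =
    (π.dp fun y q => π.dp fun w r => sw K p fun u v => F ((D.κ q * D.ι w) * D.κ v) ((D.ι y * D.κ r) * D.κ u)) := by
  calc _ = π.dp fun w r => π.dp fun y q => sw K p fun u v => F (D.κ (v * q) * D.ι w) (D.κ u * D.ι y * D.κ r) := by
        rw [HPair.dp_dp]
        simp only [mul_assoc, map_mul]
    _ = π.dp fun w r => π.dp fun y q => sw K p fun u v => F (D.κ (q * u) * D.ι w) (D.ι y * D.κ v * D.κ r) := by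
        refine π.dp_congr fun w r => ?_
        exact (D.yd.rho' p (fun q e => F (D.κ q * D.ι w) (e * D.κ r))).symm
    _ = π.dp fun y q => π.dp fun w r => sw K p fun u v => F (D.κ q * (D.κ u * D.ι w)) (D.ι y * D.κ (v * r)) := by
        rw [HPair.dp_dp]
        simp only [mul_assoc, map_mul]
    _ = _ := by
        refine π.dp_congr fun y q => ?_
        rw [← D.yd.rho' p (fun r e => F (D.κ q * e) (D.ι y * D.κ r))]
        simp only [mul_assoc, map_mul]

variable {φ : A →ₗ[K] K} (hφ : ∀ a b, φ (a * b) = φ (b * a))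


include hφ hS in
theorem zz_ι (h : H) : D.ι h * D.zz φ = D.zz φ * D.ι h := by
  calc _ = sw K h fun a c => counit (R := K) a • (D.ι c * D.zz φ) := by
        rw [sw_counit_left (K := K) h (fun c => D.ι c * D.zz φ)]
    _ = sw K h fun a c => sw K c fun b c' => π.dp fun y q => π.dp fun w r => 
          φ ((D.ι b * (D.κ q * D.ι w)) * D.ι (S a)) • (D.ι c' * (D.ι y * D.κ r)) := by
        rw [← coassoc]
        refine sw_congr _ fun a c => ?_
        rw [zz, HPair.mul_dp, HPair.dp_smul, ← HPair.dp_sw]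
        refine π.dp_congr fun y q => ?_
        rw [HPair.mul_dp, HPair.dp_smul, ← HPair.dp_sw]
        refine π.dp_congr fun w r => ?_
        have := sw_S_left (K := K) a (fun x => φ (D.ι x * (D.κ q * D.ι w)) • (D.ι c * (D.ι y * D.κ r)))
        simp only [map_one, one_mul] at this
        rw [mul_smul_comm, ← this]
        refine sw_congr _ fun a b => ?_
        rw [hφ _ (D.ι (S a)), map_mul D.ι, mul_assoc]
    _ = sw K h fun a c => sw K c fun b c' => π.dp fun y q => π.dp fun w r => 
          φ (((D.κ q * D.ι w) * D.ι b) * D.ι (S a)) • ((D.ι y * D.κ r) * D.ι c') := by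
        refine sw_congr _ fun a c => ?_
        have := D.zz_ι_aux c (fun X Y => φ (X * D.ι (S a)) • Y) (by fun_prop) (by fun_prop)
        simpa only [HPair.dp_sw] using this
    _ = sw K h fun a c => counit (R := K) a • (D.zz φ * D.ι c) := by
        rw [← coassoc]
        refine sw_congr _ fun a c => ?_
        rw [zz, HPair.dp_mul, HPair.dp_smul, ← HPair.dp_sw]
        refine π.dp_congr fun y q => ?_
        rw [HPair.dp_mul, HPair.dp_smul, ← HPair.dp_sw]
        refine π.dp_congr fun w r => ?_
        have := sw_So_right hS a (fun x => φ ((D.κ q * D.ι w) * D.ι x) • ((D.ι y * D.κ r) * D.ι c))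
        simp only [map_one, mul_one] at this
        rw [smul_mul_assoc, ← this]
        refine sw_congr _ fun a b => ?_
        rw [map_mul D.ι, mul_assoc, mul_assoc, mul_assoc]
    _ = _ := by
        rw [sw_counit_left (K := K) h (fun c => D.zz φ * D.ι c)]

include hφ hS in
theorem zz_κ (p : P) : D.κ p * D.zz φ = D.zz φ * D.κ p := by
  calc _ = sw K p fun a c => counit (R := K) c • (D.κ a * D.zz φ) := by
        rw [sw_counit_right (K := K) p (fun c => D.κ c * D.zz φ)]
    _ = sw K p fun a c => sw K a fun u v => π.dp fun y q => π.dp fun w r => 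
          φ ((D.κ v * (D.κ q * D.ι w)) * D.κ (S c)) • (D.κ u * (D.ι y * D.κ r)) := by
        rw [coassoc]
        refine sw_congr _ fun a c => ?_
        rw [zz, HPair.mul_dp, HPair.dp_smul, ← HPair.dp_sw]
        refine π.dp_congr fun y q => ?_
        rw [HPair.mul_dp, HPair.dp_smul, ← HPair.dp_sw]
        refine π.dp_congr fun w r => ?_
        have := sw_So_left (π.SP hS) c (fun x => φ (D.κ x * (D.κ q * D.ι w)) • (D.κ a * (D.ι y * D.κ r)))
        simp only [map_one, one_mul] at this
        rw [mul_smul_comm, ← this]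
        refine sw_congr _ fun a b => ?_
        rw [hφ _ (D.κ (S b)), map_mul D.κ, mul_assoc]
    _ = sw K p fun a c => sw K a fun u v => π.dp fun y q => π.dp fun w r => 
          φ (((D.κ q * D.ι w) * D.κ v) * D.κ (S c)) • ((D.ι y * D.κ r) * D.κ u) := by
        refine sw_congr _ fun a c => ?_
        have := D.zz_κ_aux a (fun X Y => φ (X * D.κ (S c)) • Y) (by fun_prop) (by fun_prop)
        simpa only [HPair.dp_sw] using this
    _ = sw K p fun a c => counit (R := K) c • (D.zz φ * D.κ a) := by
        rw [coassoc]
        refine sw_congr _ fun a c => ?_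
        rw [zz, HPair.dp_mul, HPair.dp_smul, ← HPair.dp_sw]
        refine π.dp_congr fun y q => ?_
        rw [HPair.dp_mul, HPair.dp_smul, ← HPair.dp_sw]
        refine π.dp_congr fun w r => ?_
        have := sw_S_right (K := K) c (fun x => φ ((D.κ q * D.ι w) * D.κ x) • ((D.ι y * D.κ r) * D.κ a))
        simp only [map_one, mul_one] at this
        rw [smul_mul_assoc, ← this]
        refine sw_congr _ fun a b => ?_
        rw [map_mul D.κ, mul_assoc, mul_assoc, mul_assoc]
    _ = _ := by
        rw [sw_counit_right (K := K) p (fun c => D.zz φ * D.κ c)]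

include hφ hS in
theorem zz_central (x : A) : x * D.zz φ = D.zz φ * x := by
  refine D.ext_lin (fun x => x * D.zz φ) (fun x => D.zz φ * x) (by fun_prop) (by fun_prop) (fun h p => ?_) x
  rw [mul_assoc, D.zz_κ hS hφ, ← mul_assoc, D.zz_ι hS hφ, mul_assoc]

include hφ hS in
theorem zz_mul (ψ φ' : A →ₗ[K] K) (h : ∀ p h, ψ (D.κ p * D.ι h) = sw K p fun u v => sw K h fun a b => 
      φ (D.κ v * D.ι a) * φ' (D.κ u * D.ι b)) : D.zz ψ = D.zz φ * D.zz φ' := by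
  calc D.zz ψ = π.dp fun y q => sw K q fun u v => π.dp fun w r => sw K w fun a b => 
          (φ (D.κ v * D.ι a) * φ' (D.κ u * D.ι b)) • (D.ι y * D.κ r) := by
        rw [zz]
        refine π.dp_congr fun y q => ?_
        rw [← HPair.dp_sw]
        refine π.dp_congr fun w r => ?_
        rw [h, sw_smul]
        refine sw_congr _ fun _ _ => ?_
        rw [sw_smul]
    _ = π.dp fun y q => π.dp fun y' q' => π.dp fun w r => π.dp fun w' r' => 
          (φ (D.κ q' * D.ι w) * φ' (D.κ q * D.ι w')) • (D.ι (y * y') * D.κ (r * r')) := by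
        rw [π.dp_sw_right (fun y u v => π.dp fun w r => sw K w fun a b => 
          (φ (D.κ v * D.ι a) * φ' (D.κ u * D.ι b)) • (D.ι y * D.κ r))]
        refine π.dp_congr fun y q => ?_
        refine π.dp_congr fun y' q' => ?_
        rw [π.dp_sw_left (fun a b r => (φ (D.κ q' * D.ι a) * φ' (D.κ q * D.ι b)) • (D.ι (y * y') * D.κ r))
          (by fun_prop) (by fun_prop) (by fun_prop)]
    _ = π.dp fun y q => π.dp fun w' r' => φ' (D.κ q * D.ι w') • (D.ι y * D.zz φ * D.κ r') := by
        refine π.dp_congr fun y q => ?_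
        trans π.dp fun y' q' => π.dp fun w' r' => π.dp fun w r => 
          (φ (D.κ q' * D.ι w) * φ' (D.κ q * D.ι w')) • (D.ι (y * y') * D.κ (r * r'))
        · refine π.dp_congr fun y' q' => ?_
          rw [HPair.dp_dp]
        rw [HPair.dp_dp]
        refine π.dp_congr fun w' r' => ?_
        rw [zz, HPair.mul_dp, HPair.dp_mul, HPair.dp_smul]
        refine π.dp_congr fun y' q' => ?_
        rw [HPair.mul_dp, HPair.dp_mul, HPair.dp_smul]
        refine π.dp_congr fun w r => ?_
        simp only [map_mul, mul_smul_comm, smul_mul_assoc, smul_smul, mul_assoc, mul_comm (φ _)]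
    _ = _ := by
        conv_rhs => rw [zz.eq_1 D φ', HPair.mul_dp]
        refine π.dp_congr fun y q => ?_
        rw [HPair.mul_dp]
        refine π.dp_congr fun w r => ?_
        rw [D.zz_ι hS hφ, mul_smul_comm, mul_assoc]

include hφ in
theorem zz_symm (ψ : A →ₗ[K] K) (hψ : ∀ a b, ψ (a * b) = ψ (b * a)) : φ (D.zz ψ) = ψ (D.zz φ) := by
  simp only [zz, map_dp, map_smul]
  rw [HPair.dp_dp]
  refine π.dp_congr fun y q => π.dp_congr fun w r => ?_
  rw [hφ, hψ (D.ι y), smul_eq_mul, smul_eq_mul, mul_comm]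

include hφ in
theorem zz_symm' (ψ φ' ψ' : A →ₗ[K] K) (hψ : ∀ a b, ψ (a * b) = ψ (b * a)) 
    (h1 : ∀ p h, φ' (D.κ p * D.ι h) = φ (D.ι (S h) * D.κ (S p)))
    (h2 : ∀ p h, ψ' (D.κ p * D.ι h) = ψ (D.ι (S h) * D.κ (S p))) : φ (D.zz ψ') = ψ (D.zz φ') := by
  simp only [zz, map_dp, map_smul, h1, h2, smul_eq_mul]
  calc _ = π.dp fun y q => π.dp fun w r => ψ (D.ι (S w) * D.κ q) * φ (D.ι (S y) * D.κ r) := by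
        rw [π.dp_S (fun y q => π.dp fun w r => ψ (D.ι (S w) * D.κ q) * φ (D.ι y * D.κ r))]
    _ = π.dp fun y q => π.dp fun w r => ψ (D.ι w * D.κ q) * φ (D.ι (S y) * D.κ (S r)) := by
        refine π.dp_congr fun y q => ?_
        rw [π.dp_S (fun w r => ψ (D.ι w * D.κ q) * φ (D.ι (S y) * D.κ r))]
    _ = _ := by
        rw [HPair.dp_dp]
        refine π.dp_congr fun y q => π.dp_congr fun w r => ?_
        rw [mul_comm]

end DD
end HP
end

section

open TensorProduct LinearMap Coalgebra
namespace HP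
set_option linter.unusedSectionVars false

section tens
variable {K H P E E1 E2 : Type*} [Field K] [Ring H] [HopfAlgebra K H] [FiniteDimensional K H]
    [Ring P] [HopfAlgebra K P] [FiniteDimensional K P] [Ring E] [Algebra K E]
    [Ring E1] [Algebra K E1] [Ring E2] [Algebra K E2] {π : HPair K H P}
  (hS : ∀ x : H, HopfAlgebra.antipode K (HopfAlgebra.antipode K x) = x)
local notation "S" => HopfAlgebra.antipode K

/-- tensor product of two algebra homs along a multiplicative bilinear map -/
noncomputable def tensHom (k : E1 →ₗ[K] E2 →ₗ[K] E) (k1 : k 1 1 = 1)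
    (km : ∀ a b c d, k (a * c) (b * d) = k a b * k c d) (f1 : H →ₐ[K] E1) (f2 : H →ₐ[K] E2) :
    H →ₐ[K] E :=
  AlgHom.ofLinearMap (toLin (fun h => sw K h fun a b => k (f1 a) (f2 b)) (by fun_prop))
    (by rw [toLin_apply, sw_one _ (by fun_prop) (by fun_prop), map_one f1, map_one f2, k1])
    (fun x y => by
      simp only [toLin_apply]
      rw [sw_prod _ _ _ (by fun_prop) (by fun_prop), sw_mul]
      refine sw_congr _ fun a b => ?_
      rw [mul_sw]
      refine sw_congr _ fun c d => ?_
      rw [map_mul f1, map_mul f2, km])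

theorem tensHom_apply (k : E1 →ₗ[K] E2 →ₗ[K] E) (k1 : k 1 1 = 1)
    (km : ∀ a b c d, k (a * c) (b * d) = k a b * k c d) (f1 : H →ₐ[K] E1) (f2 : H →ₐ[K] E2) (h : H) :
    tensHom k k1 km f1 f2 h = sw K h fun a b => k (f1 a) (f2 b) := rfl

/-- the same, opposite order -/
noncomputable def tensHom' (k : E1 →ₗ[K] E2 →ₗ[K] E) (k1 : k 1 1 = 1)
    (km : ∀ a b c d, k (a * c) (b * d) = k a b * k c d) (f1 : H →ₐ[K] E1) (f2 : H →ₐ[K] E2) :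
    H →ₐ[K] E :=
  AlgHom.ofLinearMap (toLin (fun h => sw K h fun a b => k (f1 b) (f2 a)) (by fun_prop))
    (by rw [toLin_apply, sw_one _ (by fun_prop) (by fun_prop), map_one f1, map_one f2, k1])
    (fun x y => by
      simp only [toLin_apply]
      rw [sw_prod _ _ _ (by fun_prop) (by fun_prop), sw_mul]
      refine sw_congr _ fun a b => ?_
      rw [mul_sw]
      refine sw_congr _ fun c d => ?_
      rw [map_mul f1, map_mul f2, km])

theorem tensHom'_apply (k : E1 →ₗ[K] E2 →ₗ[K] E) (k1 : k 1 1 = 1)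
    (km : ∀ a b c d, k (a * c) (b * d) = k a b * k c d) (f1 : H →ₐ[K] E1) (f2 : H →ₐ[K] E2) (h : H) :
    tensHom' k k1 km f1 f2 h = sw K h fun a b => k (f1 b) (f2 a) := rfl

set_option linter.unusedVariables false in
theorem sw_swap {V : Type*} [AddCommGroup V] [Module K V] (h : H) (p : P) (R : H → H → H → P → P → P → V)
    (h1 : ∀ b c u v w, Lin K (fun a => R a b c u v w)) (h2 : ∀ a c u v w, Lin K (fun b => R a b c u v w))
    (h3 : ∀ a b u v w, Lin K (fun c => R a b c u v w)) (h4 : ∀ a b c v w, Lin K (fun u => R a b c u v w))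
    (h5 : ∀ a b c u w, Lin K (fun v => R a b c u v w)) (h6 : ∀ a b c u v, Lin K (fun w => R a b c u v w)) :
    (sw K h fun x c => sw K p fun u y => sw K x fun a b => sw K y fun v w => R a b c u v w) =
    sw K h fun a c => sw K p fun r w => sw K c fun b c => sw K r fun u v => R a b c u v w := by
  calc _ = sw K h fun x c => sw K x fun a b => sw K p fun u y => sw K y fun v w => R a b c u v w := by
        refine sw_congr _ fun x c => ?_
        rw [sw_comm]
    _ = sw K h fun a c => sw K c fun b c => sw K p fun u y => sw K y fun v w => R a b c u v w :=
        coassoc h _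
    _ = sw K h fun a c => sw K c fun b c => sw K p fun r w => sw K r fun u v => R a b c u v w := by
        refine sw_congr _ fun a c => ?_
        refine sw_congr _ fun b c => ?_
        exact (coassoc p _).symm
    _ = _ := by
        refine sw_congr _ fun a c => ?_
        rw [sw_comm]

theorem YD.tens (k : E1 →ₗ[K] E2 →ₗ[K] E) (k1 : k 1 1 = 1)
    (km : ∀ a b c d, k (a * c) (b * d) = k a b * k c d) {f1 : H →ₐ[K] E1} {f2 : H →ₐ[K] E2}
    {g1 : P →ₐ[K] E1} {g2 : P →ₐ[K] E2} (h1 : YD π f1 g1) (h2 : YD π f2 g2) :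
    YD π (tensHom k k1 km f1 f2) (tensHom' k k1 km g1 g2) where
  rel := fun h p => by
    simp only [tensHom_apply, tensHom'_apply]
    calc _ = sw K h fun a c => sw K c fun b c => sw K p fun r w => sw K r fun u v => 
              π.B u c • k (f1 a * g1 w) (f2 b * g2 v) := by
            refine Eq.trans ?_ (coassoc h (fun a b c => sw K p fun r w => sw K r fun u v => 
              π.B u c • k (f1 a * g1 w) (f2 b * g2 v)))
            refine sw_congr _ fun a c => ?_
            refine Eq.trans ?_ (sw_congr _ fun x y => (coassoc p _).symm)
            rw [sw_comm]
            refine sw_congr _ fun u w => ?_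
            rw [sw_mul, smul_sw]
            refine sw_congr _ fun x y => ?_
            rw [mul_sw, smul_sw]
            refine sw_congr _ fun z t => ?_
            rw [km]
      _ = sw K h fun a c => sw K p fun r w => k (f1 a * g1 w) (sw K c fun b c => sw K r fun u v => π.B u c • (f2 b * g2 v)) := by
            refine sw_congr _ fun a c => ?_
            rw [sw_comm]
            refine sw_congr _ fun r w => ?_
            rw [map_sw]
            refine sw_congr _ fun b c => ?_
            rw [map_sw]
            refine sw_congr _ fun u v => ?_
            rw [map_smul]
      _ = sw K h fun a c => sw K p fun r w => k (f1 a * g1 w) (sw K c fun b c => sw K r fun u v => π.B v b • (g2 u * f2 c)) := by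
            refine sw_congr _ fun a c => ?_
            refine sw_congr _ fun r w => ?_
            rw [h2.rel]
      _ = sw K h fun a c => sw K p fun r w => sw K c fun b c => sw K r fun u v => π.B v b • k (f1 a * g1 w) (g2 u * f2 c) := by
            refine sw_congr _ fun a c => ?_
            refine sw_congr _ fun r w => ?_
            rw [map_sw]
            refine sw_congr _ fun b c => ?_
            rw [map_sw]
            refine sw_congr _ fun u v => ?_
            rw [map_smul]
      _ = sw K h fun x c => sw K p fun u y => (k.flip (g2 u * f2 c)) (sw K x fun a b => sw K y fun v w => π.B v b • (f1 a * g1 w)) := by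
            rw [← sw_swap h p (fun a b c u v w => π.B v b • k (f1 a * g1 w) (g2 u * f2 c)) (by fun_prop) (by fun_prop) (by fun_prop) (by fun_prop) (by fun_prop) (by fun_prop)]
            refine sw_congr _ fun x c => ?_
            refine sw_congr _ fun u y => ?_
            rw [map_sw]
            refine sw_congr _ fun b c => ?_
            rw [map_sw]
            refine sw_congr _ fun u v => ?_
            rw [map_smul]; rfl
      _ = sw K h fun x c => sw K p fun u y => (k.flip (g2 u * f2 c)) (sw K x fun a b => sw K y fun v w => π.B w a • (g1 v * f1 b)) := by
            refine sw_congr _ fun a c => ?_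
            refine sw_congr _ fun r w => ?_
            rw [h1.rel]
      _ = _ := by
            calc _ = sw K h fun x c => sw K p fun u y => sw K x fun a b => sw K y fun v w => π.B w a • k (g1 v * f1 b) (g2 u * f2 c) := by
                  refine sw_congr _ fun x c => ?_
                  refine sw_congr _ fun u y => ?_
                  rw [map_sw]
                  refine sw_congr _ fun b c => ?_
                  rw [map_sw]
                  refine sw_congr _ fun u v => ?_
                  rw [map_smul]; rfl
              _ = sw K h fun x c => sw K x fun a b => sw K p fun u y => sw K y fun v w => π.B w a • k (g1 v * f1 b) (g2 u * f2 c) := by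
                  refine sw_congr _ fun x c => ?_
                  rw [sw_comm]
              _ = sw K h fun a c => sw K c fun b c => sw K p fun u y => sw K y fun v w => π.B w a • k (g1 v * f1 b) (g2 u * f2 c) := by
                  exact coassoc h (fun a b c => sw K p fun u y => sw K y fun v w => π.B w a • k (g1 v * f1 b) (g2 u * f2 c))
              _ = _ := by
                  refine sw_congr _ fun a c => ?_
                  refine (sw_congr _ fun b c => (coassoc p _).symm).trans ?_
                  rw [sw_comm]
                  refine sw_congr _ fun r w => ?_
                  rw [mul_sw, smul_sw]
                  refine sw_congr _ fun u v => ?_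
                  rw [sw_mul, smul_sw]
                  refine sw_congr _ fun u v => ?_
                  rw [km]

/-- dual hom -/
noncomputable def dualHom (T : E1 →ₗ[K] E) (T1 : T 1 = 1)
    (Tm : ∀ a b, T (a * b) = T b * T a) (f1 : H →ₐ[K] E1) :
    H →ₐ[K] E :=
  AlgHom.ofLinearMap (toLin (fun h => T (f1 (S h))) (by fun_prop))
    (by rw [toLin_apply, S_one, map_one, T1])
    (fun x y => by simp only [toLin_apply]; rw [S_mul, map_mul, Tm])

theorem dualHom_apply (T : E1 →ₗ[K] E) (T1 : T 1 = 1)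
    (Tm : ∀ a b, T (a * b) = T b * T a) (f1 : H →ₐ[K] E1) (h : H) : 
    dualHom T T1 Tm f1 h = T (f1 (S h)) := rfl

include hS in
theorem YD.dual (T : E1 →ₗ[K] E) (T1 : T 1 = 1)
    (Tm : ∀ a b, T (a * b) = T b * T a) {f1 : H →ₐ[K] E1} {g1 : P →ₐ[K] E1} (h1 : YD π f1 g1) :
    YD π (dualHom T T1 Tm f1) (dualHom T T1 Tm g1) where
  rel := fun h p => by
    simp only [dualHom_apply]
    have key := congrArg T (h1.rel (S h) (S p))
    have hB : ∀ u b, π.B (S u) (S b) = π.B u b := by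
      intro u b; rw [π.antip, hS]
    rw [sw_anti _ _ (by fun_prop) (by fun_prop), sw_anti _ _ (by fun_prop) (by fun_prop)] at key
    simp only [map_sw] at key
    have e : ∀ (F : P → P → E) (h1 : ∀ b, Lin K (fun a => F a b)) (h2 : ∀ a, Lin K (fun b => F a b)), 
      sw K (S p) F = sw K p (fun a b => F (S b) (S a)) := fun F h1 h2 => sw_anti _ _ h1 h2
    have e1 : ∀ a b, (sw K (S p) fun u w => T (π.B u (S a) • (f1 (S b) * g1 w))) = 
       sw K p fun u w => π.B w a • (T (g1 (S u)) * T (f1 (S b))) := by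
      intro a b
      rw [e _ (by fun_prop) (by fun_prop)]
      refine sw_congr _ fun u w => ?_
      rw [hB, map_smul, Tm]
    have e2 : ∀ a b, (sw K (S p) fun u w => T (π.B w (S b) • (g1 u * f1 (S a)))) = 
       sw K p fun u w => π.B u b • (T (f1 (S a)) * T (g1 (S w))) := by
      intro a b
      rw [e _ (by fun_prop) (by fun_prop)]
      refine sw_congr _ fun u w => ?_
      rw [hB, map_smul, Tm]
    simp only [e1, e2] at key
    exact key.symm

end tens
end HP
end

section

open TensorProduct LinearMap Coalgebra
namespace HP
set_option linter.unusedSectionVars false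

theorem integral_of_ring {K : Type*} [Field K] {m : ℕ} (w : Fin m → K) (N : Fin m → Fin m → Fin m → ℕ)
    (h : ∀ i j, w i * w j = ∑ k, (N i j k : K) * w k) (i : Fin m) : IsIntegral ℤ (w i) := by
  by_cases h0 : w i = 0
  · rw [h0]; exact isIntegral_zero
  refine isIntegral_of_smul_mem_submodule (M := K) (Submodule.span ℤ (Set.range w)) ?_ ?_ (w i) ?_
  · intro hb
    have : w i ∈ Submodule.span ℤ (Set.range w) := Submodule.subset_span ⟨i, rfl⟩
    rw [hb] at this
    exact h0 this
  · exact Submodule.fg_span (Set.finite_range w)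
  · intro x hx
    induction hx using Submodule.span_induction with
    | mem x hx =>
      obtain ⟨j, rfl⟩ := hx
      rw [smul_eq_mul, h]
      refine Submodule.sum_mem _ fun k _ => ?_
      have : (N i j k : K) * w k = (N i j k : ℤ) • w k := by simp
      rw [this]
      exact Submodule.smul_mem _ _ (Submodule.subset_span ⟨k, rfl⟩)
    | zero => simp
    | add x y _ _ hx hy => rw [smul_add]; exact Submodule.add_mem _ hx hy
    | smul c x _ hx => rw [smul_comm]; exact Submodule.smul_mem _ _ hx

theorem dvd_of_integral {K : Type*} [Field K] [CharZero K] {d m : ℕ} (hm : m ≠ 0) {s : K}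
    (hs : IsIntegral ℤ s) (h : (d : K) ^ 2 = (m : K) ^ 2 * s) : m ∣ d := by
  have hm' : (m : K) ≠ 0 := by exact_mod_cast hm
  have e : s = algebraMap ℚ K ((d / m : ℚ) ^ 2) := by
    simp only [map_pow, map_div₀, map_natCast]
    field_simp
    rw [h]; ring
  rw [e, isIntegral_algebraMap_iff (algebraMap ℚ K).injective] at hs
  have h2 : IsIntegral ℤ (d / m : ℚ) := hs.of_pow (by norm_num)
  obtain ⟨z, hz⟩ := IsIntegrallyClosed.isIntegral_iff.1 h2
  have : (d : ℚ) = m * z := by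
    have hm'' : (m : ℚ) ≠ 0 := by exact_mod_cast hm
    have hz' : (z : ℚ) = d / m := by simpa using hz
    rw [hz']; field_simp
  have : (d : ℤ) = m * z := by exact_mod_cast this
  exact_mod_cast (Dvd.intro _ this.symm : (m : ℤ) ∣ d)

section decomp
variable {K : Type*} [Field K] {A : Type*} [Ring A] [Algebra K A] [FiniteDimensional K A] {m : ℕ} {n : Fin m → ℕ}
  (e : A ≃ₐ[K] Π i, Matrix (Fin (n i)) (Fin (n i)) K)

/-- block rep -/
noncomputable def rep (i : Fin m) : A →ₐ[K] Matrix (Fin (n i)) (Fin (n i)) K :=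
  (Pi.evalAlgHom K (fun i : Fin m => Matrix (Fin (n i)) (Fin (n i)) K) i).comp e.toAlgHom

@[simp] theorem rep_apply (i : Fin m) (a : A) : rep e i a = e a i := rfl

/-- character of a rep -/
noncomputable def chr {ι : Type*} [Fintype ι] [DecidableEq ι] (ρ : A →ₐ[K] Matrix ι ι K) : A →ₗ[K] K :=
  Matrix.traceLinearMap ι K K ∘ₗ ρ.toLinearMap

theorem chr_apply {ι : Type*} [Fintype ι] [DecidableEq ι] (ρ : A →ₐ[K] Matrix ι ι K) (a : A) :
    chr ρ a = (ρ a).trace := rfl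

theorem chr_comm {ι : Type*} [Fintype ι] [DecidableEq ι] (ρ : A →ₐ[K] Matrix ι ι K) (a b : A) :
    chr ρ (a * b) = chr ρ (b * a) := by
  simp only [chr_apply, map_mul]; exact Matrix.trace_mul_comm _ _

theorem pair_nondeg (b : A) (h : ∀ x, ∑ i, (e b i * e x i).trace = 0) : b = 0 := by
  classical
  apply e.injective
  rw [map_zero]
  funext i
  rw [Matrix.ext_iff_trace_mul_right]
  intro x
  have := h (e.symm (Pi.single i x))
  rw [Finset.sum_eq_single i] at this
  · simpa using this
  · intro j _ hj; simp [Pi.single_apply, hj]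
  · simp

theorem decomp [∀ i, NeZero (n i)] {ι : Type*} [Fintype ι] [DecidableEq ι] (ρ : A →ₐ[K] Matrix ι ι K) :
    ∃ N : Fin m → ℕ, chr ρ = ∑ k, (N k : K) • chr (rep e k) := by
  classical
  obtain ⟨b, hb⟩ := exists_rep e (chr ρ)
  have hc : ∀ x, x * b = b * x := by
    intro x
    rw [← sub_eq_zero]
    apply pair_nondeg e
    intro y
    simp only [map_sub, map_mul, Pi.sub_apply, Pi.mul_apply, sub_mul, Matrix.trace_sub, Finset.sum_sub_distrib]
    have h1 := hb (x * y)
    have h2 := hb (y * x)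
    rw [chr_comm, h2] at h1
    simp only [map_mul, Pi.mul_apply] at h1
    rw [sub_eq_zero]
    simp only [mul_assoc]
    rw [← h1]
    refine Finset.sum_congr rfl fun i _ => ?_
    rw [Matrix.trace_mul_comm, mul_assoc]
  choose c hc using central_scalar e b hc
  have key : ∀ k, ∃ r : ℕ, c k = r := by
    intro k
    let E : A := e.symm (Pi.single k (Matrix.single 0 0 1))
    have hE : E * E = E := by
      simp only [E, ← map_mul, ← Pi.single_mul]
      simp
    have h1 := trace_idem (Matrix.toLin' (ρ E)) (by rw [← Matrix.toLin'_mul, ← map_mul, hE])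
    rw [Matrix.trace_toLin'_eq] at h1
    refine ⟨Module.finrank K (Matrix.toLin' (ρ E)).range, ?_⟩
    · rw [← h1, ← chr_apply, hb, Finset.sum_eq_single k]
      · simp [E, hc]
      · intro j _ hj; simp [E, Pi.single_apply, hj]
      · simp
  choose N hN using key
  refine ⟨N, LinearMap.ext fun x => ?_⟩
  rw [hb]
  simp [hc, hN, chr_apply]
end decomp
end HP
end

section

open TensorProduct LinearMap Coalgebra
namespace HP
set_option linter.unusedSectionVars false

section kr
variable (K : Type*) [Field K] (ι ι' : Type*) [Fintype ι] [DecidableEq ι] [Fintype ι'] [DecidableEq ι']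
/-- bilinear Kronecker product -/
noncomputable def kr : Matrix ι ι K →ₗ[K] Matrix ι' ι' K →ₗ[K] Matrix (ι × ι') (ι × ι') K :=
  Matrix.kroneckerMapBilinear (Algebra.lmul K K).toLinearMap

theorem kr_one : kr K ι ι' 1 1 = 1 := Matrix.one_kronecker_one
theorem kr_mul (a : Matrix ι ι K) (b : Matrix ι' ι' K) (c : Matrix ι ι K) (d : Matrix ι' ι' K) :
    kr K ι ι' (a * c) (b * d) = kr K ι ι' a b * kr K ι ι' c d :=
  Matrix.mul_kronecker_mul a c b d
theorem kr_trace (a : Matrix ι ι K) (b : Matrix ι' ι' K) : (kr K ι ι' a b).trace = a.trace * b.trace :=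
  Matrix.trace_kronecker a b

/-- transpose -/
noncomputable def trl : Matrix ι ι K →ₗ[K] Matrix ι ι K := (Matrix.transposeLinearEquiv ι ι K K).toLinearMap
theorem trl_one : trl K ι 1 = 1 := Matrix.transpose_one
theorem trl_mul (a b : Matrix ι ι K) : trl K ι (a * b) = trl K ι b * trl K ι a := Matrix.transpose_mul a b
theorem trl_trace (a : Matrix ι ι K) : (trl K ι a).trace = a.trace := Matrix.trace_transpose a
end kr

namespace DD
variable {K H P E V A : Type*} [Field K] [CharZero K] [Ring H] [HopfAlgebra K H] [FiniteDimensional K H]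
    [Ring P] [HopfAlgebra K P] [FiniteDimensional K P] [Ring E] [Algebra K E]
    [AddCommGroup V] [Module K V] {π : HPair K H P} [Ring A] [Algebra K A] [FiniteDimensional K A] (D : DD π A)
  (hS : ∀ x : H, HopfAlgebra.antipode K (HopfAlgebra.antipode K x) = x) {Λ : H} (hΛ : IsInt K Λ)
  {ι ι' : Type*} [Fintype ι] [DecidableEq ι] [Fintype ι'] [DecidableEq ι']
local notation "S" => HopfAlgebra.antipode K

/-- tensor product of reps -/
noncomputable def tR (ρ : A →ₐ[K] Matrix ι ι K) (σ : A →ₐ[K] Matrix ι' ι' K) :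
    A →ₐ[K] Matrix (ι × ι') (ι × ι') K :=
  D.lift hS (YD.tens (kr K ι ι') (kr_one K ι ι') (kr_mul K ι ι') (D.yd.comp ρ) (D.yd.comp σ))

theorem tR_apply (ρ : A →ₐ[K] Matrix ι ι K) (σ : A →ₐ[K] Matrix ι' ι' K) (p : P) (h : H) :
    chr (D.tR hS ρ σ) (D.κ p * D.ι h) =
      sw K p fun u v => sw K h fun a b => chr ρ (D.κ v * D.ι a) * chr σ (D.κ u * D.ι b) := by
  rw [chr_apply, map_mul, tR, lift_ι, lift_κ, tensHom_apply, tensHom'_apply, sw_mul]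
  have : ∀ X : Matrix (ι × ι') (ι × ι') K, X.trace = Matrix.traceLinearMap _ K K X := fun _ => rfl
  rw [this, map_sw]
  refine sw_congr _ fun u v => ?_
  rw [mul_sw, map_sw]
  refine sw_congr _ fun a b => ?_
  rw [← this, ← kr_mul, kr_trace, chr_apply, chr_apply]
  simp

theorem zz_tR (ρ : A →ₐ[K] Matrix ι ι K) (σ : A →ₐ[K] Matrix ι' ι' K) :
    D.zz (chr (D.tR hS ρ σ)) = D.zz (chr ρ) * D.zz (chr σ) :=
  D.zz_mul hS (chr_comm ρ) _ _ (D.tR_apply hS ρ σ)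

/-- dual rep -/
noncomputable def dR (ρ : A →ₐ[K] Matrix ι ι K) : A →ₐ[K] Matrix ι ι K :=
  D.lift hS (YD.dual hS (trl K ι) (trl_one K ι) (trl_mul K ι) (D.yd.comp ρ))

theorem dR_apply (ρ : A →ₐ[K] Matrix ι ι K) (p : P) (h : H) :
    chr (D.dR hS ρ) (D.κ p * D.ι h) = chr ρ (D.ι (S h) * D.κ (S p)) := by
  rw [chr_apply, map_mul, dR, lift_ι, lift_κ, dualHom_apply, dualHom_apply, ← trl_mul, trl_trace, chr_apply]
  simp

include hS hΛ in
theorem tt_zz (ψ : A →ₗ[K] K) : 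
    tt K (D.zz ψ) = (Module.finrank K H : K) ^ 2 * ψ (D.κ (LamP π) * D.ι Λ) := by
  have hd := dim_ne hΛ
  rw [zz, map_dp]
  simp only [map_dp, map_smul, tt_comm (D.ι _)]
  calc _ = π.dp fun y q => π.B (LamP π) y • π.dp fun w r => π.B r Λ • ((Module.finrank K H : K) ^ 2 * ψ (D.κ q * D.ι w)) := by
        refine π.dp_congr fun y q => ?_
        rw [HPair.dp_map π (fun x => π.B (LamP π) y • x)]
        refine π.dp_congr fun w r => ?_
        rw [tt_apply, D.trace_κι hS hΛ, lamP π hΛ hS, B_LamP]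
        simp only [smul_eq_mul]
        field_simp
    _ = _ := by
        rw [HPair.dp_eval' π (LamP π) (fun q => π.dp fun w r => π.B r Λ • ((Module.finrank K H : K) ^ 2 * ψ (D.κ q * D.ι w)))]
        rw [HPair.dp_eval π Λ (fun w => ((Module.finrank K H : K) ^ 2 * ψ (D.κ (LamP π) * D.ι w)))]

variable {m : ℕ} {n : Fin m → ℕ} [∀ i, NeZero (n i)]
  (e : A ≃ₐ[K] Π i, Matrix (Fin (n i)) (Fin (n i)) K)

include hS hΛ in
theorem psi_one (M : Fin m) : chr (D.tR hS (rep e M) (D.dR hS (rep e M))) (D.κ (LamP π) * D.ι Λ) = 1 := by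
  classical
  have h := congrArg (chr (rep e M)) (D.casimir hS hΛ (e.symm (Pi.single M 1)))
  have hn : (n M : K) ≠ 0 := by exact_mod_cast NeZero.ne (n M)
  have h1 : chr (rep e M) (e.symm (Pi.single M 1)) = n M := by
    simp [chr_apply]
  have h2 : ∀ y, tt K (e.symm (Pi.single M 1) * y) = n M * chr (rep e M) y := by
    intro y
    rw [tt_apply, trace_L e, Finset.sum_eq_single M]
    · simp [chr_apply]
    · intro j _ hj; simp [hj]
    · simp
  rw [h1, map_sw] at h
  simp only [map_sw, map_smul, h2] at h
  rw [tR_apply]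
  simp only [dR_apply]
  have h3 : (n M : K) = n M * sw K (LamP π) fun u v => sw K Λ fun a b => 
      (chr (rep e M)) (D.κ v * D.ι a) * (chr (rep e M)) (D.ι (S b) * D.κ (S u)) := by
    refine h.trans ?_
    rw [mul_sw]
    refine sw_congr _ fun u v => ?_
    rw [mul_sw]
    refine sw_congr _ fun a b => ?_
    rw [smul_eq_mul, chr_comm _ (D.κ v), chr_comm _ (D.κ (S u)), mul_assoc]
  exact (mul_left_cancel₀ hn (by rw [mul_one]; exact h3)).symm

include hS hΛ D e in
theorem dim_dvd (M : Fin m) : n M ∣ Module.finrank K H := by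
  classical
  choose w hw using fun k => central_scalar e _ (D.zz_central hS (chr_comm (rep e k))) M
  choose w' hw' using fun k => central_scalar e _ (D.zz_central hS (chr_comm (D.dR hS (rep e k)))) M
  choose c hc using central_scalar e _ (D.zz_central hS (chr_comm (rep e M)))
  choose c' hc' using central_scalar e _ (D.zz_central hS (chr_comm (D.dR hS (rep e M))))
  have hnM : NeZero (n M) := inferInstance
  have inj : ∀ a b : K, a • (1 : Matrix (Fin (n M)) (Fin (n M)) K) = b • 1 → a = b := by
    intro a b h
    have := congrFun (congrFun h 0) 0
    simpa using this
  choose N hN using fun i j => decomp e (D.tR hS (rep e i) (rep e j))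
  choose N' hN' using fun i => decomp e (D.dR hS (rep e i))
  have hww : ∀ i j, w i * w j = ∑ k, (N i j k : K) * w k := by
    intro i j
    apply inj
    have := congrFun (congrArg e (D.zz_tR hS (rep e i) (rep e j))) M
    rw [hN, zz_sum, map_mul, Pi.mul_apply, hw, hw, map_sum, Finset.sum_apply] at this
    simp only [map_smul, Pi.smul_apply, hw] at this
    rw [Finset.sum_smul]
    simp only [mul_smul]
    rw [this]
    simp [smul_smul]
    rw [mul_comm]
  have hww' : ∀ i, w' i = ∑ k, (N' i k : K) * w k := by
    intro i
    apply inj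
    rw [← hw', hN', zz_sum, map_sum, Finset.sum_apply, Finset.sum_smul]
    simp only [map_smul, Pi.smul_apply, hw, mul_smul]
  have int1 : ∀ i, IsIntegral ℤ (w i) := integral_of_ring w N hww
  have int2 : ∀ i, IsIntegral ℤ (w' i) := by
    intro i
    rw [hww']
    refine IsIntegral.sum _ fun k _ => IsIntegral.mul ?_ (int1 k)
    exact_mod_cast isIntegral_algebraMap (R := ℤ) (A := K) (x := (N' i k : ℤ))
  refine dvd_of_integral (K := K) (s := ∑ k, w k * w' k) (NeZero.ne _)
    (IsIntegral.sum _ fun k _ => (int1 k).mul (int2 k)) ?_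
  have h1 := D.tt_zz hS hΛ (chr (D.tR hS (rep e M) (D.dR hS (rep e M))))
  rw [psi_one D hS hΛ, mul_one, zz_tR, tt_apply, trace_L e] at h1
  rw [← h1, Finset.mul_sum]
  refine Finset.sum_congr rfl fun k _ => ?_
  have e1 := D.zz_symm (chr_comm (rep e k)) _ (chr_comm (rep e M))
  have e2 := D.zz_symm' (chr_comm (rep e k)) (chr (rep e M)) _ _ (chr_comm (rep e M)) (D.dR_apply hS (rep e k)) (D.dR_apply hS (rep e M))
  simp only [chr_apply, rep_apply] at e1 e2
  rw [hc, hw] at e1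
  rw [hc', hw'] at e2
  simp only [Matrix.trace_smul, Matrix.trace_one, Fintype.card_fin, smul_eq_mul] at e1 e2
  rw [map_mul, Pi.mul_apply, hc, hc']
  simp only [smul_mul_smul_comm, mul_one, Matrix.trace_smul, Matrix.trace_one, Fintype.card_fin, smul_eq_mul]
  linear_combination (n k * c' k) * e1 + (w k * n M) * e2
end DD
end HP
end

section

open TensorProduct LinearMap Coalgebra
namespace HP
set_option linter.unusedSectionVars false

theorem S_sq {K H : Type*} [Field K] [CharZero K] [IsAlgClosed K] [Ring H] [HopfAlgebra K H]
    [FiniteDimensional K H] {Λ : H} (hΛ : IsInt K Λ) (x : H) :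
    HopfAlgebra.antipode K (HopfAlgebra.antipode K x) = x := by
  have := ss_of_int hΛ
  obtain ⟨m, n, hn, ⟨e⟩⟩ := IsSemisimpleRing.exists_algEquiv_pi_matrix_of_isAlgClosed K H
  exact SS_id e hΛ x

theorem cube_aux {K H P A : Type*} [Field K] [CharZero K] [IsAlgClosed K] [Ring H] [HopfAlgebra K H]
    [FiniteDimensional K H] [Ring P] [HopfAlgebra K P] [FiniteDimensional K P] {π : HPair K H P}
    [Ring A] [Algebra K A] (D : DD π A)
    (hS : ∀ x : H, HopfAlgebra.antipode K (HopfAlgebra.antipode K x) = x)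
    {Λ : H} (hΛ : IsInt K Λ) (x : H) :
    sweedlerPow K H (Module.finrank K H ^ 3) x = Coalgebra.counit (R := K) x • 1 := by
  have := D.fin
  have := D.semisimple hS hΛ
  obtain ⟨m, n, hn, ⟨e⟩⟩ := IsSemisimpleRing.exists_algEquiv_pi_matrix_of_isAlgClosed K A
  refine D.pow_of_vv hS _ ?_ x
  apply e.injective
  funext i
  choose t ht using central_scalar e _ (D.vv_central hS)
  rw [map_pow, Pi.pow_apply, ht, map_one, Pi.one_apply, smul_pow, one_pow]
  let j : A →ₐ[K] Module.End K (Fin (n i) → K) :=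
    Matrix.toLinAlgEquiv'.toAlgHom.comp (rep (n := n) e i)
  have hv : vv π (j.comp D.ι) (j.comp D.κ) = t i • 1 := by
    have h1 : j (vv π D.ι D.κ) = t i • 1 := by
      simp only [j, AlgHom.comp_apply, rep_apply, ht]
      rw [map_smul, map_one]
    rw [← h1]
    unfold vv
    rw [HPair.dp_map _ (fun x => j x)]
    simp
  have h2 := t_pow hS (D.yd.comp j) hv
  rw [Module.finrank_fin_fun] at h2
  obtain ⟨c, hc⟩ := D.dim_dvd hS hΛ e i
  have : t i ^ (Module.finrank K H ^ 3) = 1 := by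
    rw [show Module.finrank K H ^ 3 = Module.finrank K H ^ 2 * n i * c by rw [mul_assoc, ← hc]; ring, pow_mul, h2, one_pow]
  rw [this, one_smul]

theorem cube_closed {K H : Type*} [Field K] [CharZero K] [IsAlgClosed K] [Ring H] [HopfAlgebra K H]
    [FiniteDimensional K H] {Λ : H} (hΛ : IsInt K Λ) (x : H) :
    sweedlerPow K H (Module.finrank K H ^ 3) x = Coalgebra.counit (R := K) x • 1 :=
  cube_aux (DAdd (hdPair K H) (S_sq hΛ)) (S_sq hΛ) hΛ x

end HP
end

section

open TensorProduct LinearMap Coalgebra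
namespace HP
set_option linter.unusedSectionVars false

/-! ### Existence of a normalized integral -/

theorem exists_left_int {K R : Type*} [Field K] [Ring R] [Algebra K R] [IsSemisimpleRing R]
    (f : R →+* K) (hf : ∀ c : K, f (algebraMap K R c) = c) :
    ∃ j : R, f j = 1 ∧ ∀ h, h * j = f h • j := by
  obtain ⟨J, hJ⟩ := exists_isCompl (RingHom.ker f : Submodule R R)
  have h1 : (1 : R) ∈ (RingHom.ker f : Submodule R R) ⊔ J := by
    rw [hJ.sup_eq_top]; trivial
  obtain ⟨i, hi, j, hj, hij⟩ := Submodule.mem_sup.1 h1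
  have hfi : f i = 0 := hi
  have hfj : f j = 1 := by
    have := congrArg f hij
    rw [map_add, hfi, zero_add, map_one] at this
    exact this
  refine ⟨j, hfj, fun h => ?_⟩
  have hmem : (h - algebraMap K R (f h)) * j ∈ (RingHom.ker f : Submodule R R) ⊓ J := by
    refine ⟨?_, J.smul_mem _ hj⟩
    change f _ = 0
    rw [map_mul, map_sub, hf, sub_self, zero_mul]
  rw [hJ.inf_eq_bot, Submodule.mem_bot, sub_mul, sub_eq_zero] at hmem
  rw [hmem, Algebra.smul_def]

theorem exists_int (K H : Type*) [Field K] [Ring H] [HopfAlgebra K H] [IsSemisimpleRing H] :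
    ∃ Λ : H, IsInt K Λ := by
  let f : H →+* K := (Bialgebra.counitAlgHom K H).toRingHom
  have hf : ∀ c : K, f (algebraMap K H c) = c := fun c => by simp [f]
  have ff : ∀ x, f x = Coalgebra.counit (R := K) x := fun x => rfl
  obtain ⟨j, hj1, hj⟩ := exists_left_int f hf
  let g : Hᵐᵒᵖ →+* K := f.fromOpposite (fun x y => mul_comm _ _)
  obtain ⟨r, hr1, hr⟩ := exists_left_int (K := K) g (fun c => hf c)
  have hr' : ∀ h : H, r.unop * h = f h • r.unop := fun h => congrArg MulOpposite.unop (hr (.op h))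
  have e : r.unop = j := by
    have h1 := hr' j
    have h2 := hj r.unop
    rw [h1, hj1, one_smul] at h2
    rw [h2, show f r.unop = 1 from hr1, one_smul]
  rw [e] at hr'
  exact ⟨j, hj, hr', hj1⟩

/-! ### Base change -/
section BC
variable {K H : Type*} [Field K] [Ring H] [HopfAlgebra K H] (L : Type*) [Field L] [Algebra K L]

theorem int_bc {Λ : H} (hΛ : IsInt K Λ) : IsInt L ((1 : L) ⊗ₜ[K] Λ) := by
  constructor
  · intro h
    induction h with
    | zero => simp
    | add x y hx hy => rw [add_mul, hx, hy, map_add, add_smul]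
    | tmul a b =>
      rw [Algebra.TensorProduct.tmul_mul_tmul, hΛ.l, TensorProduct.counit_tmul, TensorProduct.smul_tmul',
        TensorProduct.tmul_smul, TensorProduct.smul_tmul']
      simp
  · intro h
    induction h with
    | zero => simp
    | add x y hx hy => rw [mul_add, hx, hy, map_add, add_smul]
    | tmul a b =>
      rw [Algebra.TensorProduct.tmul_mul_tmul, hΛ.r, TensorProduct.counit_tmul, TensorProduct.smul_tmul',
        TensorProduct.tmul_smul, TensorProduct.smul_tmul']
      simp
  · rw [TensorProduct.counit_tmul, hΛ.e]; simp

theorem sweedler_bc (N : ℕ) (h : H) :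
    sweedlerPow L (L ⊗[K] H) N ((1 : L) ⊗ₜ[K] h) = (1 : L) ⊗ₜ[K] sweedlerPow K H N h := by
  induction N generalizing h with
  | zero =>
    simp only [sweedlerPow, LinearMap.comp_apply, Algebra.linearMap_apply, TensorProduct.counit_tmul]
    rw [Algebra.algebraMap_eq_smul_one, Algebra.algebraMap_eq_smul_one, Algebra.TensorProduct.one_def,
      TensorProduct.tmul_smul, TensorProduct.smul_tmul']
    simp [TensorProduct.smul_tmul']
  | succ N ih =>
    simp only [sweedlerPow, LinearMap.comp_apply, TensorProduct.comul_tmul]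
    rw [show comul (R := L) (1 : L) = 1 ⊗ₜ[L] 1 from rfl]
    generalize comul (R := K) h = z
    induction z with
    | zero => simp
    | add x y hx hy => simp only [TensorProduct.tmul_add, map_add, hx, hy]
    | tmul a b => simp [ih]

theorem cube {K H : Type*} [Field K] [CharZero K] [Ring H] [HopfAlgebra K H]
    [FiniteDimensional K H] {Λ : H} (hΛ : IsInt K Λ) :
    sweedlerPow K H (Module.finrank K H ^ 3) = Algebra.linearMap K H ∘ₗ Coalgebra.counit := by
  ext x
  have : CharZero (AlgebraicClosure K) := charZero_of_injective_algebraMap (algebraMap K _).injective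
  have h1 := cube_closed (int_bc (AlgebraicClosure K) hΛ) (1 ⊗ₜ x)
  rw [Module.finrank_baseChange, sweedler_bc, TensorProduct.counit_tmul] at h1
  apply Algebra.TensorProduct.includeRight_injective (R := K) (A := AlgebraicClosure K) (B := H)
    (algebraMap K (AlgebraicClosure K)).injective
  simp only [Algebra.TensorProduct.includeRight_apply, LinearMap.comp_apply, Algebra.linearMap_apply]
  rw [h1, Algebra.algebraMap_eq_smul_one, Algebra.TensorProduct.one_def,
      TensorProduct.tmul_smul, TensorProduct.smul_tmul']
  simp [TensorProduct.smul_tmul']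
end BC

/-! ### Evaluation form powers -/
section EV
variable {K H : Type*} [Field K] [Ring H] [HopfAlgebra K H] [FiniteDimensional K H]

theorem dd_comul (φ : Module.Dual K H) :
    TensorProduct.dualDistrib K H H (dualComul K H φ) = φ ∘ₗ LinearMap.mul' K H := by
  change TensorProduct.dualDistribEquiv K H H ((TensorProduct.dualDistribEquiv K H H).symm _) = _
  rw [LinearEquiv.apply_symm_apply]; rfl

theorem ev_aux (f : (Module.Dual K H ⊗[K] H) →ₗ[K] K) (R : H →ₗ[K] H)
    (hf : ∀ φ h, f (φ ⊗ₜ h) = φ (R h)) (ζ : Module.Dual K H ⊗[K] Module.Dual K H) (w : H ⊗[K] H) :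
    LinearMap.mul' K K (TensorProduct.map f (evalForm K H)
      (TensorProduct.tensorTensorTensorComm K _ _ _ _ ((TensorProduct.comm K _ _ ζ) ⊗ₜ w))) =
    TensorProduct.dualDistrib K H H ζ (TensorProduct.comm K _ _ (R.rTensor H w)) := by
  induction ζ with
  | zero => simp
  | add x y hx hy => simp only [map_add, TensorProduct.add_tmul, LinearMap.add_apply, hx, hy]
  | tmul a b =>
    induction w with
    | zero => simp
    | add x y hx hy => simp only [map_add, TensorProduct.tmul_add, hx, hy]
    | tmul x y => simp [hf, evalForm, mul_comm]

theorem ev_pow (m : ℕ) (φ : Module.Dual K H) (h : H) :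
    evalFormPow K H m (φ ⊗ₜ h) = φ (revSweedlerPow K H m h) := by
  induction m generalizing φ h with
  | zero => simp [evalFormPow, revSweedlerPow, counitD, Algebra.algebraMap_eq_smul_one, mul_comm]
  | succ m ih =>
    simp only [evalFormPow, convD, comulD, LinearMap.comp_apply, TensorProduct.map_tmul,
      LinearEquiv.coe_coe]
    rw [ev_aux _ _ ih, dd_comul]
    rfl

theorem ev_iff (m : ℕ) : evalFormPow K H m = counitD K H ↔
    revSweedlerPow K H m = Algebra.linearMap K H ∘ₗ Coalgebra.counit := by
  have h0 : counitD K H = evalFormPow K H 0 := rfl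
  have h1 : Algebra.linearMap K H ∘ₗ Coalgebra.counit = revSweedlerPow K H 0 := rfl
  rw [h0, h1]
  constructor
  · intro e
    ext h
    refine (Module.forall_dual_apply_eq_zero_iff K _).1 ?_ |> sub_eq_zero.1
    intro φ
    rw [map_sub, ← ev_pow, ← ev_pow, e, sub_self]
  · intro e
    ext φ h
    simp only [TensorProduct.AlgebraTensorModule.curry_apply, TensorProduct.curry_apply,
      LinearMap.restrictScalars_self, ev_pow, e]

open WithConv in
theorem sw_conv (m : ℕ) : toConv (sweedlerPow K H m) = toConv (LinearMap.id : H →ₗ[K] H) ^ m := by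
  induction m with
  | zero => rfl
  | succ m ih =>
    rw [pow_succ', ← ih]; rfl

open WithConv in
theorem rev_conv (m : ℕ) : toConv (HopfAlgebra.antipode K (A := H) ∘ₗ revSweedlerPow K H m) =
    toConv (HopfAlgebra.antipode K (A := H)) ^ m := by
  induction m with
  | zero =>
    rw [pow_zero]
    ext h
    simp [revSweedlerPow, Algebra.algebraMap_eq_smul_one, HopfAlgebra.antipode_one]
  | succ m ih =>
    rw [pow_succ, ← ih]
    ext h
    simp only [revSweedlerPow, LinearMap.convMul_apply, LinearMap.comp_apply, LinearEquiv.coe_coe]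
    change HopfAlgebra.antipode K _ = _
    generalize comul (R := K) h = z
    induction z with
    | zero => simp
    | add x y hx hy => simp only [map_add, hx, hy]
    | tmul a b => simp [S_mul]

open WithConv in
theorem rev_iff {Λ : H} (hΛ : IsInt K Λ) (m : ℕ) :
    revSweedlerPow K H m = Algebra.linearMap K H ∘ₗ Coalgebra.counit ↔
    sweedlerPow K H m = Algebra.linearMap K H ∘ₗ Coalgebra.counit := by
  let u : (WithConv (H →ₗ[K] H))ˣ := ⟨toConv LinearMap.id, toConv (HopfAlgebra.antipode K),
    by simp, by simp⟩
  have h1 : sweedlerPow K H m = Algebra.linearMap K H ∘ₗ Coalgebra.counit ↔ u ^ m = 1 := by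
    rw [← Units.val_inj, Units.val_pow_eq_pow_val, ← toConv_injective.eq_iff, sw_conv]; rfl
  have h2 : revSweedlerPow K H m = Algebra.linearMap K H ∘ₗ Coalgebra.counit ↔ u⁻¹ ^ m = 1 := by
    rw [← Units.val_inj, Units.val_pow_eq_pow_val]
    change _ ↔ toConv (HopfAlgebra.antipode K (A := H)) ^ m = toConv (HopfAlgebra.antipode K (A := H)) ^ 0
    rw [← rev_conv, ← rev_conv, toConv_injective.eq_iff]
    constructor
    · intro e; rw [e]; rfl
    · intro e
      ext h
      exact S_inj hΛ (LinearMap.congr_fun e h)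
  rw [h1, h2, inv_pow, inv_eq_one]

open WithConv in
theorem sw_one_iff (m : ℕ) : sweedlerPow K H m = Algebra.linearMap K H ∘ₗ Coalgebra.counit ↔
    toConv (LinearMap.id : H →ₗ[K] H) ^ m = 1 := by
  rw [← toConv_injective.eq_iff, sw_conv]; rfl

end EV

theorem final {K H : Type*} [Field K] [CharZero K] [Ring H] [HopfAlgebra K H]
    [FiniteDimensional K H] [IsSemisimpleRing H]
    (n : ℕ)
    (hn : IsLeast {m : ℕ | 0 < m ∧
      sweedlerPow K H m = Algebra.linearMap K H ∘ₗ Coalgebra.counit} n) :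
    IsLeast {m : ℕ | 0 < m ∧ evalFormPow K H m = counitD K H} n ∧
      n ∣ (Module.finrank K H) ^ 3 := by
  obtain ⟨Λ, hΛ⟩ := exists_int K H
  refine ⟨by simpa only [ev_iff, rev_iff hΛ] using hn, ?_⟩
  have hc := (sw_one_iff _).1 (cube hΛ)
  have hd := orderOf_dvd_of_pow_eq_one hc
  have hp : 0 < orderOf (WithConv.toConv (LinearMap.id : H →ₗ[K] H)) :=
    orderOf_pos_iff.2 (isOfFinOrder_iff_pow_eq_one.2 ⟨n, hn.1.1, (sw_one_iff _).1 hn.1.2⟩)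
  have h1 := hn.2 ⟨hp, (sw_one_iff _).2 (pow_orderOf_eq_one _)⟩
  have h2 := Nat.le_of_dvd hn.1.1 (orderOf_dvd_of_pow_eq_one ((sw_one_iff n).1 hn.1.2))
  rwa [le_antisymm h1 h2]

end HP
end

/-- Suppose `H` is a semisimple Hopf algebra over a field of
characteristic zero.  Then the order of the evaluation form `e` in the group of
invertible elements of the convolution algebra `D(H)*` (i.e. the least `m > 0` with
`e^m = ε_{D(H)}`) is equal to the exponent `n` of `H` (the least `n > 0` such that
`h₍₁₎ h₍₂₎ ⋯ h₍ₙ₎ = ε(h)1` for all `h`).  In particular, the order of `e` divides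
`(dim H)³`. -/
theorem order_evalForm_eq_exponent
    {K H : Type*} [Field K] [CharZero K] [Ring H] [HopfAlgebra K H]
    [FiniteDimensional K H] [IsSemisimpleRing H]
    (n : ℕ)
    (hn : IsLeast {m : ℕ | 0 < m ∧
      sweedlerPow K H m = Algebra.linearMap K H ∘ₗ Coalgebra.counit} n) :
    IsLeast {m : ℕ | 0 < m ∧ evalFormPow K H m = counitD K H} n ∧
      n ∣ (Module.finrank K H) ^ 3 := by
  exact HP.final n hn
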